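/- Suppose p ≡ 1 (mod 3). Then F[V]^{SL2(F_p)} is generated as an F-algebra by the invariants D, K, L, N·a0, δ = tr_B^G(N^{(p−1)/3}), ẽ = tr_B^G(N·e), together with the transfers tr^G(N^j a2^{(m−1)(p−1)−3j} a3^{p−1}) for j = 1, …, (p−4)/3; tr^G(N^j a3^{p−1−j}) for j = 1, …, (p−4)/3; and tr^G(N^j a3^{p−2} a2^{(m−1)(p−1)+3−3j}) for j = 2, …, (p−4)/3, where in each case m = 2 + ⌊3j/(p−1)⌋. -/

import Mathlib

open MvPolynomial

noncomputable section

/-- The right action of the 2×2 matrix `g` over `F_p` on `F[V] = F[a₃,a₂,a₁,a₀]`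
(with `aᵢ = X i`), given by the dual of the third symmetric power representation. -/
def act (p : ℕ) [Fact p.Prime] (F : Type) [Field F] [CharP F p]
    (g : Matrix (Fin 2) (Fin 2) (ZMod p)) :
    MvPolynomial (Fin 4) F →ₐ[F] MvPolynomial (Fin 4) F :=
  letI c : ZMod p → MvPolynomial (Fin 4) F := fun x => C (ZMod.castHom (dvd_refl p) F x)
  letI al := c (g 0 0)
  letI be := c (g 0 1)
  letI ga := c (g 1 0)
  letI de := c (g 1 1)
  aeval ![
    de ^ 3 * X 0 + 3 * de ^ 2 * ga * X 1 + 3 * de * ga ^ 2 * X 2 + ga ^ 3 * X 3,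
    de ^ 2 * be * X 0 + (de ^ 2 * al + 2 * de * be * ga) * X 1
      + (2 * de * ga * al + be * ga ^ 2) * X 2 + ga ^ 2 * al * X 3,
    de * be ^ 2 * X 0 + (2 * de * be * al + be ^ 2 * ga) * X 1
      + (de * al ^ 2 + 2 * be * ga * al) * X 2 + ga * al ^ 2 * X 3,
    be ^ 3 * X 0 + 3 * be ^ 2 * al * X 1 + 3 * be * al ^ 2 * X 2 + al ^ 3 * X 3]

/-- The transfer with respect to the Sylow `p`-subgroup `P = ⟨σ⟩`,
`tr^P(f) = ∑_{τ ∈ P} (f)τ`, where the elements of `P` are the matrices `[[1,s],[0,1]]`. -/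
def trP (p : ℕ) [Fact p.Prime] (F : Type) [Field F] [CharP F p]
    (f : MvPolynomial (Fin 4) F) : MvPolynomial (Fin 4) F :=
  ∑ s : ZMod p, act p F !![1, s; 0, 1] f

/-- The relative transfer `tr_B^G(f) = ∑_{τ ∈ Q ∪ {η}} (f)τ`, using the coset
representatives `Q ∪ {η}` of the Borel subgroup `B` in `G = SL₂(F_p)`. -/
def trBG (p : ℕ) [Fact p.Prime] (F : Type) [Field F] [CharP F p]
    (f : MvPolynomial (Fin 4) F) : MvPolynomial (Fin 4) F :=
  (∑ s : ZMod p, act p F !![1, 0; s, 1] f) + act p F !![0, 1; -1, 0] f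

/-- The full transfer `tr^G(f) = ∑_{τ ∈ SL₂(F_p)} (f)τ`. -/
def trG (p : ℕ) [Fact p.Prime] (F : Type) [Field F] [CharP F p]
    (f : MvPolynomial (Fin 4) F) : MvPolynomial (Fin 4) F :=
  ∑ g : Matrix.SpecialLinearGroup (Fin 2) (ZMod p), act p F g.1 f

/-- `N = ∏_{τ ∈ P} (a₃)τ = ∏_{s ∈ F_p} (a₃ + 3s a₂ + 3s² a₁ + s³ a₀)`. -/
def Npoly (p : ℕ) [Fact p.Prime] (F : Type) [Field F] [CharP F p] :
    MvPolynomial (Fin 4) F :=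
  ∏ s : ZMod p, act p F !![1, s; 0, 1] (X 3)

/-- The weight of the monomial `a₃^e₃ a₂^e₂ a₁^e₁ a₀^e₀`, i.e. `3e₃ + e₂ - e₁ - 3e₀`. -/
def wt (d : Fin 4 →₀ ℕ) : ℤ :=
  3 * (d 3 : ℤ) + (d 2 : ℤ) - (d 1 : ℤ) - 3 * (d 0 : ℤ)

/-- `f` is isobaric of weight `lam` modulo `p - 1`: every monomial occurring in `f`
has weight congruent to `lam` modulo `p - 1`. -/
def Isobaric (p : ℕ) {F : Type} [Field F] (f : MvPolynomial (Fin 4) F) (lam : ℤ) : Prop :=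
  ∀ d ∈ f.support, ((p : ℤ) - 1) ∣ (wt d - lam)

/-- Strict grevlex comparison on exponent vectors, for the graded reverse
lexicographic order with `a₀ < a₁ < a₂ < a₃`. -/
def grevlexLt (d e : Fin 4 →₀ ℕ) : Prop :=
  (∑ i : Fin 4, d i) < (∑ i : Fin 4, e i) ∨
    ((∑ i : Fin 4, d i) = (∑ i : Fin 4, e i) ∧
      ∃ k : Fin 4, e k < d k ∧ ∀ j : Fin 4, j < k → d j = e j)

/-- `d` is the lead monomial of `f` in the grevlex order with `a₀ < a₁ < a₂ < a₃`. -/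
def LeadMonomialIs {F : Type} [Field F] (f : MvPolynomial (Fin 4) F) (d : Fin 4 →₀ ℕ) : Prop :=
  coeff d f ≠ 0 ∧ ∀ e ∈ f.support, e ≠ d → grevlexLt e d

/-- The lead term of `f` is `c · x^d` in the grevlex order with `a₀ < a₁ < a₂ < a₃`. -/
def LeadTermIs {F : Type} [Field F] (f : MvPolynomial (Fin 4) F) (c : F) (d : Fin 4 →₀ ℕ) :
    Prop :=
  LeadMonomialIs f d ∧ coeff d f = c

/-- The discriminant `D` of the binary cubic. -/
def Dpoly (F : Type) [Field F] : MvPolynomial (Fin 4) F :=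
  3 * X 2 ^ 2 * X 1 ^ 2 - 4 * X 3 * X 1 ^ 3 - 4 * X 2 ^ 3 * X 0
    + 6 * X 3 * X 2 * X 1 * X 0 - X 3 ^ 2 * X 0 ^ 2

/-- `K = -tr^G(a₁^{p-1})`. -/
def Kpoly (p : ℕ) [Fact p.Prime] (F : Type) [Field F] [CharP F p] :
    MvPolynomial (Fin 4) F :=
  - trG p F (X 1 ^ (p - 1))

/-- Dickson's invariant `L = 3(a₂^p a₁ - a₂ a₁^p) - (a₃^p a₀ - a₃ a₀^p)`. -/
def Lpoly (p : ℕ) (F : Type) [Field F] : MvPolynomial (Fin 4) F :=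
  3 * (X 2 ^ p * X 1 - X 2 * X 1 ^ p) - (X 3 ^ p * X 0 - X 3 * X 0 ^ p)

/-- `e = 2a₁³ + a₀(a₃a₀ - 3a₂a₁)`. -/
def epoly (F : Type) [Field F] : MvPolynomial (Fin 4) F :=
  2 * X 1 ^ 3 + X 0 * (X 3 * X 0 - 3 * X 2 * X 1)

/-- `d = a₁² - a₂a₀`. -/
def dpoly (F : Type) [Field F] : MvPolynomial (Fin 4) F :=
  X 1 ^ 2 - X 2 * X 0

/-- `ξ = 3a₂² - 4a₃a₁`. -/
def xipoly (F : Type) [Field F] : MvPolynomial (Fin 4) F :=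
  3 * X 2 ^ 2 - 4 * X 3 * X 1

/-- The ring of `SL₂(F_p)`-invariants `F[V]^{SL₂(F_p)}`, as a subalgebra of `F[V]`. -/
def invariants (p : ℕ) [Fact p.Prime] (F : Type) [Field F] [CharP F p] :
    Subalgebra F (MvPolynomial (Fin 4) F) where
  carrier := {f | ∀ g : Matrix.SpecialLinearGroup (Fin 2) (ZMod p), act p F g.1 f = f}
  mul_mem' := fun hf hg g => by rw [map_mul, hf g, hg g]
  one_mem' := fun g => map_one _
  add_mem' := fun hf hg g => by rw [map_add, hf g, hg g]
  zero_mem' := fun g => map_zero _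
  algebraMap_mem' := fun c g => (act _ _ _).commutes c

section S1
variable {p : ℕ} [Fact p.Prime] {F : Type} [Field F] [CharP F p]

/-- the structural map from `ZMod p` to `F` -/
def cF (p : ℕ) (F : Type) [Field F] [CharP F p] : ZMod p →+* F := ZMod.castHom (dvd_refl p) F

/-- action on points -/
def ptAct (p : ℕ) (F : Type) [Field F] [CharP F p] {S : Type*} [CommRing S] [Algebra F S]
    (g : Matrix (Fin 2) (Fin 2) (ZMod p)) (x : Fin 4 → S) : Fin 4 → S :=
  letI c : ZMod p → S := fun y => algebraMap F S (cF p F y)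
  letI al := c (g 0 0)
  letI be := c (g 0 1)
  letI ga := c (g 1 0)
  letI de := c (g 1 1)
  ![de ^ 3 * x 0 + 3 * de ^ 2 * ga * x 1 + 3 * de * ga ^ 2 * x 2 + ga ^ 3 * x 3,
    de ^ 2 * be * x 0 + (de ^ 2 * al + 2 * de * be * ga) * x 1
      + (2 * de * ga * al + be * ga ^ 2) * x 2 + ga ^ 2 * al * x 3,
    de * be ^ 2 * x 0 + (2 * de * be * al + be ^ 2 * ga) * x 1
      + (de * al ^ 2 + 2 * be * ga * al) * x 2 + ga * al ^ 2 * x 3,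
    be ^ 3 * x 0 + 3 * be ^ 2 * al * x 1 + 3 * be * al ^ 2 * x 2 + al ^ 3 * x 3]

lemma act_def (g : Matrix (Fin 2) (Fin 2) (ZMod p)) :
    act p F g = aeval (ptAct p F g (X : Fin 4 → MvPolynomial (Fin 4) F)) := rfl

lemma aeval_act {S : Type*} [CommRing S] [Algebra F S] (x : Fin 4 → S)
    (g : Matrix (Fin 2) (Fin 2) (ZMod p)) (f : MvPolynomial (Fin 4) F) :
    aeval x (act p F g f) = aeval (ptAct p F g x) f := by
  have : (aeval x).comp (act p F g) = aeval (ptAct p F g x) := by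
    apply MvPolynomial.algHom_ext
    intro i
    rw [act_def]
    fin_cases i <;> simp [ptAct]
  rw [← this]; rfl

lemma ptAct_ptAct {S : Type*} [CommRing S] [Algebra F S] (x : Fin 4 → S)
    (g h : Matrix (Fin 2) (Fin 2) (ZMod p)) :
    ptAct p F h (ptAct p F g x) = ptAct p F (h * g) x := by
  funext i
  fin_cases i <;> simp [ptAct, Matrix.mul_apply, Fin.sum_univ_two] <;> ring

lemma act_act (g h : Matrix (Fin 2) (Fin 2) (ZMod p)) (f : MvPolynomial (Fin 4) F) :
    act p F g (act p F h f) = act p F (h * g) f := by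
  rw [act_def g, aeval_act, ptAct_ptAct, ← act_def]

lemma ptAct_one {S : Type*} [CommRing S] [Algebra F S] (x : Fin 4 → S) :
    ptAct p F 1 x = x := by
  funext i
  fin_cases i <;> simp [ptAct]

lemma act_one (f : MvPolynomial (Fin 4) F) : act p F 1 f = f := by
  rw [act_def, ptAct_one]; exact aeval_X_left_apply f

lemma ptAct_u {S : Type*} [CommRing S] [Algebra F S] (x : Fin 4 → S) (s : ZMod p) :
    ptAct p F !![1, s; 0, 1] x = ![x 0, x 1 + algebraMap F S (cF p F s) * x 0,
      x 2 + 2 * algebraMap F S (cF p F s) * x 1 + algebraMap F S (cF p F s) ^ 2 * x 0,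
      x 3 + 3 * algebraMap F S (cF p F s) * x 2 + 3 * algebraMap F S (cF p F s) ^ 2 * x 1 +
        algebraMap F S (cF p F s) ^ 3 * x 0] := by
  funext i
  fin_cases i <;> simp [ptAct] <;> ring

lemma ptAct_low {S : Type*} [CommRing S] [Algebra F S] (x : Fin 4 → S) (s : ZMod p) :
    ptAct p F !![1, 0; s, 1] x =
     ![x 0 + 3 * algebraMap F S (cF p F s) * x 1 + 3 * algebraMap F S (cF p F s) ^ 2 * x 2 +
        algebraMap F S (cF p F s) ^ 3 * x 3,
       x 1 + 2 * algebraMap F S (cF p F s) * x 2 + algebraMap F S (cF p F s) ^ 2 * x 3,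
       x 2 + algebraMap F S (cF p F s) * x 3, x 3] := by
  funext i
  fin_cases i <;> simp [ptAct] 

lemma ptAct_eta {S : Type*} [CommRing S] [Algebra F S] (x : Fin 4 → S) :
    ptAct p F !![0, 1; -1, 0] x = ![-x 3, x 2, -x 1, x 0] := by
  funext i
  fin_cases i <;> simp [ptAct]
  ring

lemma ptAct_rho {S : Type*} [CommRing S] [Algebra F S] (x : Fin 4 → S) (w : ZMod p) (hw : w ≠ 0) :
    ptAct p F !![w, 0; 0, w⁻¹] x =
     ![algebraMap F S (cF p F w⁻¹) ^ 3 * x 0,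
       algebraMap F S (cF p F w⁻¹) * x 1,
       algebraMap F S (cF p F w) * x 2,
       algebraMap F S (cF p F w) ^ 3 * x 3] := by
  have h : algebraMap F S (cF p F w⁻¹) * algebraMap F S (cF p F w) = 1 := by
    rw [← map_mul, ← map_mul]; simp [hw]
  funext i
  fin_cases i <;> simp only [ptAct] <;> simp [-map_inv₀]
  · linear_combination (algebraMap F S (cF p F w⁻¹) * x 1) * h
  · linear_combination (algebraMap F S (cF p F w) * x 2) * h

lemma low_eq (t : ZMod p) : (!![1, 0; t, 1] : Matrix (Fin 2) (Fin 2) (ZMod p)) =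
      !![0, 1; -1, 0] * !![1, -t; 0, 1] * !![0, 1; -1, 0] * !![0, 1; -1, 0] * !![0, 1; -1, 0] := by
  simp

lemma u_eq (t : ZMod p) : (!![1, t; 0, 1] : Matrix (Fin 2) (Fin 2) (ZMod p)) =
      !![0, 1; -1, 0] * !![1, 0; -t, 1] * !![0, 1; -1, 0] * !![0, 1; -1, 0] * !![0, 1; -1, 0] := by
  simp

lemma gauss_eq (g : Matrix (Fin 2) (Fin 2) (ZMod p)) (hg : g 1 0 ≠ 0) (hd : g.det = 1) :
    g = !![1, (g 0 0 - 1) / g 1 0; 0, 1] * !![1, 0; g 1 0, 1] *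
        !![1, (g 1 1 - 1) / g 1 0; 0, 1] := by
  rw [Matrix.det_fin_two] at hd
  ext i j
  fin_cases i <;> fin_cases j <;> simp <;> field_simp <;> try ring
  linear_combination -hd

lemma mem_inv_of_u_eta {f : MvPolynomial (Fin 4) F} (hu : ∀ t, act p F !![1, t; 0, 1] f = f)
    (he : act p F !![0, 1; -1, 0] f = f) : f ∈ invariants p F := by
  have hl : ∀ t, act p F !![1, 0; t, 1] f = f := by
    intro t
    rw [low_eq, ← act_act, ← act_act, ← act_act, ← act_act, he, hu, he, he, he]
  have key : ∀ g : Matrix (Fin 2) (Fin 2) (ZMod p), g 1 0 ≠ 0 → g.det = 1 → act p F g f = f := by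
    intro g hg hd
    rw [gauss_eq g hg hd, ← act_act, ← act_act, hu, hl, hu]
  intro g
  by_cases hg : g.1 1 0 = 0
  · have hd := g.2
    have h1 : act p F (g.1 * !![1, 0; 1, 1]) f = f := by
      apply key
      · rw [Matrix.det_fin_two, hg] at hd
        simp [Matrix.mul_apply, Fin.sum_univ_two, hg]
        intro h; simp [h] at hd
      · rw [Matrix.det_mul, g.2]; simp [Matrix.det_fin_two]
    have h2 := congrArg (act p F !![1, 0; -1, 1]) h1
    have h3 : (!![1, 0; 1, 1] : Matrix (Fin 2) (Fin 2) (ZMod p)) * !![1, 0; -1, 1] = 1 := by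
      simp [Matrix.one_fin_two]
    rw [hl, act_act, Matrix.mul_assoc, h3, mul_one] at h2
    exact h2
  · exact key _ hg g.2

lemma trG_mem (f : MvPolynomial (Fin 4) F) : trG p F f ∈ invariants p F := by
  intro h
  unfold trG
  rw [map_sum]
  simp_rw [act_act]
  exact Fintype.sum_equiv (Equiv.mulRight h) _ _ (fun g => rfl)

lemma borel_eq (w s : ZMod p) (hw : w ≠ 0) : (!![w, s; 0, w⁻¹] : Matrix (Fin 2) (Fin 2) (ZMod p)) =
      !![w, 0; 0, w⁻¹] * !![1, w⁻¹ * s; 0, 1] := by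
  simp [hw]

lemma lowη_eq (s : ZMod p) (hs : s ≠ 0) :
    (!![1, 0; s, 1] * !![0, 1; -1, 0] : Matrix (Fin 2) (Fin 2) (ZMod p)) =
      !![s⁻¹, 1; 0, s⁻¹⁻¹] * !![1, 0; -s⁻¹, 1] := by
  simp [hs]

lemma ηη_eq : (!![0, 1; -1, 0] * !![0, 1; -1, 0] : Matrix (Fin 2) (Fin 2) (ZMod p)) =
      !![-1, 0; 0, (-1)⁻¹] * !![1, 0; 0, 1] := by
  simp [inv_neg]

lemma ηlow_eq (t : ZMod p) : (!![0, 1; -1, 0] * !![1, 0; t, 1] : Matrix (Fin 2) (Fin 2) (ZMod p)) =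
      !![1, -t; 0, 1⁻¹] * !![0, 1; -1, 0] := by
  simp

lemma one_eq : (!![1, 0; 0, 1] : Matrix (Fin 2) (Fin 2) (ZMod p)) = 1 := by
  rw [Matrix.one_fin_two]

lemma act_borel_mul {f : MvPolynomial (Fin 4) F} (hu : ∀ t, act p F !![1, t; 0, 1] f = f)
    (hr : ∀ w : ZMod p, w ≠ 0 → act p F !![w, 0; 0, w⁻¹] f = f)
    (w s : ZMod p) (hw : w ≠ 0) (g : Matrix (Fin 2) (Fin 2) (ZMod p)) :
      act p F (!![w, s; 0, w⁻¹] * g) f = act p F g f := by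
  rw [borel_eq w s hw, ← act_act, ← act_act, hr w hw, hu]

lemma trBG_eta {f : MvPolynomial (Fin 4) F} (hu : ∀ t, act p F !![1, t; 0, 1] f = f)
    (hr : ∀ w : ZMod p, w ≠ 0 → act p F !![w, 0; 0, w⁻¹] f = f) :
    act p F !![0, 1; -1, 0] (trBG p F f) = trBG p F f := by
  have hb := act_borel_mul hu hr
  unfold trBG
  rw [map_add, map_sum]
  simp_rw [act_act]
  have h1 : ∀ s : ZMod p, act p F (!![1, 0; s, 1] * !![0, 1; -1, 0]) f =
      act p F !![1, 0; -s⁻¹, 1] f + if s = 0 then act p F !![0, 1; -1, 0] f - f else 0 := by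
    intro s
    split_ifs with hs
    · subst hs
      simp only [inv_zero, neg_zero, one_eq, one_mul, act_one]; ring
    · rw [add_zero, lowη_eq s hs, hb _ _ (inv_ne_zero hs)]
  have h2 : ∑ s : ZMod p, act p F !![1, 0; -s⁻¹, 1] f = ∑ s : ZMod p, act p F !![1, 0; s, 1] f :=
    Fintype.sum_equiv ⟨fun s => -s⁻¹, fun s => -s⁻¹, fun s => by simp [inv_neg],
      fun s => by simp [inv_neg]⟩ _ _ (fun s => rfl)
  have h3 : act p F (!![0, 1; -1, 0] * !![0, 1; -1, 0]) f = f := by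
    rw [ηη_eq, hb _ _ (by simp), one_eq, act_one]
  rw [Finset.sum_congr rfl (fun s _ => h1 s), Finset.sum_add_distrib,
    Finset.sum_ite_eq' Finset.univ (0 : ZMod p), h2, h3]
  simp only [Finset.mem_univ, if_true]
  ring

lemma trBG_low {f : MvPolynomial (Fin 4) F} (hu : ∀ t, act p F !![1, t; 0, 1] f = f)
    (hr : ∀ w : ZMod p, w ≠ 0 → act p F !![w, 0; 0, w⁻¹] f = f) (t : ZMod p) :
    act p F !![1, 0; t, 1] (trBG p F f) = trBG p F f := by
  have hb := act_borel_mul hu hr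
  have h1 : ∀ s : ZMod p, (!![1, 0; s, 1] * !![1, 0; t, 1] : Matrix (Fin 2) (Fin 2) (ZMod p)) =
      !![1, 0; s + t, 1] := by intro s; simp
  unfold trBG
  rw [map_add, map_sum, act_act, ηlow_eq, hb _ _ one_ne_zero]
  simp_rw [act_act, h1]
  have h2 := Equiv.sum_comp (Equiv.addRight t) (fun s => act p F !![1, 0; s, 1] f)
  simp only [Equiv.coe_addRight] at h2
  rw [h2]

lemma trBG_mem {f : MvPolynomial (Fin 4) F} (hu : ∀ t, act p F !![1, t; 0, 1] f = f)
    (hr : ∀ w : ZMod p, w ≠ 0 → act p F !![w, 0; 0, w⁻¹] f = f) :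
    trBG p F f ∈ invariants p F := by
  have hη := trBG_eta hu hr
  have hl := trBG_low hu hr
  apply mem_inv_of_u_eta _ hη
  intro t
  rw [u_eq, ← act_act, ← act_act, ← act_act, ← act_act, hη, hl, hη, hη, hη]

/-- parametrisation of `SL2` by Borel cosets -/
def bruhat (x : (ZMod p)ˣ × ZMod p × Option (ZMod p)) : Matrix.SpecialLinearGroup (Fin 2) (ZMod p) :=
  match x with
  | (w, s, some t) => ⟨!![(w : ZMod p), s; 0, (w : ZMod p)⁻¹] * !![1, 0; t, 1], by
      rw [Matrix.det_mul]; simp [Matrix.det_fin_two, -ZMod.inv_coe_unit]⟩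
  | (w, s, none) => ⟨!![(w : ZMod p), s; 0, (w : ZMod p)⁻¹] * !![0, 1; -1, 0], by
      rw [Matrix.det_mul]; simp [Matrix.det_fin_two, -ZMod.inv_coe_unit]⟩

lemma bruhat_some (w : (ZMod p)ˣ) (s t : ZMod p) : (bruhat (w, s, some t)).1 =
    !![(w : ZMod p) + s * t, s; (w : ZMod p)⁻¹ * t, (w : ZMod p)⁻¹] := by
  simp [bruhat, -ZMod.inv_coe_unit]

lemma bruhat_none (w : (ZMod p)ˣ) (s : ZMod p) : (bruhat (w, s, none)).1 =
    !![-s, (w : ZMod p); -(w : ZMod p)⁻¹, 0] := by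
  simp [bruhat, -ZMod.inv_coe_unit]

lemma bruhat_inj : Function.Injective (bruhat (p := p)) := by
  rintro ⟨w, s, t⟩ ⟨w', s', t'⟩ h
  have h' := congrArg Subtype.val h
  have hw : (w : ZMod p) ≠ 0 := w.ne_zero
  have hw' : (w' : ZMod p) ≠ 0 := w'.ne_zero
  have e := fun i j => congrFun (congrFun h' i) j
  have e1 := e 0 0
  have e2 := e 0 1
  have e3 := e 1 0
  have e4 := e 1 1
  rcases t with _ | t <;> rcases t' with _ | t' <;>
    simp only [bruhat_some, bruhat_none] at e1 e2 e3 e4 <;> simp [-ZMod.inv_coe_unit] at e1 e2 e3 e4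
  · simp [e1, Units.ext_iff, e2]
  · exact absurd e4.symm hw'
  · have : w = w' := Units.ext e4
    subst this
    have e5 : t = t' := mul_left_cancel₀ (inv_ne_zero hw) e3
    rw [e5, e2]

lemma bruhat_surj : Function.Surjective (bruhat (p := p)) := by
  intro g
  have hd := g.2
  rw [Matrix.det_fin_two] at hd
  by_cases h : g.1 1 1 = 0
  · rw [h] at hd
    have hb : g.1 0 1 ≠ 0 := by intro h0; simp [h0] at hd
    refine ⟨(Units.mk0 _ hb, -g.1 0 0, none), ?_⟩
    apply Subtype.ext
    rw [bruhat_none]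
    ext i j
    fin_cases i <;> fin_cases j <;> simp [h]
    field_simp
    linear_combination hd
  · refine ⟨(Units.mk0 _ (inv_ne_zero h), g.1 0 1, some (g.1 1 0 / g.1 1 1)), ?_⟩
    apply Subtype.ext
    rw [bruhat_some]
    ext i j
    fin_cases i <;> fin_cases j <;> simp
    · field_simp
      linear_combination -hd
    · field_simp

lemma trG_eq (f : MvPolynomial (Fin 4) F) : trG p F f =
    trBG p F (∑ w : (ZMod p)ˣ, ∑ s : ZMod p,
      act p F !![(w : ZMod p), s; 0, (w : ZMod p)⁻¹] f) := by
  unfold trG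
  rw [← Function.Bijective.sum_comp ⟨bruhat_inj, bruhat_surj⟩ (fun g => act p F g.1 f)]
  rw [Fintype.sum_prod_type]
  simp_rw [Fintype.sum_prod_type, Fintype.sum_option]
  unfold trBG
  simp_rw [map_sum, act_act]
  rw [Finset.sum_comm (γ := ZMod p) (s := Finset.univ) (t := Finset.univ) (f := fun x y => ∑ s, _),
    ← Finset.sum_add_distrib]
  apply Finset.sum_congr rfl; intro w _
  rw [Finset.sum_comm, ← Finset.sum_add_distrib]
  apply Finset.sum_congr rfl; intro s _
  rw [add_comm]
  rfl

lemma trG_eq_of_rho {f : MvPolynomial (Fin 4) F}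
    (hr : ∀ w : ZMod p, w ≠ 0 → act p F !![w, 0; 0, w⁻¹] f = f) :
    trG p F f = - trBG p F (trP p F f) := by
  rw [trG_eq]
  have : ∀ w : (ZMod p)ˣ, ∑ s : ZMod p, act p F !![(w : ZMod p), s; 0, (w : ZMod p)⁻¹] f =
      trP p F f := by
    intro w
    unfold trP
    refine Fintype.sum_equiv (Equiv.mulLeft₀ (w : ZMod p)⁻¹ (inv_ne_zero w.ne_zero)) _ _ (fun s => ?_)
    rw [borel_eq _ _ w.ne_zero, ← act_act, hr _ w.ne_zero]; rfl
  simp_rw [this]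
  rw [Finset.sum_const, Finset.card_univ, ZMod.card_units_eq_totient,
    Nat.totient_prime (Fact.out : p.Prime), nsmul_eq_mul, Nat.cast_sub (Fact.out : p.Prime).one_le]
  rw [show ((p : ℕ) : MvPolynomial (Fin 4) F) = 0 from CharP.cast_eq_zero _ p]
  simp [trBG]
  ring
end S1

section S2
variable {p : ℕ} [Fact p.Prime] {F : Type} [Field F] [CharP F p]

lemma prod_split {M : Type*} [CommMonoid M] (f : ZMod p → M) :
    ∏ s : ZMod p, f s = f 0 * ∏ w : (ZMod p)ˣ, f w := by
  rw [Fintype.prod_eq_mul_prod_compl 0 f]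
  congr 1
  symm
  refine Finset.prod_bij (fun w _ => (w : ZMod p)) ?_ ?_ ?_ ?_
  · intro w _; simp
  · intro a _ b _ h; exact Units.ext h
  · intro b hb; exact ⟨Units.mk0 b (by simpa using hb), by simp⟩
  · intro _ _; rfl

lemma sum_split {M : Type*} [AddCommMonoid M] (f : ZMod p → M) :
    ∑ s : ZMod p, f s = f 0 + ∑ w : (ZMod p)ˣ, f w := by
  have := prod_split (p := p) (M := Multiplicative M) f
  exact this

lemma act_X3 (g : Matrix (Fin 2) (Fin 2) (ZMod p)) : act p F g (X 3) =
    C (cF p F (g 0 1)) ^ 3 * X 0 + 3 * C (cF p F (g 0 1)) ^ 2 * C (cF p F (g 0 0)) * X 1 +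
     3 * C (cF p F (g 0 1)) * C (cF p F (g 0 0)) ^ 2 * X 2 + C (cF p F (g 0 0)) ^ 3 * X 3 := by
  rw [act_def, aeval_X]
  simp [ptAct, algebraMap_eq]

lemma act_X0 (g : Matrix (Fin 2) (Fin 2) (ZMod p)) : act p F g (X 0) =
    C (cF p F (g 1 1)) ^ 3 * X 0 + 3 * C (cF p F (g 1 1)) ^ 2 * C (cF p F (g 1 0)) * X 1 +
     3 * C (cF p F (g 1 1)) * C (cF p F (g 1 0)) ^ 2 * X 2 + C (cF p F (g 1 0)) ^ 3 * X 3 := by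
  rw [act_def, aeval_X]
  simp [ptAct, algebraMap_eq]

lemma act_u_X0 (t : ZMod p) : act p F !![1, t; 0, 1] (X 0) = X 0 := by
  simp [act_X0]

lemma u_mul_u (s t : ZMod p) : (!![1, s; 0, 1] * !![1, t; 0, 1] : Matrix (Fin 2) (Fin 2) (ZMod p)) =
    !![1, t + s; 0, 1] := by simp

lemma act_u_N (t : ZMod p) : act p F !![1, t; 0, 1] (Npoly p F) = Npoly p F := by
  unfold Npoly
  rw [map_prod]
  simp_rw [act_act, u_mul_u]
  have h2 := Equiv.prod_comp (Equiv.addLeft t) (fun s => act p F !![1, s; 0, 1] (X 3))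
  simp only [Equiv.coe_addLeft] at h2
  exact h2

lemma u_mul_rho (s w : ZMod p) (hw : w ≠ 0) :
    (!![1, s; 0, 1] * !![w, 0; 0, w⁻¹] : Matrix (Fin 2) (Fin 2) (ZMod p)) =
    !![w, 0; 0, w⁻¹] * !![1, (w⁻¹ ^ 2) * s; 0, 1] := by
  ext i j
  fin_cases i <;> fin_cases j <;> simp
  field_simp

lemma act_rho_X3 (w : ZMod p) : act p F !![w, 0; 0, w⁻¹] (X 3) = C (cF p F w) ^ 3 * X 3 := by
  simp [act_X3]

lemma cF_pow (w : ZMod p) : (cF p F w) ^ p = cF p F w := by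
  rw [← map_pow, ZMod.pow_card]

lemma act_C (g : Matrix (Fin 2) (Fin 2) (ZMod p)) (c : F) : act p F g (C c) = C c :=
  (act p F g).commutes c

lemma act_rho_N (w : ZMod p) (hw : w ≠ 0) :
    act p F !![w, 0; 0, w⁻¹] (Npoly p F) = C (cF p F w ^ 3) * Npoly p F := by
  unfold Npoly
  rw [map_prod]
  simp_rw [act_act, u_mul_rho _ w hw]
  have h1 : ∀ s : ZMod p, act p F (!![w, 0; 0, w⁻¹] * !![1, (w⁻¹ ^ 2) * s; 0, 1]) (X 3) =
    C (cF p F w ^ 3) * act p F !![1, (w⁻¹ ^ 2) * s; 0, 1] (X 3) := by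
    intro s
    rw [← act_act, act_rho_X3, map_mul, map_pow, map_pow, act_C]
  rw [Finset.prod_congr rfl (fun s _ => h1 s), Finset.prod_mul_distrib, Finset.prod_const]
  have h2 := Equiv.prod_comp (Equiv.mulLeft₀ (w⁻¹ ^ 2) (pow_ne_zero _ (inv_ne_zero hw)))
    (fun s => act p F !![1, s; 0, 1] (X 3 : MvPolynomial (Fin 4) F))
  simp only [Equiv.mulLeft₀_apply] at h2
  rw [h2, Finset.card_univ, ZMod.card, ← map_pow, ← pow_mul, mul_comm 3 p, pow_mul, cF_pow]

lemma X0_dvd_low_N (t : ZMod p) (ht : t ≠ 0) :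
    (X 0 : MvPolynomial (Fin 4) F) ∣ act p F !![1, 0; t, 1] (Npoly p F) := by
  unfold Npoly
  rw [map_prod]
  refine Dvd.dvd.trans ?_ (Finset.dvd_prod_of_mem _ (Finset.mem_univ (-t⁻¹)))
  rw [act_act, act_X3]
  simp [ht]

lemma X0_dvd_eta_N :
    (X 0 : MvPolynomial (Fin 4) F) ∣ act p F !![0, 1; -1, 0] (Npoly p F) := by
  unfold Npoly
  rw [map_prod]
  refine Dvd.dvd.trans ?_ (Finset.dvd_prod_of_mem _ (Finset.mem_univ 0))
  rw [act_act, act_X3]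
  simp

lemma trBG_N_mul (f : MvPolynomial (Fin 4) F) :
    X 0 ∣ trBG p F (Npoly p F * f) - Npoly p F * f := by
  unfold trBG
  rw [sum_split, one_eq, act_one]
  have : (Npoly p F * f + ∑ w : (ZMod p)ˣ, act p F !![1, 0; (w : ZMod p), 1] (Npoly p F * f)) +
    act p F !![0, 1; -1, 0] (Npoly p F * f) - Npoly p F * f =
    (∑ w : (ZMod p)ˣ, act p F !![1, 0; (w : ZMod p), 1] (Npoly p F * f)) +
    act p F !![0, 1; -1, 0] (Npoly p F * f) := by ring
  rw [this]
  apply dvd_add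
  · apply Finset.dvd_sum
    intro w _
    rw [map_mul]
    exact Dvd.dvd.mul_right (X0_dvd_low_N _ w.ne_zero) _
  · rw [map_mul]
    exact Dvd.dvd.mul_right X0_dvd_eta_N _

lemma D_mem : Dpoly F ∈ invariants p F := by
  apply mem_inv_of_u_eta
  · intro t
    rw [act_def, ptAct_u]
    simp only [Dpoly, map_add, map_sub, map_mul, map_pow, aeval_X, map_ofNat]
    simp
    ring
  · rw [act_def, ptAct_eta]
    simp only [Dpoly, map_add, map_sub, map_mul, map_pow, aeval_X, map_ofNat]
    simp
    ring

lemma L_mem : Lpoly p F ∈ invariants p F := by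
  haveI : ExpChar (MvPolynomial (Fin 4) F) p := ExpChar.prime Fact.out
  have hL : Lpoly p F = 3 * (frobenius _ p (X 2) * X 1 - X 2 * frobenius _ p (X 1)) -
      (frobenius _ p (X 3) * X 0 - X 3 * frobenius _ p (X 0)) := rfl
  have key : ∀ (x : Fin 4 → MvPolynomial (Fin 4) F), aeval x (Lpoly p F) =
      3 * (frobenius _ p (x 2) * x 1 - x 2 * frobenius _ p (x 1)) -
      (frobenius _ p (x 3) * x 0 - x 3 * frobenius _ p (x 0)) := by
    intro x
    simp only [Lpoly, frobenius_def, map_sub, map_mul, map_pow, aeval_X, map_ofNat]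
  apply mem_inv_of_u_eta
  · intro t
    have hc : frobenius _ p (algebraMap F (MvPolynomial (Fin 4) F) (cF p F t)) =
      algebraMap F (MvPolynomial (Fin 4) F) (cF p F t) := by
      rw [frobenius_def, ← map_pow, cF_pow]
    rw [act_def, key, hL, ptAct_u]
    generalize algebraMap F (MvPolynomial (Fin 4) F) (cF p F t) = c at *
    generalize frobenius (MvPolynomial (Fin 4) F) p = φ at *
    simp
    simp only [map_add, map_mul, map_pow, map_ofNat, hc]
    ring
  · rw [act_def, key, hL, ptAct_eta]
    generalize frobenius (MvPolynomial (Fin 4) F) p = φ at *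
    simp
    ring

lemma act_u_e (t : ZMod p) : act p F !![1, t; 0, 1] (epoly F) = epoly F := by
  rw [act_def, ptAct_u]
  simp only [epoly, map_add, map_sub, map_mul, map_pow, aeval_X, map_ofNat]
  simp
  ring

lemma act_rho_e (w : ZMod p) (hw : w ≠ 0) :
    act p F !![w, 0; 0, w⁻¹] (epoly F) = C (cF p F w⁻¹ ^ 3) * epoly F := by
  have h : C (σ := Fin 4) (cF p F w⁻¹) * C (cF p F w) = 1 := by
    rw [← map_mul, ← map_mul]; simp [hw]
  have h3 : C (σ := Fin 4) (cF p F w⁻¹) ^ 3 * C (cF p F w) ^ 3 = 1 := by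
    rw [← mul_pow, h, one_pow]
  rw [act_def, ptAct_rho _ _ hw]
  simp only [epoly, map_add, map_sub, map_mul, map_pow, aeval_X, map_ofNat]
  simp [algebraMap_eq, -map_inv₀]
  linear_combination (X 3 * X 0 ^ 2 * C (cF p F w⁻¹) ^ 3) * h3 -
    (3 * X 2 * X 1 * X 0 * C (cF p F w⁻¹) ^ 3) * h

lemma cF_cancel (w : ZMod p) (hw : w ≠ 0) : cF p F w * cF p F w⁻¹ = 1 := by
  rw [← map_mul]; simp [hw]

lemma Ne_mem : trBG p F (Npoly p F * epoly F) ∈ invariants p F := by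
  apply trBG_mem
  · intro t; rw [map_mul, act_u_N, act_u_e]
  · intro w hw
    rw [map_mul, act_rho_N _ hw, act_rho_e _ hw]
    have : C (σ := Fin 4) (cF p F w ^ 3) * C (cF p F w⁻¹ ^ 3) = 1 := by
      rw [← map_mul, ← mul_pow, cF_cancel w hw]; simp
    linear_combination (Npoly p F * epoly F) * this

lemma delta_mem (hp3 : p % 3 = 1) : trBG p F (Npoly p F ^ ((p - 1) / 3)) ∈ invariants p F := by
  apply trBG_mem
  · intro t; rw [map_pow, act_u_N]
  · intro w hw
    rw [map_pow, act_rho_N _ hw, mul_pow, ← map_pow, ← pow_mul,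
      show 3 * ((p - 1) / 3) = p - 1 by omega, ← map_pow, ZMod.pow_card_sub_one_eq_one hw]
    simp

lemma NX0_mem (hp : 3 < p) : Npoly p F * X 0 ∈ invariants p F := by
  apply mem_inv_of_u_eta
  · intro t; rw [map_mul, act_u_N, act_u_X0]
  · have h0 : Npoly p F = X 3 * ∏ w : (ZMod p)ˣ, act p F !![1, (w : ZMod p); 0, 1] (X 3) := by
      unfold Npoly
      rw [prod_split, one_eq, act_one]
    have h1 : ∀ w : (ZMod p)ˣ, act p F !![0, 1; -1, 0] (act p F !![1, (w : ZMod p); 0, 1] (X 3)) =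
        C (cF p F ((-w : (ZMod p)ˣ) : ZMod p)) ^ 3 *
          act p F !![1, ((-w⁻¹ : (ZMod p)ˣ) : ZMod p); 0, 1] (X 3) := by
      intro w
      have h : C (σ := Fin 4) (cF p F (w⁻¹ : (ZMod p)ˣ)) * C (cF p F w) = 1 := by
        rw [← map_mul, ← map_mul, ← Units.val_mul]; simp
      rw [act_act, act_X3, act_X3]
      simp [-Units.val_inv_eq_inv_val, -map_inv₀, -ZMod.inv_coe_unit, -map_units_inv]
      generalize C (σ := Fin 4) (cF p F (w⁻¹ : (ZMod p)ˣ)) = y at *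
      generalize C (σ := Fin 4) (cF p F w) = z at *
      linear_combination (-X 0 * (y ^ 2 * z ^ 2 + y * z + 1) + 3 * z * X 1 * (y * z + 1)
        - 3 * z ^ 2 * X 2) * h
    have h2 : ∏ w : (ZMod p)ˣ, act p F !![1, ((-w⁻¹ : (ZMod p)ˣ) : ZMod p); 0, 1]
        (X 3 : MvPolynomial (Fin 4) F) =
        ∏ w : (ZMod p)ˣ, act p F !![1, (w : ZMod p); 0, 1] (X 3) :=
      Fintype.prod_equiv ⟨fun s => -s⁻¹, fun s => -s⁻¹, fun s => by simp [inv_neg],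
      fun s => by simp [inv_neg]⟩ _ _ (fun s => rfl)
    have h3 : ∏ w : (ZMod p)ˣ, C (σ := Fin 4) (cF p F ((-w : (ZMod p)ˣ) : ZMod p)) ^ 3 = -1 := by
      rw [Finset.prod_pow, ← map_prod, ← map_prod, ← Units.coe_prod]
      have h4 : ∏ w : (ZMod p)ˣ, (-w) = -1 := by
        rw [← FiniteField.prod_univ_units_id_eq_neg_one (K := ZMod p)]
        exact Fintype.prod_equiv (Equiv.neg _) _ _ (fun s => rfl)
      rw [h4]; simp
      ring
    rw [map_mul, h0, map_mul, map_prod, Finset.prod_congr rfl (fun w _ => h1 w),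
      Finset.prod_mul_distrib, h2, h3, act_X3, act_X0]
    simp
    ring

lemma C_two : (C 2 : MvPolynomial (Fin 4) F) = 2 := map_ofNat C 2

lemma C_three : (C 3 : MvPolynomial (Fin 4) F) = 3 := map_ofNat C 3

lemma C_four : (C 4 : MvPolynomial (Fin 4) F) = 4 := map_ofNat C 4

lemma act_hom {f : MvPolynomial (Fin 4) F} {d : ℕ} (hf : f.IsHomogeneous d)
    (g : Matrix (Fin 2) (Fin 2) (ZMod p)) : (act p F g f).IsHomogeneous d := by
  have hl : ∀ i, (ptAct p F g (X : Fin 4 → MvPolynomial (Fin 4) F) i).IsHomogeneous 1 := by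
    have hx : ∀ (c : F) (i : Fin 4), (C c * X i : MvPolynomial (Fin 4) F).IsHomogeneous 1 := by
      intro c i
      simpa using (isHomogeneous_C (Fin 4) c).mul (isHomogeneous_X F i)
    have key : ∀ c0 c1 c2 c3 : F, (C c0 * X 0 + C c1 * X 1 + C c2 * X 2 + C c3 * X 3 :
        MvPolynomial (Fin 4) F).IsHomogeneous 1 := fun c0 c1 c2 c3 =>
      (((hx c0 0).add (hx c1 1)).add (hx c2 2)).add (hx c3 3)
    intro i
    fin_cases i
    · convert key (cF p F (g 1 1) ^ 3) (3 * cF p F (g 1 1) ^ 2 * cF p F (g 1 0))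
        (3 * cF p F (g 1 1) * cF p F (g 1 0) ^ 2) (cF p F (g 1 0) ^ 3) using 1
      simp [ptAct, algebraMap_eq, C_two, C_three]
    · convert key (cF p F (g 1 1) ^ 2 * cF p F (g 0 1)) (cF p F (g 1 1) ^ 2 * cF p F (g 0 0) +
        2 * cF p F (g 1 1) * cF p F (g 0 1) * cF p F (g 1 0))
        (2 * cF p F (g 1 1) * cF p F (g 1 0) * cF p F (g 0 0) + cF p F (g 0 1) * cF p F (g 1 0) ^ 2)
        (cF p F (g 1 0) ^ 2 * cF p F (g 0 0)) using 1
      simp [ptAct, algebraMap_eq, C_two, C_three]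
    · convert key (cF p F (g 1 1) * cF p F (g 0 1) ^ 2) (2 * cF p F (g 1 1) * cF p F (g 0 1) * cF p F (g 0 0) +
        cF p F (g 0 1) ^ 2 * cF p F (g 1 0))
        (cF p F (g 1 1) * cF p F (g 0 0) ^ 2 + 2 * cF p F (g 0 1) * cF p F (g 1 0) * cF p F (g 0 0))
        (cF p F (g 1 0) * cF p F (g 0 0) ^ 2) using 1
      simp [ptAct, algebraMap_eq, C_two, C_three]
    · convert key (cF p F (g 0 1) ^ 3) (3 * cF p F (g 0 1) ^ 2 * cF p F (g 0 0))
        (3 * cF p F (g 0 1) * cF p F (g 0 0) ^ 2) (cF p F (g 0 0) ^ 3) using 1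
      simp [ptAct, algebraMap_eq, C_two, C_three]
  rw [act_def]
  simpa using hf.aeval _ hl

lemma trG_hom {f : MvPolynomial (Fin 4) F} {d : ℕ} (hf : f.IsHomogeneous d) :
    (trG p F f).IsHomogeneous d :=
  IsHomogeneous.sum _ _ _ (fun g _ => act_hom hf _)

lemma trP_hom {f : MvPolynomial (Fin 4) F} {d : ℕ} (hf : f.IsHomogeneous d) :
    (trP p F f).IsHomogeneous d :=
  IsHomogeneous.sum _ _ _ (fun g _ => act_hom hf _)

lemma trBG_hom {f : MvPolynomial (Fin 4) F} {d : ℕ} (hf : f.IsHomogeneous d) :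
    (trBG p F f).IsHomogeneous d :=
  (IsHomogeneous.sum _ _ _ (fun g _ => act_hom hf _)).add (act_hom hf _)

lemma N_hom : (Npoly p F).IsHomogeneous p := by
  have := IsHomogeneous.prod (Finset.univ : Finset (ZMod p)) (fun s => act p F !![1, s; 0, 1] (X 3))
    (fun _ => 1) (fun s _ => act_hom (isHomogeneous_X F 3) _)
  unfold Npoly
  simpa using this

lemma hcomp_act (f : MvPolynomial (Fin 4) F) (d : ℕ) (g : Matrix (Fin 2) (Fin 2) (ZMod p)) :
    homogeneousComponent d (act p F g f) = act p F g (homogeneousComponent d f) := by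
  conv_lhs => rw [← sum_homogeneousComponent f]
  rw [map_sum, map_sum]
  have : ∀ i ∈ Finset.range (f.totalDegree + 1), homogeneousComponent d (act p F g (homogeneousComponent i f))
      = if i = d then act p F g (homogeneousComponent d f) else 0 := by
    intro i _
    have h := act_hom (p := p) (homogeneousComponent_isHomogeneous i f) g
    rw [homogeneousComponent_of_mem h]
    split_ifs with h1 h2 h2
    · rw [h1]
    · exact absurd h1.symm h2
    · exact absurd h2.symm h1
    · rfl
  rw [Finset.sum_congr rfl this, Finset.sum_ite_eq']
  split_ifs with h
  · rfl
  · rw [homogeneousComponent_eq_zero, map_zero]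
    simpa using h
end S2

section S3
variable {p : ℕ} [Fact p.Prime] {F : Type} [Field F] [CharP F p]

lemma dvd_aeval_sub {S : Type*} [CommRing S] [Algebra F S] (a : S) (x y : Fin 4 → S)
    (h : ∀ i, a ∣ x i - y i) (f : MvPolynomial (Fin 4) F) : a ∣ aeval x f - aeval y f := by
  induction f using MvPolynomial.induction_on with
  | C c => simp
  | add f g hf hg =>
    have : aeval x (f + g) - aeval y (f + g) = (aeval x f - aeval y f) + (aeval x g - aeval y g) := by
      simp only [map_add]; ring
    rw [this]; exact dvd_add hf hg
  | mul_X f i hf =>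
    have : aeval x (f * X i) - aeval y (f * X i) =
      (aeval x f - aeval y f) * x i + aeval y f * (x i - y i) := by
      simp only [map_mul, aeval_X]; ring
    rw [this]; exact dvd_add (hf.mul_right _) ((h i).mul_left _)

/-- kill `X 0` -/
def kill0 (F : Type) [Field F] : MvPolynomial (Fin 4) F →ₐ[F] MvPolynomial (Fin 4) F :=
  aeval ![0, X 1, X 2, X 3]

lemma X0_dvd_sub_kill0 (f : MvPolynomial (Fin 4) F) : X 0 ∣ f - kill0 F f := by
  have := dvd_aeval_sub (X 0 : MvPolynomial (Fin 4) F) (X : Fin 4 → MvPolynomial (Fin 4) F) ![0, X 1, X 2, X 3]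
    (by intro i; fin_cases i <;> simp) f
  rwa [aeval_X_left_apply] at this

lemma X0_dvd_iff (f : MvPolynomial (Fin 4) F) : X 0 ∣ f ↔ kill0 F f = 0 := by
  constructor
  · rintro ⟨g, rfl⟩
    simp [kill0]
  · intro h
    have := X0_dvd_sub_kill0 f
    rwa [h, sub_zero] at this

lemma aeval_eq_of_dvd {S : Type*} [CommRing S] [Algebra F S] {x : Fin 4 → S} (hx : x 0 = 0)
    {f g : MvPolynomial (Fin 4) F} (h : X 0 ∣ f - g) : aeval x f = aeval x g := by
  obtain ⟨q, hq⟩ := h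
  rw [← sub_eq_zero, ← map_sub, hq, map_mul, aeval_X, hx, zero_mul]

lemma X1_dvd_sub (f : MvPolynomial (Fin 4) F) : X 1 ∣ f - aeval ![X 0, 0, X 2, X 3] f := by
  have := dvd_aeval_sub (X 1 : MvPolynomial (Fin 4) F) (X : Fin 4 → MvPolynomial (Fin 4) F) ![X 0, 0, X 2, X 3]
    (by intro i; fin_cases i <;> simp) f
  rwa [aeval_X_left_apply] at this

lemma X0_dvd_X1_mul {f : MvPolynomial (Fin 4) F} (h : X 0 ∣ X 1 * f) : X 0 ∣ f := by
  rw [X0_dvd_iff] at *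
  rw [map_mul] at h
  have : kill0 F (X 1) = X 1 := by simp [kill0]
  rw [this] at h
  exact (mul_eq_zero.mp h).resolve_left (X_ne_zero 1)

lemma hcomp_mul {A f : MvPolynomial (Fin 4) F} {a : ℕ} (hA : A.IsHomogeneous a) (d : ℕ) :
    homogeneousComponent (a + d) (A * f) = A * homogeneousComponent d f := by
  conv_lhs => rw [← sum_homogeneousComponent f]
  rw [Finset.mul_sum, map_sum]
  have : ∀ i ∈ Finset.range (f.totalDegree + 1), homogeneousComponent (a + d) (A * homogeneousComponent i f)
      = if i = d then A * homogeneousComponent d f else 0 := by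
    intro i _
    have h := hA.mul (homogeneousComponent_isHomogeneous i f)
    rw [homogeneousComponent_of_mem h]
    split_ifs with h1 h2 h2
    · rw [h2]
    · omega
    · omega
    · rfl
  rw [Finset.sum_congr rfl this, Finset.sum_ite_eq']
  split_ifs with h
  · rfl
  · rw [homogeneousComponent_eq_zero, mul_zero]
    simpa using h

lemma hcomp_mul_lt {A f : MvPolynomial (Fin 4) F} {a : ℕ} (hA : A.IsHomogeneous a) (d : ℕ) (hd : d < a) :
    homogeneousComponent d (A * f) = 0 := by
  conv_lhs => rw [← sum_homogeneousComponent f]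
  rw [Finset.mul_sum, map_sum]
  apply Finset.sum_eq_zero
  intro i _
  have h := hA.mul (homogeneousComponent_isHomogeneous i f)
  rw [homogeneousComponent_of_mem h, if_neg (by omega)]

lemma degreeOf_hcomp (f : MvPolynomial (Fin 4) F) (d : ℕ) :
    degreeOf 3 (homogeneousComponent d f) ≤ degreeOf 3 f := by
  rw [degreeOf_le_iff]
  intro m hm
  rw [support_homogeneousComponent] at hm
  exact (degreeOf_le_iff.mp le_rfl) m (Finset.mem_filter.mp hm).1

lemma degreeOf_aeval_le (x : Fin 4 → MvPolynomial (Fin 4) F) (hx : ∀ i, i ≠ 3 → degreeOf 3 (x i) = 0)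
    (hx3 : degreeOf 3 (x 3) ≤ 1) (f : MvPolynomial (Fin 4) F) :
    degreeOf 3 (aeval x f) ≤ degreeOf 3 f := by
  rw [aeval_def, eval₂_eq']
  refine (degreeOf_sum_le _ _ _).trans (Finset.sup_le ?_)
  intro m hm
  refine (degreeOf_mul_le _ _ _).trans ?_
  rw [algebraMap_eq, degreeOf_C, zero_add]
  have h3 : m 3 ≤ degreeOf 3 f := (degreeOf_le_iff.mp le_rfl) m hm
  refine le_trans ?_ h3
  refine (degreeOf_prod_le _ _ _).trans ?_
  rw [Fin.sum_univ_four]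
  have h := fun i => degreeOf_pow_le (3 : Fin 4) (x i) (m i)
  have h0 := h 0
  have h1 := h 1
  have h2 := h 2
  have h4 := h 3
  rw [hx 0 (by decide)] at h0
  rw [hx 1 (by decide)] at h1
  rw [hx 2 (by decide)] at h2
  have h5 : m 3 * degreeOf 3 (x 3) ≤ m 3 * 1 := Nat.mul_le_mul_left _ hx3
  omega

lemma natDegree_aeval_le {S : Type*} [CommRing S] [Algebra F S] (y0 y1 y2 : S)
    (f : MvPolynomial (Fin 4) F) :
    (aeval ![Polynomial.C y0, Polynomial.C y1, Polynomial.C y2, Polynomial.X] f).natDegree ≤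
      degreeOf 3 f := by
  rw [aeval_def, eval₂_eq']
  refine Polynomial.natDegree_sum_le_of_forall_le _ _ ?_
  intro m hm
  have h3 : m 3 ≤ degreeOf 3 f := (degreeOf_le_iff.mp le_rfl) m hm
  refine le_trans ?_ h3
  rw [Fin.prod_univ_four, Polynomial.algebraMap_apply]
  simp only [Matrix.cons_val_zero, Matrix.cons_val_one, Matrix.cons_val]
  rw [← Polynomial.C_pow, ← Polynomial.C_pow, ← Polynomial.C_pow, ← Polynomial.C_mul,
    ← Polynomial.C_mul, ← mul_assoc, ← Polynomial.C_mul]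
  exact Polynomial.natDegree_C_mul_X_pow_le _ _

lemma eval_aeval_T {S : Type*} [CommRing S] [Algebra F S] (y0 y1 y2 z : S)
    (f : MvPolynomial (Fin 4) F) :
    Polynomial.eval z (aeval ![Polynomial.C y0, Polynomial.C y1, Polynomial.C y2, Polynomial.X] f) =
      aeval ![y0, y1, y2, z] f := by
  rw [← Polynomial.coe_aeval_eq_eval, ← AlgHom.restrictScalars_apply F, ← AlgHom.comp_apply]
  congr 1
  apply MvPolynomial.algHom_ext
  intro i
  fin_cases i <;> simp

/-- vanishing by `p` distinct roots -/
lemma aeval_const_of_roots {S : Type*} [CommRing S] [IsDomain S] [Algebra F S] (y0 y1 y2 c : S)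
    (f : MvPolynomial (Fin 4) F) (hf : degreeOf 3 f < p) (z : ZMod p → S)
    (hz : Function.Injective z) (h : ∀ s, aeval ![y0, y1, y2, z s] f = c) (w : S) :
    aeval ![y0, y1, y2, w] f = c := by
  set P := aeval ![Polynomial.C y0, Polynomial.C y1, Polynomial.C y2, Polynomial.X] f - Polynomial.C c
  have hP : P = 0 := by
    apply Polynomial.eq_zero_of_natDegree_lt_card_of_eval_eq_zero P hz
    · intro s
      simp only [P, Polynomial.eval_sub, Polynomial.eval_C, eval_aeval_T, h s, sub_self]
    · rw [ZMod.card]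
      have := natDegree_aeval_le y0 y1 y2 f
      have h2 : P.natDegree ≤ _ := Polynomial.natDegree_sub_le _ _
      rw [Polynomial.natDegree_C] at h2
      omega
  have h2 := congrArg (Polynomial.eval w) hP
  simp only [P, Polynomial.eval_sub, Polynomial.eval_C, eval_aeval_T, Polynomial.eval_zero] at h2
  exact sub_eq_zero.mp h2

/-- restriction to the plane -/
def ev (F : Type) [Field F] : MvPolynomial (Fin 4) F →ₐ[F] Polynomial F :=
  aeval ![0, Polynomial.X, 1, 0]

/-- exponent vector -/
def mon4 (a b c d : ℕ) : Fin 4 →₀ ℕ := Finsupp.equivFunOnFinite.symm ![a, b, c, d]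

lemma ev_coeff_sum (f : MvPolynomial (Fin 4) F) (i : ℕ) : (ev F f).coeff i =
    ∑ m ∈ f.support, coeff m f * (if m 0 = 0 ∧ m 3 = 0 ∧ m 1 = i then 1 else 0) := by
  rw [ev, aeval_def, eval₂_eq', Polynomial.finset_sum_coeff]
  apply Finset.sum_congr rfl
  intro m _
  rw [Fin.prod_univ_four, Polynomial.algebraMap_apply, Algebra.algebraMap_self_apply,
    Polynomial.coeff_C_mul]
  congr 1
  simp only [Matrix.cons_val_zero, Matrix.cons_val_one, Matrix.cons_val]
  by_cases h0 : m 0 = 0 <;> by_cases h3 : m 3 = 0 <;>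
    simp [h0, h3, Polynomial.coeff_X_pow, eq_comm]

lemma plane {S : Type*} [CommRing S] [Algebra F S] (y1 y2 : S) {f : MvPolynomial (Fin 4) F} {d : ℕ}
    (hf : f.IsHomogeneous d) : aeval ![0, y1, y2, 0] f =
      ∑ i ∈ Finset.range (d + 1), algebraMap F S ((ev F f).coeff i) * y1 ^ i * y2 ^ (d - i) := by
  simp_rw [ev_coeff_sum, map_sum, Finset.sum_mul]
  rw [Finset.sum_comm, aeval_def, eval₂_eq']
  apply Finset.sum_congr rfl
  intro m hm
  have hd : d = m.degree := hf.degree_eq_sum_deg_support hm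
  have hd' : m.degree = m 0 + m 1 + m 2 + m 3 := by
    rw [Finsupp.degree_eq_sum, Fin.sum_univ_four]
  rw [Fin.prod_univ_four]
  simp only [Matrix.cons_val_zero, Matrix.cons_val_one, Matrix.cons_val]
  by_cases h0 : m 0 = 0
  · by_cases h3 : m 3 = 0
    · have h1 : m 1 ≤ d := by omega
      have h2 : m 2 = d - m 1 := by omega
      rw [Finset.sum_eq_single (m 1)]
      · simp [h0, h3, h2]; ring
      · intro b _ hb
        simp [h0, h3, Ne.symm hb]
      · intro h; simp at h; omega
    · simp [h3]
  · simp [h0]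

lemma ev_eq_sum {f : MvPolynomial (Fin 4) F} {d : ℕ} (hf : f.IsHomogeneous d) :
    ev F f = ∑ i ∈ Finset.range (d + 1), Polynomial.C ((ev F f).coeff i) * Polynomial.X ^ i := by
  have := plane (Polynomial.X : Polynomial F) 1 hf
  simpa [ev] using this

lemma ev_natDegree {f : MvPolynomial (Fin 4) F} {d : ℕ} (hf : f.IsHomogeneous d) :
    (ev F f).natDegree ≤ d := by
  rw [ev_eq_sum hf]
  refine Polynomial.natDegree_sum_le_of_forall_le _ _ ?_
  intro m hm
  refine (Polynomial.natDegree_C_mul_X_pow_le _ _).trans ?_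
  simp at hm; omega

/-- flattened P-invariants -/
structure TF (p : ℕ) [Fact p.Prime] (F : Type) [Field F] [CharP F p] (d : ℕ)
    (r : MvPolynomial (Fin 4) F) : Prop where
  hom : r.IsHomogeneous d
  deg : degreeOf 3 r < p
  inv : ∀ s : ZMod p, X 0 ∣ act p F !![1, s; 0, 1] r - r

lemma TF.shift {d : ℕ} {r : MvPolynomial (Fin 4) F} (hr : TF p F d r) {S : Type*} [CommRing S]
    [Algebra F S] (y1 y2 y3 : S) (s : ZMod p) :
    aeval ![0, y1, y2 + 2 * algebraMap F S (cF p F s) * y1,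
      y3 + 3 * algebraMap F S (cF p F s) * y2 + 3 * algebraMap F S (cF p F s) ^ 2 * y1] r =
    aeval ![0, y1, y2, y3] r := by
  have h := aeval_eq_of_dvd (x := ![0, y1, y2, y3]) rfl (hr.inv s)
  rw [aeval_act, ptAct_u] at h
  simpa using h

lemma three_ne (hp : 3 < p) : (3 : F) ≠ 0 := by
  have h := CharP.cast_eq_zero_iff F p 3
  intro h3
  have := h.mp (by exact_mod_cast h3)
  exact absurd (Nat.le_of_dvd (by norm_num) this) (by omega)

lemma two_ne (hp : 3 < p) : (2 : F) ≠ 0 := by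
  have h := CharP.cast_eq_zero_iff F p 2
  intro h3
  have := h.mp (by exact_mod_cast h3)
  exact absurd (Nat.le_of_dvd (by norm_num) this) (by omega)

lemma cF_inj : Function.Injective (cF p F) := (cF p F).injective

lemma root_inj (hp : 3 < p) : Function.Injective (fun s : ZMod p =>
    (3 * C (cF p F s) * X 2 - 3 * C (cF p F s) ^ 2 * X 1 : MvPolynomial (Fin 4) F)) := by
  intro s t h
  have := congrArg (aeval ![(0 : F), 0, 1, 0]) h
  simp [three_ne hp, aeval_C] at this
  exact cF_inj this

lemma inj_TF (hp : 3 < p) {d : ℕ} {r : MvPolynomial (Fin 4) F} (hr : TF p F d r) (h : ev F r = 0) :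
    X 0 ∣ r := by
  rw [X0_dvd_iff, kill0]
  have h0 : ∀ y1 y2 : MvPolynomial (Fin 4) F, aeval ![0, y1, y2, 0] r = 0 := by
    intro y1 y2
    rw [plane y1 y2 hr.hom]
    simp [h]
  apply aeval_const_of_roots (p := p) _ _ _ _ _ hr.deg _ (root_inj hp)
  intro s
  have h1 := hr.shift (S := MvPolynomial (Fin 4) F) (X 1) (X 2 - 2 * C (cF p F s) * X 1) 0 s
  rw [h0, algebraMap_eq] at h1
  rw [show (X 2 - 2 * C (cF p F s) * X 1 + 2 * C (cF p F s) * X 1 : MvPolynomial (Fin 4) F) = X 2 by ring,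
    show 0 + 3 * C (cF p F s) * (X 2 - 2 * C (cF p F s) * X 1) + 3 * C (cF p F s) ^ 2 * X 1 =
      (3 * C (cF p F s) * X 2 - 3 * C (cF p F s) ^ 2 * X 1 : MvPolynomial (Fin 4) F) by ring] at h1
  exact h1
end S3

section S4
variable {p : ℕ} [Fact p.Prime] {F : Type} [Field F] [CharP F p]

/-- P-invariants modulo `X 0` -/
def PI (p : ℕ) [Fact p.Prime] (F : Type) [Field F] [CharP F p] :
    Subalgebra F (MvPolynomial (Fin 4) F) where
  carrier := {f | ∀ s : ZMod p, kill0 F (act p F !![1, s; 0, 1] f) = kill0 F f}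
  mul_mem' := fun hf hg g => by simp only [map_mul]; rw [hf g, hg g]
  one_mem' := fun g => by simp
  add_mem' := fun hf hg g => by simp only [map_add]; rw [hf g, hg g]
  zero_mem' := fun g => by simp
  algebraMap_mem' := fun c g => by rw [(act _ _ _).commutes c]

lemma mem_PI {f : MvPolynomial (Fin 4) F} : f ∈ PI p F ↔ ∀ s : ZMod p, X 0 ∣ act p F !![1, s; 0, 1] f - f := by
  have : f ∈ PI p F ↔ ∀ s : ZMod p, kill0 F (act p F !![1, s; 0, 1] f) = kill0 F f := Iff.rfl
  rw [this]
  simp_rw [X0_dvd_iff, map_sub, sub_eq_zero]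

/-- the element `M` -/
def Mpoly (p : ℕ) (F : Type) [Field F] : MvPolynomial (Fin 4) F := X 2 ^ p - X 2 * X 1 ^ (p - 1)

lemma X1_PI : (X 1 : MvPolynomial (Fin 4) F) ∈ PI p F := by
  intro s
  rw [kill0, aeval_act, ptAct_u]; simp

lemma xi_PI : xipoly F ∈ PI p F := by
  intro s
  rw [kill0, aeval_act, ptAct_u]
  simp only [xipoly, map_sub, map_mul, map_pow, aeval_X, map_ofNat]
  simp
  ring

lemma M_PI : Mpoly p F ∈ PI p F := by
  intro s
  have hp : p = (p - 1) + 1 := (Nat.succ_pred_eq_of_pos (Fact.out : p.Prime).pos).symm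
  have h1 : (X 1 : MvPolynomial (Fin 4) F) ^ p = X 1 * X 1 ^ (p - 1) := by
    conv_lhs => rw [hp, pow_succ']
  have : ExpChar (MvPolynomial (Fin 4) F) p := ExpChar.prime Fact.out
  have hc : (C (cF p F s) : MvPolynomial (Fin 4) F) ^ p = C (cF p F s) := by
    rw [← map_pow, cF_pow]
  have h2 : (2 : MvPolynomial (Fin 4) F) ^ p = 2 := by
    rw [← C_two, ← map_pow]
    congr 1
    have := cF_pow (F := F) (2 : ZMod p)
    have e : cF p F 2 = 2 := map_ofNat _ 2
    rw [e] at this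
    exact this
  rw [kill0, aeval_act, ptAct_u]
  simp only [Mpoly, map_sub, map_mul, map_pow, aeval_X, map_ofNat]
  simp only [Matrix.cons_val_zero, Matrix.cons_val_one, Matrix.cons_val, mul_zero, add_zero,
    algebraMap_eq]
  rw [add_pow_expChar, mul_pow, mul_pow, hc, h2, h1]
  ring

lemma Mpoly_hom : (Mpoly p F).IsHomogeneous p := by
  have hp : 1 + 1 * (p - 1) = p := by have := (Fact.out : p.Prime).pos; omega
  refine IsHomogeneous.sub ?_ ?_
  · simpa using (isHomogeneous_X F (2 : Fin 4)).pow p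
  · have := (isHomogeneous_X F (2 : Fin 4)).mul ((isHomogeneous_X F (1 : Fin 4)).pow (p - 1))
    rwa [hp] at this

lemma xi_hom : (xipoly F).IsHomogeneous 2 := by
  refine IsHomogeneous.sub ?_ ?_
  · rw [← C_three]
    exact ((isHomogeneous_X F (2 : Fin 4)).pow 2).C_mul 3
  · rw [← C_four, mul_assoc]
    exact ((isHomogeneous_X F (3 : Fin 4)).mul (isHomogeneous_X F 1)).C_mul 4

lemma tau_hom (k b : ℕ) : (xipoly F ^ k * Mpoly p F ^ b).IsHomogeneous (2 * k + p * b) :=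
  (xi_hom.pow k).mul (Mpoly_hom.pow b)

lemma degX (i : Fin 4) (hi : i ≠ 3) : degreeOf 3 (X i : MvPolynomial (Fin 4) F) = 0 := by
  rw [degreeOf_X, if_neg hi.symm]

lemma degM : degreeOf 3 (Mpoly p F) = 0 := by
  have h1 : degreeOf 3 (X 2 ^ p : MvPolynomial (Fin 4) F) ≤ 0 := by
    refine (degreeOf_pow_le _ _ _).trans ?_
    rw [degX 2 (by decide), mul_zero]
  have h2 : degreeOf 3 (X 2 * X 1 ^ (p - 1) : MvPolynomial (Fin 4) F) ≤ 0 := by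
    refine (degreeOf_mul_le _ _ _).trans ?_
    have := degreeOf_pow_le (3 : Fin 4) (X 1 : MvPolynomial (Fin 4) F) (p - 1)
    rw [degX 1 (by decide), mul_zero] at this
    rw [degX 2 (by decide)]; omega
  have h3 := degreeOf_sub_le (3 : Fin 4) (X 2 ^ p : MvPolynomial (Fin 4) F) (X 2 * X 1 ^ (p - 1))
  unfold Mpoly
  omega

lemma degxi : degreeOf 3 (xipoly F) ≤ 1 := by
  have h1 : degreeOf 3 (3 * X 2 ^ 2 : MvPolynomial (Fin 4) F) ≤ 0 := by
    rw [← C_three]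
    refine (degreeOf_C_mul_le _ _ _).trans ?_
    refine (degreeOf_pow_le _ _ _).trans ?_
    rw [degX 2 (by decide), mul_zero]
  have h2 : degreeOf 3 (4 * X 3 * X 1 : MvPolynomial (Fin 4) F) ≤ 1 := by
    rw [← C_four, mul_assoc]
    refine (degreeOf_C_mul_le _ _ _).trans ?_
    refine (degreeOf_mul_le _ _ _).trans ?_
    rw [degX 1 (by decide), degreeOf_X]; simp
  have h3 := degreeOf_sub_le (3 : Fin 4) (3 * X 2 ^ 2 : MvPolynomial (Fin 4) F) (4 * X 3 * X 1)
  unfold xipoly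
  omega

lemma degtau (k b : ℕ) : degreeOf 3 (xipoly F ^ k * Mpoly p F ^ b) ≤ k := by
  refine (degreeOf_mul_le _ _ _).trans ?_
  have h1 := degreeOf_pow_le (3 : Fin 4) (xipoly F) k
  have h2 := degreeOf_pow_le (3 : Fin 4) (Mpoly p F) b
  rw [degM, mul_zero] at h2
  have h3 : k * degreeOf 3 (xipoly F) ≤ k * 1 := Nat.mul_le_mul_left _ degxi
  omega

lemma ev_xi : ev F (xipoly F) = Polynomial.C 3 := by
  simp [ev, xipoly]
  exact (map_ofNat Polynomial.C 3).symm

lemma ev_M : ev F (Mpoly p F) = 1 - Polynomial.X ^ (p - 1) := by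
  simp [ev, Mpoly]

lemma ev_X1 : ev F (X 1) = Polynomial.X := by simp [ev]

lemma coeff0_eq (r : MvPolynomial (Fin 4) F) : (ev F r).coeff 0 = aeval ![(0 : F), 0, 1, 0] r := by
  rw [Polynomial.coeff_zero_eq_eval_zero, ev, ← Polynomial.coe_aeval_eq_eval, ← AlgHom.comp_apply]
  congr 1
  apply MvPolynomial.algHom_ext
  intro i
  fin_cases i <;> simp

lemma TF.kill01 (hp : 3 < p) {d : ℕ} {r : MvPolynomial (Fin 4) F} (hr : TF p F d r) :
    aeval ![0, 0, X 2, X 3] r = (C ((ev F r).coeff 0) * X 2 ^ d : MvPolynomial (Fin 4) F) := by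
  apply aeval_const_of_roots (p := p) _ _ _ _ _ hr.deg
    (fun s => (3 * C (cF p F s) * X 2 : MvPolynomial (Fin 4) F))
  · intro s t h
    have := congrArg (aeval ![(0 : F), 0, 1, 0]) h
    simp [three_ne hp, aeval_C] at this
    exact cF_inj this
  · intro s
    have h := hr.shift (S := MvPolynomial (Fin 4) F) 0 (X 2) 0 s
    rw [plane _ _ hr.hom, Finset.sum_eq_single 0] at h
    · simp [-algHom_C, algebraMap_eq] at h
      simpa using h
    · intro i _ hi
      simp [hi]
    · simp

lemma TF.odd (hp : 3 < p) {d : ℕ} {r : MvPolynomial (Fin 4) F} (hr : TF p F d r) (hd : Odd d) (hdp : d < p) :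
    (ev F r).coeff 0 = 0 := by
  have h1 : ∀ w : ZMod p, w ≠ 0 → (ev F r).eval (cF p F w) + (ev F r).eval (-cF p F w) = 0 := by
    intro w hw
    have e1 : ∀ x : F, (ev F r).eval x = aeval ![0, x, 1, 0] r := by
      intro x
      rw [ev, ← Polynomial.coe_aeval_eq_eval, ← AlgHom.restrictScalars_apply F, ← AlgHom.comp_apply]
      congr 1
      apply MvPolynomial.algHom_ext
      intro i
      fin_cases i <;> simp
    have e2 := hr.shift (S := F) (cF p F w) 1 0 (-w⁻¹)
    have hw' : cF p F w ≠ 0 := by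
      rw [Ne, map_eq_zero]; exact hw
    rw [e1, e1, ← e2, Algebra.algebraMap_self_apply, map_neg, map_inv₀]
    have e3 : 1 + 2 * -(cF p F w)⁻¹ * cF p F w = -1 := by field_simp; norm_num
    have e4 : 0 + 3 * -(cF p F w)⁻¹ * 1 + 3 * (-(cF p F w)⁻¹) ^ 2 * cF p F w = 0 := by
      field_simp; norm_num
    rw [e3, e4, plane _ _ hr.hom, plane _ _ hr.hom, ← Finset.sum_add_distrib]
    apply Finset.sum_eq_zero
    intro i hi
    have hi' : i ≤ d := by simp at hi; omega
    have : (-1 : F) ^ (d - i) = - (-1) ^ i := by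
      have h3 : (-1 : F) ^ (d - i) * (-1) ^ i = -1 := by
        rw [← pow_add, Nat.sub_add_cancel hi', hd.neg_one_pow]
      have h4 : ((-1 : F) ^ i) * (-1) ^ i = 1 := by
        rw [← mul_pow]; simp
      linear_combination (-1 : F) ^ i * h3 - (-1 : F) ^ (d - i) * h4
    rw [this, neg_pow (cF p F w)]
    ring
  set P := ev F r + (ev F r).comp (-Polynomial.X)
  have hP : P = 0 := by
    apply Polynomial.eq_zero_of_natDegree_lt_card_of_eval_eq_zero P
      (f := fun w : (ZMod p)ˣ => cF p F w)
    · intro a b h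
      exact Units.ext (cF_inj h)
    · intro w
      simpa [P] using h1 w w.ne_zero
    · rw [ZMod.card_units_eq_totient, Nat.totient_prime Fact.out]
      have h2 := ev_natDegree hr.hom
      have h3 : ((ev F r).comp (-Polynomial.X)).natDegree ≤ d := by
        refine (Polynomial.natDegree_comp_le).trans ?_
        simpa using h2
      have h4 : P.natDegree ≤ _ := Polynomial.natDegree_add_le _ _
      have h5 : d ≠ p - 1 := by
        rintro rfl
        have := (Fact.out : p.Prime).eq_two_or_odd'
        rcases this with h | h
        · omega
        · obtain ⟨a, ha⟩ := h
          obtain ⟨b, hb⟩ := hd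
          omega
      have h6 : max (ev F r).natDegree ((ev F r).comp (-Polynomial.X)).natDegree ≤ d := max_le h2 h3
      omega
  have := congrArg (Polynomial.eval 0) hP
  simp [P, ← Polynomial.coeff_zero_eq_eval_zero] at this
  have h2 : (2 : F) * (ev F r).coeff 0 = 0 := by rw [two_mul]; exact this
  exact (mul_eq_zero.mp h2).resolve_left (two_ne hp)

lemma exists_kb (hp : 3 < p) (d : ℕ) (h : ¬ (Odd d ∧ d < p)) : ∃ k b, 2 * k + p * b = d ∧ k < p := by
  have hpo : p % 2 = 1 := by
    rcases (Fact.out : p.Prime).eq_two_or_odd with h | h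
    · omega
    · exact h
  rcases Nat.even_or_odd d with he | ho
  · obtain ⟨a, ha⟩ := he
    refine ⟨a % p, 2 * (a / p), ?_, Nat.mod_lt _ (by omega)⟩
    have := Nat.mod_add_div a p
    rw [ha]
    calc 2 * (a % p) + p * (2 * (a / p)) = 2 * (a % p + p * (a / p)) := by ring
      _ = a + a := by rw [this]; ring
  · have hdp : p ≤ d := by
      by_contra h'; exact h ⟨ho, by omega⟩
    obtain ⟨c, hc⟩ := ho
    obtain ⟨a, ha⟩ : ∃ a, d = p + (a + a) := ⟨(d - p) / 2, by omega⟩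
    refine ⟨a % p, 2 * (a / p) + 1, ?_, Nat.mod_lt _ (by omega)⟩
    have := Nat.mod_add_div a p
    rw [ha]
    calc 2 * (a % p) + p * (2 * (a / p) + 1) = p + 2 * (a % p + p * (a / p)) := by ring
      _ = p + (a + a) := by rw [this]; ring

lemma TF.step (hp : 3 < p) {d : ℕ} {r : MvPolynomial (Fin 4) F} (hr : TF p F (d + 1) r)
    (g : MvPolynomial (Fin 4) F) (hg : TF p F (d + 1) g) (h0 : (ev F g).coeff 0 = (ev F r).coeff 0) :
    ∃ r', TF p F d r' ∧ X 0 ∣ r - (g + X 1 * r') := by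
  have hz : aeval ![0, 0, X 2, X 3] (r - g) = (0 : MvPolynomial (Fin 4) F) := by
    rw [map_sub, hr.kill01 hp, hg.kill01 hp, h0, sub_self]
  have hkk : aeval (![X 0, 0, X 2, X 3] : Fin 4 → MvPolynomial (Fin 4) F) (kill0 F (r - g)) =
      aeval (![0, 0, X 2, X 3] : Fin 4 → MvPolynomial (Fin 4) F) (r - g) := by
    rw [kill0, ← AlgHom.comp_apply]
    refine congrFun (congrArg DFunLike.coe ?_) (r - g)
    apply MvPolynomial.algHom_ext
    intro i
    fin_cases i <;> simp
  obtain ⟨q, hq⟩ := X1_dvd_sub (kill0 F (r - g))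
  rw [hkk, hz, sub_zero] at hq
  have hkh : (kill0 F (r - g)).IsHomogeneous (1 + d) := by
    have hx : ∀ i, ((![0, X 1, X 2, X 3] : Fin 4 → MvPolynomial (Fin 4) F) i).IsHomogeneous 1 := by
      intro i
      fin_cases i
      · exact isHomogeneous_zero _ _ _
      · exact isHomogeneous_X _ _
      · exact isHomogeneous_X _ _
      · exact isHomogeneous_X _ _
    have := (hr.hom.sub hg.hom).aeval _ hx
    rw [add_comm 1 d]
    simpa [kill0] using this
  set r' := homogeneousComponent d q with hr'
  have hq' : kill0 F (r - g) = X 1 * r' := by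
    rw [hr', ← hcomp_mul (isHomogeneous_X F 1), ← hq]
    exact (homogeneousComponent_eq_self hkh).symm
  refine ⟨r', ⟨homogeneousComponent_isHomogeneous _ _, ?_, ?_⟩, ?_⟩
  · have h1 : degreeOf 3 (X 1 * r') < p := by
      rw [← hq']
      refine lt_of_le_of_lt (degreeOf_aeval_le _ ?_ ?_ _)
        (lt_of_le_of_lt (degreeOf_sub_le _ _ _) (max_lt hr.deg hg.deg))
      · intro i hi
        fin_cases i
        · simp
        · exact degX 1 (by decide)
        · exact degX 2 (by decide)
        · exact absurd rfl hi
      · simp [degreeOf_X]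
    by_cases h2 : r' = 0
    · rw [h2, degreeOf_zero]; omega
    · rw [degreeOf_mul_eq (X_ne_zero _) h2] at h1
      omega
  · intro s
    apply X0_dvd_X1_mul
    rw [X0_dvd_iff, map_mul, map_sub]
    have h1 : X 1 * r' ∈ PI p F := by
      have h2 : r - g ∈ PI p F := Subalgebra.sub_mem _ (mem_PI.mpr hr.inv) (mem_PI.mpr hg.inv)
      rw [← hq']
      have h3 := X0_dvd_sub_kill0 (r - g)
      rw [mem_PI] at h2 ⊢
      intro s
      obtain ⟨v, hv⟩ := h3
      have h4 : kill0 F (r - g) = (r - g) - X 0 * v := by rw [← hv]; ring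
      rw [h4, map_sub, map_mul, act_u_X0]
      have h5 : act p F !![1, s; 0, 1] (r - g) - X 0 * act p F !![1, s; 0, 1] v - (r - g - X 0 * v) =
        (act p F !![1, s; 0, 1] (r - g) - (r - g)) + X 0 * (v - act p F !![1, s; 0, 1] v) := by ring
      rw [h5]
      exact dvd_add (h2 s) (dvd_mul_right _ _)
    have h6 := h1 s
    have h7 := X1_PI (p := p) (F := F) s
    rw [map_mul, map_mul, map_mul, h7] at h6
    linear_combination h6
  · rw [X0_dvd_iff, map_sub, map_add, map_mul]
    have h1 : kill0 F (X 1 * r') = X 1 * r' := by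
      rw [← hq', ← sub_eq_zero, ← map_sub]
      rw [← X0_dvd_iff, ← dvd_neg, neg_sub]
      exact X0_dvd_sub_kill0 _
    rw [map_mul] at h1
    rw [h1, ← hq', map_sub]; ring

lemma TF_tau (k b : ℕ) (hk : k < p) (c : F) : TF p F (2 * k + p * b) (C c * (xipoly F ^ k * Mpoly p F ^ b)) where
  hom := (tau_hom k b).C_mul c
  deg := lt_of_le_of_lt ((degreeOf_C_mul_le _ _ _).trans (degtau k b)) hk
  inv := mem_PI.mp (Subalgebra.mul_mem _ (Subalgebra.algebraMap_mem _ c)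
    (Subalgebra.mul_mem _ (Subalgebra.pow_mem _ xi_PI _) (Subalgebra.pow_mem _ M_PI _)))

lemma ev_tau0 (hp : 3 < p) (k b : ℕ) (c : F) :
    (ev F (C c * (xipoly F ^ k * Mpoly p F ^ b))).coeff 0 = c * 3 ^ k := by
  have : (ev F) (C c) = Polynomial.C c := (ev F).commutes c
  rw [Polynomial.coeff_zero_eq_eval_zero, map_mul, map_mul, map_pow, map_pow, ev_xi, ev_M, this]
  simp [show p - 1 ≠ 0 by omega]

lemma TF.six (hp : 3 < p) {d : ℕ} {r : MvPolynomial (Fin 4) F} (hr : TF p F (d + 1) r) :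
    ∃ r' c k b, TF p F d r' ∧ (c ≠ 0 → 2 * k + p * b = d + 1) ∧ c * 3 ^ k = (ev F r).coeff 0 ∧
      X 0 ∣ r - (C c * (xipoly F ^ k * Mpoly p F ^ b) + X 1 * r') := by
  by_cases h : Odd (d + 1) ∧ d + 1 < p
  · have h0 := hr.odd hp h.1 h.2
    have hz : TF p F (d + 1) (0 : MvPolynomial (Fin 4) F) :=
      ⟨isHomogeneous_zero _ _ _, by rw [degreeOf_zero]; omega, by simp⟩
    obtain ⟨r', h1, h2⟩ := hr.step hp 0 hz (by simp [h0])
    refine ⟨r', 0, 0, 0, h1, by simp, by simp [h0], ?_⟩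
    simpa using h2
  · obtain ⟨k, b, hkb, hk⟩ := exists_kb hp (d + 1) h
    have h3 : (3 : F) ^ k ≠ 0 := pow_ne_zero _ (three_ne hp)
    set c := (ev F r).coeff 0 / 3 ^ k
    have hg := TF_tau k b hk c
    rw [hkb] at hg
    have hc : c * 3 ^ k = (ev F r).coeff 0 := div_mul_cancel₀ _ h3
    obtain ⟨r', h1, h2⟩ := hr.step hp _ hg (by rw [ev_tau0 hp, hc])
    exact ⟨r', c, k, b, h1, fun _ => hkb, hc, h2⟩

lemma ev_eq_of_dvd {f g : MvPolynomial (Fin 4) F} (h : X 0 ∣ f - g) : ev F f = ev F g :=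
  aeval_eq_of_dvd rfl h

lemma TF.span (hp : 3 < p) (W : Submodule F (MvPolynomial (Fin 4) F)) (hW : ∀ f, X 0 ∣ f → f ∈ W)
    (A : MvPolynomial (Fin 4) F) : ∀ (d : ℕ) (r : MvPolynomial (Fin 4) F), TF p F d r → ∀ t : ℕ,
    (∀ i k b, i + 2 * k + p * b = d → (d < p → (ev F r).coeff i ≠ 0) →
      A * (X 1 ^ (t + i) * (xipoly F ^ k * Mpoly p F ^ b)) ∈ W) → A * (X 1 ^ t * r) ∈ W := by
  intro d
  induction d with
  | zero =>
    intro r hr t h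
    have hr0 : r = C (coeff 0 r) := by
      have := homogeneousComponent_eq_self hr.hom
      rw [homogeneousComponent_zero] at this
      exact this.symm
    by_cases hc : coeff 0 r = 0
    · rw [hr0, hc]; simp
    · have h1 := h 0 0 0 (by simp) (fun _ => by
        have h4 : (ev F) (C (coeff 0 r)) = Polynomial.C (coeff 0 r) := (ev F).commutes _
        rw [hr0, h4]
        simpa using hc)
      rw [hr0]
      have := W.smul_mem (coeff 0 r) h1
      rw [smul_eq_C_mul] at this
      convert this using 1
      simp; ring
  | succ d ih =>
    intro r hr t h
    obtain ⟨r', c, k, b, hr', hkb, hc, hd⟩ := hr.six hp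
    have hpp := (Fact.out : p.Prime).pos
    have h1 : A * (X 1 ^ t * r) = A * X 1 ^ t * (r - (C c * (xipoly F ^ k * Mpoly p F ^ b) + X 1 * r')) +
      c • (A * (X 1 ^ (t + 0) * (xipoly F ^ k * Mpoly p F ^ b))) + A * (X 1 ^ (t + 1) * r') := by
      rw [smul_eq_C_mul]; ring
    rw [h1]
    refine W.add_mem (W.add_mem (hW _ (hd.mul_left _)) ?_) ?_
    · by_cases hc0 : c = 0
      · rw [hc0, zero_smul]; exact W.zero_mem
      · apply W.smul_mem
        apply h 0 k b
        · rw [zero_add]; exact hkb hc0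
        · intro _
          rw [← hc]
          exact mul_ne_zero hc0 (pow_ne_zero _ (three_ne hp))
    · apply ih r' hr' (t + 1)
      intro i k' b' hi hco
      have h2 := h (i + 1) k' b' (by omega) ?_
      · rw [show t + 1 + i = t + (i + 1) by ring]; exact h2
      · intro hdp
        have h3 := ev_eq_of_dvd hd
        have h4 : (ev F) (C c) = Polynomial.C c := (ev F).commutes c
        have h5 : ev F (C c * (xipoly F ^ k * Mpoly p F ^ b)) = Polynomial.C (c * 3 ^ k) := by
          by_cases hc0 : c = 0
          · simp [hc0]
          · have hb : b = 0 := by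
              by_contra hb
              have h6 := hkb hc0
              have : p * 1 ≤ p * b := Nat.mul_le_mul_left _ (by omega)
              omega
            rw [hb, map_mul, map_mul, map_pow, ev_xi, h4]
            simp
        rw [h3, map_add, h5, map_mul (ev F), ev_X1, Polynomial.coeff_add, Polynomial.coeff_X_mul,
          Polynomial.coeff_C_succ, zero_add]
        exact hco (by omega)
end S4

section S5
variable {p : ℕ} [Fact p.Prime] {F : Type} [Field F] [CharP F p]

/-- view as a polynomial in `X 3` -/
def Psi (F : Type) [Field F] : MvPolynomial (Fin 4) F ≃ₐ[F] Polynomial (MvPolynomial (Fin 3) F) :=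
  (renameEquiv F (Equiv.swap (0 : Fin 4) 3)).trans (finSuccEquiv F 3)

lemma natDegree_Psi (f : MvPolynomial (Fin 4) F) : (Psi F f).natDegree = degreeOf 3 f := by
  have h1 : Psi F f = finSuccEquiv F 3 (rename (Equiv.swap (0 : Fin 4) 3) f) := rfl
  rw [h1, natDegree_finSuccEquiv]
  have := degreeOf_rename_of_injective (p := f) (Equiv.swap (0 : Fin 4) 3).injective 3
  rw [← this, Equiv.swap_apply_right]

lemma Psi_l (s : ZMod p) : ∃ c, Psi F (act p F !![1, s; 0, 1] (X 3)) = Polynomial.X + Polynomial.C c := by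
  have h3 : Psi F (X 3) = Polynomial.X := by
    have : Psi F (X 3) = finSuccEquiv F 3 (rename (Equiv.swap (0 : Fin 4) 3) (X 3)) := rfl
    rw [this, rename_X, Equiv.swap_apply_right, finSuccEquiv_X_zero]
  have h0 : Psi F (X 0) = Polynomial.C (X 2) := by
    have : Psi F (X 0) = finSuccEquiv F 3 (rename (Equiv.swap (0 : Fin 4) 3) (X 0)) := rfl
    rw [this, rename_X, Equiv.swap_apply_left, show (3 : Fin 4) = Fin.succ 2 from rfl, finSuccEquiv_X_succ]
  have h1 : Psi F (X 1) = Polynomial.C (X 0) := by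
    have : Psi F (X 1) = finSuccEquiv F 3 (rename (Equiv.swap (0 : Fin 4) 3) (X 1)) := rfl
    rw [this, rename_X, show (Equiv.swap (0 : Fin 4) 3) 1 = Fin.succ 0 by decide, finSuccEquiv_X_succ]
  have h2 : Psi F (X 2) = Polynomial.C (X 1) := by
    have : Psi F (X 2) = finSuccEquiv F 3 (rename (Equiv.swap (0 : Fin 4) 3) (X 2)) := rfl
    rw [this, rename_X, show (Equiv.swap (0 : Fin 4) 3) 2 = Fin.succ 1 by decide, finSuccEquiv_X_succ]
  have hC : ∀ a : F, Psi F (C a) = Polynomial.C (C a) := fun a => by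
    have := (Psi F).commutes a
    exact this
  refine ⟨C (cF p F s) ^ 3 * X 2 + 3 * C (cF p F s) ^ 2 * X 0 + 3 * C (cF p F s) * X 1, ?_⟩
  have : act p F !![1, s; 0, 1] (X 3) = X 3 + C (cF p F s) ^ 3 * X 0 + 3 * C (cF p F s) ^ 2 * X 1 + 3 * C (cF p F s) * X 2 := by
    simp [act, cF]; ring
  rw [this]
  simp only [map_add, map_mul, map_pow, map_ofNat, h0, h1, h2, h3, hC]
  ring

lemma Psi_N_monic : (Psi F (Npoly p F)).Monic ∧ (Psi F (Npoly p F)).natDegree = p := by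
  have h : ∀ s : ZMod p, (Psi F (act p F !![1, s; 0, 1] (X 3))).Monic := fun s => by
    obtain ⟨c, hc⟩ := Psi_l (F := F) s
    rw [hc]; exact Polynomial.monic_X_add_C _
  rw [Npoly, map_prod]
  refine ⟨Polynomial.monic_prod_of_monic _ _ fun s _ => h s, ?_⟩
  rw [Polynomial.natDegree_prod_of_monic _ _ fun s _ => h s]
  have : ∀ s : ZMod p, (Psi F (act p F !![1, s; 0, 1] (X 3))).natDegree = 1 := fun s => by
    obtain ⟨c, hc⟩ := Psi_l (F := F) s
    rw [hc]; exact Polynomial.natDegree_X_add_C _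
  simp [this, ZMod.card]

lemma degN : degreeOf 3 (Npoly p F) = p := by
  rw [← natDegree_Psi]; exact Psi_N_monic.2

lemma N_ne : Npoly p F ≠ 0 := by
  intro h
  have := degN (p := p) (F := F)
  rw [h, degreeOf_zero] at this
  exact (Fact.out : p.Prime).pos.ne this

lemma N_div_unique {q r : MvPolynomial (Fin 4) F} (h : Npoly p F * q = r) (hr : degreeOf 3 r < p) :
    q = 0 ∧ r = 0 := by
  by_cases hq : q = 0
  · refine ⟨hq, ?_⟩; rw [← h, hq, mul_zero]
  · rw [← h, degreeOf_mul_eq N_ne hq, degN] at hr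
    omega

lemma N_div (f : MvPolynomial (Fin 4) F) : ∃ q r, f = Npoly p F * q + r ∧ degreeOf 3 r < p := by
  obtain ⟨hm, hd⟩ := Psi_N_monic (p := p) (F := F)
  refine ⟨(Psi F).symm (Psi F f /ₘ Psi F (Npoly p F)), (Psi F).symm (Psi F f %ₘ Psi F (Npoly p F)), ?_, ?_⟩
  · apply (Psi F).injective
    rw [map_add, map_mul, AlgEquiv.apply_symm_apply, AlgEquiv.apply_symm_apply, add_comm]
    exact (Polynomial.modByMonic_add_div _ _).symm
  · rw [← natDegree_Psi, AlgEquiv.apply_symm_apply]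
    conv_rhs => rw [← hd]
    apply Polynomial.natDegree_modByMonic_lt _ hm
    intro h
    rw [h] at hd
    simp at hd
    exact (Fact.out : p.Prime).pos.ne hd

lemma N_div_hom {d : ℕ} {f : MvPolynomial (Fin 4) F} (hf : f.IsHomogeneous d) :
    ∃ q r, f = Npoly p F * q + r ∧ degreeOf 3 r < p ∧ r.IsHomogeneous d ∧
      (∀ e, d = p + e → q.IsHomogeneous e) ∧ (d < p → q = 0) := by
  obtain ⟨q, r, h, hr⟩ := N_div (p := p) f
  have hpos := (Fact.out : p.Prime).pos
  by_cases hd : d < p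
  · refine ⟨0, homogeneousComponent d r, ?_, lt_of_le_of_lt (degreeOf_hcomp _ _) hr,
      homogeneousComponent_isHomogeneous _ _, fun e he => by omega, fun _ => rfl⟩
    conv_lhs => rw [← homogeneousComponent_eq_self hf, h]
    rw [map_add, hcomp_mul_lt N_hom _ hd]; ring
  · obtain ⟨e, rfl⟩ := Nat.exists_eq_add_of_le (not_lt.mp hd)
    refine ⟨homogeneousComponent e q, homogeneousComponent (p + e) r, ?_, lt_of_le_of_lt (degreeOf_hcomp _ _) hr,
      homogeneousComponent_isHomogeneous _ _, fun e' he => ?_, fun h => absurd h hd⟩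
    · conv_lhs => rw [← homogeneousComponent_eq_self hf, h]
      rw [map_add, hcomp_mul N_hom]
    · have : e' = e := by omega
      rw [this]; exact homogeneousComponent_isHomogeneous _ _

lemma N_div_sym {f q r : MvPolynomial (Fin 4) F} (h : f = Npoly p F * q + r) (hr : degreeOf 3 r < p)
    (g : Matrix (Fin 2) (Fin 2) (ZMod p)) (hg : degreeOf 3 (act p F g r) ≤ degreeOf 3 r) (c a : F)
    (hN : act p F g (Npoly p F) = C a * Npoly p F) (hf : C c * act p F g f = f) :
    C (c * a) * act p F g q = q ∧ C c * act p F g r = r := by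
  have h1 : Npoly p F * (C (c * a) * act p F g q - q) = r - C c * act p F g r := by
    rw [h, map_add, map_mul, hN] at hf
    rw [map_mul C]
    linear_combination hf
  have h2 : degreeOf 3 (r - C c * act p F g r) < p := by
    refine lt_of_le_of_lt (degreeOf_sub_le _ _ _) (max_lt hr ?_)
    exact lt_of_le_of_lt ((degreeOf_C_mul_le _ _ _).trans hg) hr
  obtain ⟨h3, h4⟩ := N_div_unique h1 h2
  exact ⟨sub_eq_zero.mp h3, (sub_eq_zero.mp h4).symm⟩

lemma deg_C_mul_X (c : F) (i : Fin 4) (hi : i ≠ 3) : degreeOf 3 (C c * X i : MvPolynomial (Fin 4) F) = 0 := by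
  have := degreeOf_C_mul_le (X i : MvPolynomial (Fin 4) F) 3 c
  rw [degX i hi] at this
  omega

lemma deg_act_u (s : ZMod p) (r : MvPolynomial (Fin 4) F) :
    degreeOf 3 (act p F !![1, s; 0, 1] r) ≤ degreeOf 3 r := by
  rw [act_def, ptAct_u]
  have hX := deg_C_mul_X (F := F)
  have hadd : ∀ a b : MvPolynomial (Fin 4) F, degreeOf 3 a = 0 → degreeOf 3 b = 0 → degreeOf 3 (a + b) = 0 := by
    intro a b ha hb
    have := degreeOf_add_le 3 a b
    rw [ha, hb] at this
    simpa using this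
  apply degreeOf_aeval_le
  · intro i hi
    fin_cases i
    · exact degX 0 (by decide)
    · exact hadd _ _ (degX 1 (by decide)) (hX _ 0 (by decide))
    · refine hadd _ _ (hadd _ _ (degX 2 (by decide)) ?_) ?_
      · have := hX (2 * cF p F s) 1 (by decide)
        rwa [map_mul, C_two] at this
      · have := hX (cF p F s ^ 2) 0 (by decide)
        rwa [map_pow] at this
    · exact absurd rfl hi
  · have h1 := hX (3 * cF p F s) 2 (by decide)
    have h2 := hX (3 * cF p F s ^ 2) 1 (by decide)
    have h3 := hX (cF p F s ^ 3) 0 (by decide)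
    rw [map_mul, C_three] at h1
    rw [map_mul, map_pow, C_three] at h2
    rw [map_pow] at h3
    have h4 : degreeOf 3 (X 3 : MvPolynomial (Fin 4) F) ≤ 1 := by rw [degreeOf_X]; simp
    have h5 := hadd _ _ (hadd _ _ h1 h2) h3
    have h6 := degreeOf_add_le 3 (X 3 : MvPolynomial (Fin 4) F) (3 * C (cF p F s) * X 2 +
      3 * C (cF p F s) ^ 2 * X 1 + C (cF p F s) ^ 3 * X 0)
    rw [h5] at h6
    simp only [← add_assoc] at h6
    refine le_trans h6 ?_
    simpa using h4

lemma deg_act_rho (w : ZMod p) (hw : w ≠ 0) (r : MvPolynomial (Fin 4) F) :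
    degreeOf 3 (act p F !![w, 0; 0, w⁻¹] r) ≤ degreeOf 3 r := by
  rw [act_def, ptAct_rho _ _ hw]
  have hX := deg_C_mul_X (F := F)
  apply degreeOf_aeval_le
  · intro i hi
    fin_cases i
    · have := hX (cF p F w⁻¹ ^ 3) 0 (by decide)
      rwa [map_pow] at this
    · exact hX (cF p F w⁻¹) 1 (by decide)
    · exact hX (cF p F w) 2 (by decide)
    · exact absurd rfl hi
  · have := degreeOf_C_mul_le (X 3 : MvPolynomial (Fin 4) F) 3 (cF p F w ^ 3)
    rw [map_pow] at this
    refine le_trans this ?_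
    rw [degreeOf_X]; simp

end S5

section S6

lemma tri (q : ℕ) (c : ℤ) : (q : ℤ) * c ≤ -q ∨ (q : ℤ) * c = 0 ∨ (q : ℤ) * c = q ∨ (q : ℤ) * c = 2 * q ∨
    3 * (q : ℤ) ≤ q * c := by
  have hq : (0 : ℤ) ≤ q := Int.natCast_nonneg q
  rcases lt_trichotomy c 0 with h | h | h
  · left; nlinarith
  · right; left; rw [h]; ring
  · obtain h | h | h : c = 1 ∨ c = 2 ∨ 3 ≤ c := by omega
    · right; right; left; rw [h]; ring
    · right; right; right; left; rw [h]; ring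
    · right; right; right; right; nlinarith

/-- weight condition -/
def okw (q j i k b : ℕ) : Prop := ∃ c : ℤ, (3 * j + 2 * k + b : ℤ) - i = 6 * (q * c)

/-- bad exponents -/
def badE (p i k b : ℕ) : Prop := b = 0 ∧ i < 2 * k ∧ 2 * (i + k) + 3 ≤ p

lemma claimC_step (q p : ℕ) (hq : 1 ≤ q) (hpq : p = 6 * q + 1) (mem : ℕ → ℕ → ℕ → ℕ → Prop)
    (hD : ∀ j i k b, mem j i k b → mem j (i + 2) (k + 1) b)
    (hL : ∀ j i k b, mem j i k b → mem j (i + 1) k (b + 1))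
    (hdel : ∀ j i k b, mem j i k b → mem (j + 2 * q) i k b)
    (hK1 : ∀ j i k b, mem j i k b → mem j (i + 6 * q) k b → mem j i (k + 3 * q) b)
    (hK2 : ∀ j i k b, mem j i k b → mem j i (k + 3 * q) b → mem j (i + 6 * q) k b)
    (base0 : mem (2 * q) 0 0 0)
    (base1 : ∀ j, 1 ≤ j → mem j (3 * j) 0 0)
    (fam2 : ∀ j, 1 ≤ j → j < 2 * q → mem j j (3 * q - j) 0)
    (fam1 : ∀ j k b, 1 ≤ j → j < 2 * q → 2 * k + p * b + 3 * j = 2 * (p - 1) →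
      (∀ i' k' b', 1 ≤ i' → i' + 2 * k' + p * b' + 3 * j = 2 * (p - 1) → okw q j i' k' b' → mem j i' k' b') →
        mem j 0 k b)
    (fam3 : ∀ j k b, 2 ≤ j → j < 2 * q → 1 + 2 * k + p * b + 3 * j = 2 * p →
      (∀ i' k' b', 2 ≤ i' → i' + 2 * k' + p * b' + 3 * j = 2 * p → okw q j i' k' b' → mem j i' k' b') →
        mem j 1 k b)
    (rel : ∀ j k b, mem j 0 (k + p) b → mem j (p - 1) (k + 1 + 3 * q) b → mem j (2 * (p - 1)) (k + 1) b →
      mem (j + 1) p k b → mem j 0 k (b + 2))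
    (j i k b : ℕ) (hj : 1 ≤ j) (hok : okw q j i k b) (hbad : ¬ badE p i k b)
    (H : ∀ j' i' k' b', 1 ≤ j' → okw q j' i' k' b' → ¬ badE p i' k' b' →
      (p * j' + i' + 2 * k' + p * b' < p * j + i + 2 * k + p * b ∨
        (p * j' + i' + 2 * k' + p * b' = p * j + i + 2 * k + p * b ∧ (i < i' ∨ (i' = i ∧ b' < b)))) →
      mem j' i' k' b') : mem j i k b := by
  obtain ⟨c, hc⟩ := hok
  have ht := tri q c
  unfold badE at hbad H
  by_cases hjn : 2 * q < j
  · obtain ⟨j', rfl⟩ : ∃ j', j = j' + 2 * q := ⟨j - 2 * q, by omega⟩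
    apply hdel
    apply H j' i k b (by omega) ⟨c - 1, by push_cast at hc; linear_combination hc⟩ hbad
    left
    have : p * (j' + 2 * q) = p * j' + p * (2 * q) := by ring
    have h2 : 0 < p * (2 * q) := by apply Nat.mul_pos <;> omega
    omega
  by_cases hb2 : 2 ≤ b
  · obtain ⟨b', rfl⟩ : ∃ b', b = b' + 2 := ⟨b - 2, by omega⟩
    have hm2 : p * (b' + 2) = p * b' + 2 * p := by ring
    have hm1 : p * (b' + 1) = p * b' + p := by ring
    have hmj : p * (j + 1) = p * j + p := by ring
    rcases Nat.eq_zero_or_pos i with rfl | hi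
    · apply rel
      · apply H _ _ _ _ hj ⟨c + 2, by subst hpq; push_cast at hc ⊢; linear_combination hc⟩ (by omega)
        right; exact ⟨by omega, by omega⟩
      · apply H _ _ _ _ hj ⟨c, by subst hpq; push_cast at hc ⊢; linear_combination hc⟩ (by omega)
        right; exact ⟨by omega, by omega⟩
      · apply H _ _ _ _ hj ⟨c - 2, by subst hpq; push_cast at hc ⊢; linear_combination hc⟩ (by omega)
        right; exact ⟨by omega, by omega⟩
      · apply H _ _ _ _ (by omega) ⟨c - 1, by subst hpq; push_cast at hc ⊢; linear_combination hc⟩ (by omega)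
        right; exact ⟨by omega, by omega⟩
    · obtain ⟨i', rfl⟩ : ∃ i', i = i' + 1 := ⟨i - 1, by omega⟩
      apply hL j i' k (b' + 1)
      apply H _ _ _ _ hj ⟨c, by push_cast at hc ⊢; linear_combination hc⟩ (by omega)
      left; omega
  obtain rfl | rfl : b = 0 ∨ b = 1 := by omega
  · rw [mul_zero] at H
    rcases Nat.eq_zero_or_pos k with rfl | hk
    · -- k = 0
      by_cases h0 : i < 3 * j
      · have : j = 2 * q ∧ i = 0 := by omega
        rw [this.1, this.2]; exact base0
      · by_cases h1 : i = 3 * j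
        · rw [h1]; exact base1 j hj
        · obtain ⟨i', rfl⟩ : ∃ i', i = i' + 6 * q := ⟨i - 6 * q, by omega⟩
          apply hK2
          · apply H _ _ _ _ hj ⟨c + 1, by push_cast at hc ⊢; linear_combination hc⟩ (by omega)
            left; omega
          · obtain ⟨i'', rfl⟩ : ∃ i'', i' = i'' + 2 := ⟨i' - 2, by omega⟩
            have : 3 * q = (3 * q - 1) + 1 := by omega
            rw [zero_add, this]
            apply hD
            apply H _ _ _ _ hj ?_ (by omega)
            · left; omega
            · rw [okw, Nat.cast_sub (by omega)]
              exact ⟨c + 2, by push_cast at hc ⊢; linear_combination hc⟩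
    obtain rfl | rfl | hi : i = 0 ∨ i = 1 ∨ 2 ≤ i := by omega
    · -- i = 0
      by_cases hk3 : k < 3 * q
      · exfalso; omega
      · by_cases hf : j < 2 * q ∧ (q : ℤ) * c = 2 * q
        · apply fam1 j k 0 hj hf.1 (by omega)
          intro i' k' b' hi' hd hok'
          apply H _ _ _ _ hj hok' (by
            rintro ⟨rfl, h1, h2⟩; omega)
          right; exact ⟨by omega, by omega⟩
        · obtain ⟨k', rfl⟩ : ∃ k', k = k' + 3 * q := ⟨k - 3 * q, by omega⟩
          have hn : mem j 0 k' 0 := by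
            apply H _ _ _ _ hj ⟨c - 1, by push_cast at hc ⊢; linear_combination hc⟩
            · rintro ⟨-, h1, h2⟩; omega
            · left; omega
          apply hK1 _ _ _ _ hn
          by_cases hk' : k' = 0
          · have hj' : j = 2 * q := by omega
            have := base1 j hj
            rw [hk', zero_add]
            rw [show 3 * j = 6 * q by omega] at this
            exact this
          · obtain ⟨k'', rfl⟩ : ∃ k'', k' = k'' + 1 := ⟨k' - 1, by omega⟩
            rw [show 0 + 6 * q = (6 * q - 2) + 2 by omega]
            apply hD
            apply H _ _ _ _ hj ?_ (by omega)
            · left; omega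
            · rw [okw, Nat.cast_sub (by omega)]
              exact ⟨c - 2, by push_cast at hc ⊢; linear_combination hc⟩
    · -- i = 1
      by_cases hf2 : j = 1 ∧ (q : ℤ) * c = q
      · have := fam2 j hj (by omega)
        rw [hf2.1] at this ⊢
        rw [show k = 3 * q - 1 by omega]
        exact this
      · by_cases hf3 : 3 ≤ j ∧ (q : ℤ) * c = 2 * q
        · apply fam3 j k 0 (by omega) (by omega) (by omega)
          intro i' k' b' hi' hd hok'
          apply H _ _ _ _ hj hok' (by
            rintro ⟨rfl, h1, h2⟩; omega)
          right; exact ⟨by omega, by omega⟩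
        · obtain ⟨k', rfl⟩ : ∃ k', k = k' + 1 + 3 * q := ⟨k - 3 * q - 1, by omega⟩
          apply hK1
          · apply H _ _ _ _ hj ⟨c - 1, by push_cast at hc ⊢; linear_combination hc⟩
            · rintro ⟨-, h1, h2⟩; omega
            · left; omega
          · rw [show 1 + 6 * q = (6 * q - 1) + 2 by omega]
            apply hD
            apply H _ _ _ _ hj ?_ (by omega)
            · left; omega
            · rw [okw, Nat.cast_sub (by omega)]
              exact ⟨c - 2, by push_cast at hc ⊢; linear_combination hc⟩
    · -- i ≥ 2
      obtain ⟨i', rfl⟩ : ∃ i', i = i' + 2 := ⟨i - 2, by omega⟩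
      obtain ⟨k', rfl⟩ : ∃ k', k = k' + 1 := ⟨k - 1, by omega⟩
      by_cases hb : i' < 2 * k' ∧ 2 * (i' + k') + 3 ≤ p
      · have h1 : i' + 2 = j ∧ k' + 1 = 3 * q - j ∧ j < 2 * q := by omega
        have := fam2 j hj h1.2.2
        rw [h1.2.1, h1.1]; exact this
      · apply hD
        apply H _ _ _ _ hj ⟨c, by push_cast at hc ⊢; linear_combination hc⟩ (by omega)
        left; omega
  · -- b = 1
    rw [mul_one] at H
    rcases Nat.eq_zero_or_pos i with rfl | hi
    · by_cases hf : (q : ℤ) * c = q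
      · apply fam1 j k 1 hj (by omega) (by omega)
        intro i' k' b' hi' hd hok'
        apply H _ _ _ _ hj hok' (by
          rintro ⟨rfl, h1, h2⟩; omega)
        right; exact ⟨by omega, by omega⟩
      · obtain ⟨k', rfl⟩ : ∃ k', k = k' + 1 + 3 * q := ⟨k - 3 * q - 1, by omega⟩
        apply hK1
        · apply H _ _ _ _ hj ⟨c - 1, by push_cast at hc ⊢; linear_combination hc⟩ (by omega)
          left; omega
        · rw [show 0 + 6 * q = (6 * q - 2) + 2 by omega]
          apply hD
          apply H _ _ _ _ hj ?_ (by omega)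
          · left; omega
          · rw [okw, Nat.cast_sub (by omega)]
            exact ⟨c - 2, by push_cast at hc ⊢; linear_combination hc⟩
    · obtain ⟨i', rfl⟩ : ∃ i', i = i' + 1 := ⟨i - 1, by omega⟩
      by_cases hb : i' < 2 * k ∧ 2 * (i' + k) + 3 ≤ p
      · obtain ⟨k', rfl⟩ : ∃ k', k = k' + 1 := ⟨k - 1, by omega⟩
        rcases Nat.eq_zero_or_pos i' with rfl | hi'
        · apply fam3 j _ 1 (by omega) (by omega) (by omega)
          intro i' k' b' hi' hd hok'
          apply H _ _ _ _ hj hok' (by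
            rintro ⟨rfl, h1, h2⟩; omega)
          right; exact ⟨by omega, by omega⟩
        · obtain ⟨i'', rfl⟩ : ∃ i'', i' = i'' + 1 := ⟨i' - 1, by omega⟩
          apply hD
          apply H _ _ _ _ hj ⟨c, by push_cast at hc ⊢; linear_combination hc⟩ (by omega)
          left; omega
      · apply hL
        apply H _ _ _ _ hj ⟨c, by push_cast at hc ⊢; linear_combination hc⟩ (by omega)
        left; omega

lemma claimC (q p : ℕ) (hq : 1 ≤ q) (hpq : p = 6 * q + 1) (mem : ℕ → ℕ → ℕ → ℕ → Prop)
    (hD : ∀ j i k b, mem j i k b → mem j (i + 2) (k + 1) b)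
    (hL : ∀ j i k b, mem j i k b → mem j (i + 1) k (b + 1))
    (hdel : ∀ j i k b, mem j i k b → mem (j + 2 * q) i k b)
    (hK1 : ∀ j i k b, mem j i k b → mem j (i + 6 * q) k b → mem j i (k + 3 * q) b)
    (hK2 : ∀ j i k b, mem j i k b → mem j i (k + 3 * q) b → mem j (i + 6 * q) k b)
    (base0 : mem (2 * q) 0 0 0)
    (base1 : ∀ j, 1 ≤ j → mem j (3 * j) 0 0)
    (fam2 : ∀ j, 1 ≤ j → j < 2 * q → mem j j (3 * q - j) 0)
    (fam1 : ∀ j k b, 1 ≤ j → j < 2 * q → 2 * k + p * b + 3 * j = 2 * (p - 1) →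
      (∀ i' k' b', 1 ≤ i' → i' + 2 * k' + p * b' + 3 * j = 2 * (p - 1) → okw q j i' k' b' → mem j i' k' b') →
        mem j 0 k b)
    (fam3 : ∀ j k b, 2 ≤ j → j < 2 * q → 1 + 2 * k + p * b + 3 * j = 2 * p →
      (∀ i' k' b', 2 ≤ i' → i' + 2 * k' + p * b' + 3 * j = 2 * p → okw q j i' k' b' → mem j i' k' b') →
        mem j 1 k b)
    (rel : ∀ j k b, mem j 0 (k + p) b → mem j (p - 1) (k + 1 + 3 * q) b → mem j (2 * (p - 1)) (k + 1) b →
      mem (j + 1) p k b → mem j 0 k (b + 2))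
    (j i k b : ℕ) (hj : 1 ≤ j) (hok : okw q j i k b) (hbad : ¬ badE p i k b) : mem j i k b := by
  have key : ∀ d s b', ∀ j i k b, p * j + i + 2 * k + p * b = d → i + s = d → b = b' → 1 ≤ j → okw q j i k b →
      ¬ badE p i k b → mem j i k b := by
    intro d
    induction d using Nat.strong_induction_on with
    | _ d ih1 =>
      intro s
      induction s using Nat.strong_induction_on with
      | _ s ih2 =>
        intro b'
        induction b' using Nat.strong_induction_on with
        | _ b' ih3 =>
          intro j i k b hd hs hb hj hok hbad
          apply claimC_step q p hq hpq mem hD hL hdel hK1 hK2 base0 base1 fam2 fam1 fam3 rel j i k b hj hok hbad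
          intro j' i' k' b'' hj' hok' hbad' h
          rcases h with h | ⟨h, h' | ⟨h1, h2⟩⟩
          · exact ih1 (p * j' + i' + 2 * k' + p * b'') (by omega) (p * j' + i' + 2 * k' + p * b'' - i') _ j' i' k' b'' rfl (by omega) rfl hj' hok' hbad'
          · exact ih2 (d - i') (by omega) _ j' i' k' b'' (by omega) (by omega) rfl hj' hok' hbad'
          · exact ih3 b'' (by omega) j' i' k' b'' (by omega) (by omega) rfl hj' hok' hbad'
  exact key _ (p * j + i + 2 * k + p * b - i) _ j i k b rfl (by omega) rfl hj hok hbad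

end S6

section S7
variable {p : ℕ} [Fact p.Prime] {F : Type} [Field F] [CharP F p]

lemma vander (n : ℕ) : ∀ (E : Finset ℕ) (Q : Polynomial F), E.card = n → (∀ e ∈ E, e < p) →
    (∀ e, e ∉ E → Q.coeff e = 0) → (Polynomial.X - 1) ^ n ∣ Q → Q = 0 := by
  induction n with
  | zero =>
    intro E Q hE _ hs _
    rw [Finset.card_eq_zero] at hE
    ext e
    simpa using hs e (by simp [hE])
  | succ n ih =>
    intro E Q hE hlt hs hd
    obtain ⟨a, ha⟩ : E.Nonempty := by rw [← Finset.card_pos]; omega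
    obtain ⟨W, hW⟩ := hd
    have h1 := ih (E.erase a) (Polynomial.X * Polynomial.derivative Q - Polynomial.C (a : F) * Q)
      (by rw [Finset.card_erase_of_mem ha]; omega) (fun e he => hlt e (Finset.mem_of_mem_erase he)) ?_ ?_
    · have h2 : ∀ e, e ≠ a → Q.coeff e = 0 := by
        intro e he
        by_cases heE : e ∈ E
        · have := congrArg (fun P => Polynomial.coeff P e) h1
          have h3 : ((e : F) - a) * Q.coeff e = 0 := by
            rw [← Polynomial.coeff_zero e, ← h1, Polynomial.coeff_sub, Polynomial.coeff_C_mul]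
            cases e with
            | zero => simp
            | succ e => rw [Polynomial.coeff_X_mul, Polynomial.coeff_derivative]; push_cast; ring
          refine (mul_eq_zero.mp h3).resolve_left ?_
          intro h4
          rw [sub_eq_zero] at h4
          rw [CharP.natCast_eq_natCast F p] at h4
          apply he
          have h5 := Nat.mod_eq_of_lt (hlt e heE)
          have h6 := Nat.mod_eq_of_lt (hlt a ha)
          rw [← h5, ← h6]; exact h4
        · exact hs e heE
      have h3 : Q = Polynomial.C (Q.coeff a) * Polynomial.X ^ a := by
        ext e
        rw [Polynomial.coeff_C_mul, Polynomial.coeff_X_pow]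
        by_cases he : e = a
        · simp [he]
        · simp [he, h2 e he]
      have h4 : Q.eval 1 = 0 := by rw [hW]; simp
      rw [h3] at h4 ⊢
      simp at h4
      simp [h4]
    · intro e he
      rw [Polynomial.coeff_sub, Polynomial.coeff_C_mul]
      have h3 : (Polynomial.X * Polynomial.derivative Q).coeff e = e * Q.coeff e := by
        cases e with
        | zero => simp
        | succ e => rw [Polynomial.coeff_X_mul, Polynomial.coeff_derivative]; push_cast; ring
      rw [h3]
      by_cases hea : e = a
      · rw [hea]; ring
      · rw [hs e (fun h => he (Finset.mem_erase.mpr ⟨hea, h⟩))]; ring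
    · rw [hW, Polynomial.derivative_mul, Polynomial.derivative_pow]
      refine ⟨Polynomial.X * (Polynomial.C ((n : F) + 1) * W + (Polynomial.X - 1) * Polynomial.derivative W) -
        Polynomial.C (a : F) * ((Polynomial.X - 1) * W), ?_⟩
      simp
      ring

lemma sum_units_pow (E : ℕ) : ∑ v : (ZMod p)ˣ, (cF p F v) ^ E = if p - 1 ∣ E then -1 else 0 := by
  have := FiniteField.sum_pow_units (K := ZMod p) E
  rw [ZMod.card] at this
  have h2 := congrArg (cF p F) this
  rw [map_sum] at h2
  simp only [map_pow] at h2
  rw [h2]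
  split_ifs <;> simp

/-- auxiliary terms -/
def GG (F : Type) [Field F] (m : Fin 4 →₀ ℕ) : Polynomial F :=
  Polynomial.C ((0 : F) ^ m 3 * (3⁻¹ : F) ^ (m 1 + m 2)) * ((Polynomial.X + 1) ^ m 1 * Polynomial.X ^ m 2)

/-- auxiliary terms -/
def HH (F : Type) [Field F] (m : Fin 4 →₀ ℕ) : Polynomial F :=
  Polynomial.C ((0 : F) ^ m 3 * (3⁻¹ : F) ^ (m 1 + m 2)) *
    ((Polynomial.X - Polynomial.C 2) ^ m 1 * (1 - Polynomial.X) ^ m 2)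

lemma GH1 (hp : 3 < p) {f : MvPolynomial (Fin 4) F} (hinv : ∀ s : ZMod p, act p F !![1, s; 0, 1] f = f)
    (v : ZMod p) : ∑ m ∈ f.support, Polynomial.C (coeff m f) * Polynomial.C (cF p F v) ^ (m 1 + 2 * m 2) *
      (GG F m - HH F m) = 0 := by
  have h3 := three_ne (F := F) hp
  have hexp : ∀ y1 y2 : Polynomial F, aeval ![1, Polynomial.C (cF p F v * 3⁻¹) * y1, Polynomial.C (cF p F v ^ 2 * 3⁻¹) * y2, 0] f =
      ∑ m ∈ f.support, Polynomial.C (coeff m f) * Polynomial.C (cF p F v) ^ (m 1 + 2 * m 2) *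
        (Polynomial.C ((0 : F) ^ m 3 * (3⁻¹ : F) ^ (m 1 + m 2)) * (y1 ^ m 1 * y2 ^ m 2)) := by
    intro y1 y2
    rw [aeval_def, eval₂_eq']
    apply Finset.sum_congr rfl
    intro m _
    rw [Fin.prod_univ_four, Polynomial.algebraMap_apply, Algebra.algebraMap_self_apply]
    simp only [Matrix.cons_val_zero, Matrix.cons_val_one, Matrix.cons_val, map_mul, map_pow, map_zero]
    ring
  have h1 := aeval_act (p := p) (F := F) (![1, Polynomial.C (cF p F v * 3⁻¹) * (Polynomial.X + 1),
    Polynomial.C (cF p F v ^ 2 * 3⁻¹) * Polynomial.X, 0] : Fin 4 → Polynomial F) !![1, -v; 0, 1] f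
  rw [hinv, ptAct_u] at h1
  have hC3 : (3 : Polynomial F) * Polynomial.C (3⁻¹ : F) = 1 := by
    rw [← map_ofNat Polynomial.C 3, ← map_mul, mul_inv_cancel₀ h3, map_one]
  have h2 : (![(![1, Polynomial.C (cF p F v * 3⁻¹) * (Polynomial.X + 1),
      Polynomial.C (cF p F v ^ 2 * 3⁻¹) * Polynomial.X, 0] : Fin 4 → Polynomial F) 0, 
      Polynomial.C (cF p F v * 3⁻¹) * (Polynomial.X + 1) + algebraMap F (Polynomial F) (cF p F (-v)) * 1,
      Polynomial.C (cF p F v ^ 2 * 3⁻¹) * Polynomial.X + 2 * algebraMap F (Polynomial F) (cF p F (-v)) *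
        (Polynomial.C (cF p F v * 3⁻¹) * (Polynomial.X + 1)) + algebraMap F (Polynomial F) (cF p F (-v)) ^ 2 * 1,
      0 + 3 * algebraMap F (Polynomial F) (cF p F (-v)) * (Polynomial.C (cF p F v ^ 2 * 3⁻¹) * Polynomial.X) +
       3 * algebraMap F (Polynomial F) (cF p F (-v)) ^ 2 * (Polynomial.C (cF p F v * 3⁻¹) * (Polynomial.X + 1)) +
       algebraMap F (Polynomial F) (cF p F (-v)) ^ 3 * 1] : Fin 4 → Polynomial F) =
      ![1, Polynomial.C (cF p F v * 3⁻¹) * (Polynomial.X - Polynomial.C 2),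
        Polynomial.C (cF p F v ^ 2 * 3⁻¹) * (1 - Polynomial.X), 0] := by
    rw [Polynomial.algebraMap_apply, Algebra.algebraMap_self_apply, map_neg, map_neg, map_mul, map_mul, map_pow]
    have h2C : (Polynomial.C 2 : Polynomial F) = 2 := map_ofNat _ 2
    rw [h2C]
    set a := Polynomial.C (cF p F v)
    set κ := Polynomial.C (3⁻¹ : F)
    funext i
    fin_cases i
    · rfl
    · simp
      linear_combination a * hC3
    · simp
      linear_combination (-a ^ 2) * hC3
    · simp
      linear_combination (a ^ 3) * hC3
  change _ = aeval (![_, Polynomial.C (cF p F v * 3⁻¹) * (Polynomial.X + 1) + algebraMap F (Polynomial F) (cF p F (-v)) * 1, _, _] : Fin 4 → Polynomial F) f at h1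
  erw [h2] at h1
  rw [hexp, hexp] at h1
  rw [← sub_eq_zero, ← Finset.sum_sub_distrib] at h1
  rw [← h1]
  apply Finset.sum_congr rfl
  intro m _
  rw [GG, HH]; ring

end S7

section S8
variable {p : ℕ} [Fact p.Prime] {F : Type} [Field F] [CharP F p]

lemma GH2 (hp : 3 < p) {f : MvPolynomial (Fin 4) F} (hinv : ∀ s : ZMod p, act p F !![1, s; 0, 1] f = f)
    (e : ℕ) : ∑ m ∈ f.support, (if p - 1 ∣ m 1 + 2 * m 2 + e then
      Polynomial.C (coeff m f) * (GG F m - HH F m) else 0) = 0 := by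
  have h1 : ∑ v : (ZMod p)ˣ, Polynomial.C (cF p F v) ^ e * (∑ m ∈ f.support, Polynomial.C (coeff m f) *
      Polynomial.C (cF p F v) ^ (m 1 + 2 * m 2) * (GG F m - HH F m)) = 0 := by
    apply Finset.sum_eq_zero
    intro v _
    rw [GH1 hp hinv, mul_zero]
  simp_rw [Finset.mul_sum] at h1
  rw [Finset.sum_comm] at h1
  rw [← neg_eq_zero]
  refine Eq.trans ?_ h1
  rw [← Finset.sum_neg_distrib]
  apply Finset.sum_congr rfl
  intro m _
  have h2 : ∀ v : (ZMod p)ˣ, Polynomial.C (cF p F v) ^ e * (Polynomial.C (coeff m f) *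
      Polynomial.C (cF p F v) ^ (m 1 + 2 * m 2) * (GG F m - HH F m)) =
      Polynomial.C (cF p F v ^ (m 1 + 2 * m 2 + e)) * (Polynomial.C (coeff m f) * (GG F m - HH F m)) := by
    intro v
    rw [map_pow]; ring
  simp_rw [h2]
  rw [← Finset.sum_mul, ← map_sum, sum_units_pow]
  split_ifs <;> simp

lemma coeff_pow_top (a : F) (n : ℕ) : ((Polynomial.X + Polynomial.C a) ^ n).coeff n = 1 := by
  have h := (Polynomial.monic_X_add_C a).pow n
  have h2 : ((Polynomial.X + Polynomial.C a) ^ n).natDegree = n := by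
    rw [Polynomial.natDegree_pow, Polynomial.natDegree_X_add_C, mul_one]
  have h3 := h.coeff_natDegree
  rwa [h2] at h3

lemma coeff_pow_gt (a : F) (n e : ℕ) (h : n < e) : ((Polynomial.X + Polynomial.C a) ^ n).coeff e = 0 := by
  apply Polynomial.coeff_eq_zero_of_natDegree_lt
  rw [Polynomial.natDegree_pow, Polynomial.natDegree_X_add_C, mul_one]; exact h

lemma GG_coeff_gt (m : Fin 4 →₀ ℕ) (e : ℕ) (h : m 1 + m 2 < e) : (GG F m).coeff e = 0 := by
  rw [GG, Polynomial.coeff_C_mul, ← map_one Polynomial.C, Polynomial.coeff_mul_X_pow', if_pos (by omega),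
    coeff_pow_gt _ _ _ (by omega), mul_zero]

lemma HH_coeff_gt (m : Fin 4 →₀ ℕ) (e : ℕ) (h : m 1 + m 2 < e) : (HH F m).coeff e = 0 := by
  rw [HH, Polynomial.coeff_C_mul]
  have : ((Polynomial.X - Polynomial.C (2 : F)) ^ m 1 * (1 - Polynomial.X) ^ m 2).coeff e = 0 := by
    apply Polynomial.coeff_eq_zero_of_natDegree_lt
    refine lt_of_le_of_lt Polynomial.natDegree_mul_le ?_
    have h1 : ((Polynomial.X - Polynomial.C (2 : F)) ^ m 1).natDegree ≤ m 1 := by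
      rw [Polynomial.natDegree_pow, Polynomial.natDegree_X_sub_C, mul_one]
    have h2 : ((1 - Polynomial.X : Polynomial F) ^ m 2).natDegree ≤ m 2 * 1 := by
      refine (Polynomial.natDegree_pow_le).trans (Nat.mul_le_mul_left _ ?_)
      refine (Polynomial.natDegree_sub_le _ _).trans ?_
      simp
    omega
  rw [this, mul_zero]

lemma GH_coeff (m : Fin 4 →₀ ℕ) (e : ℕ) (h : m 1 + 2 * m 2 ≤ e) : (GG F m - HH F m).coeff e = 0 := by
  rw [Polynomial.coeff_sub]
  by_cases h1 : m 1 + m 2 < e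
  · rw [GG_coeff_gt _ _ h1, HH_coeff_gt _ _ h1, sub_zero]
  · have h2 : m 2 = 0 := by omega
    have h3 : e = m 1 := by omega
    rw [GG, HH, h2, pow_zero, pow_zero, mul_one, mul_one, Polynomial.coeff_C_mul, Polynomial.coeff_C_mul, h3,
      ← map_one Polynomial.C, coeff_pow_top, sub_eq_add_neg Polynomial.X,
      ← map_neg Polynomial.C, coeff_pow_top, sub_self]

lemma bad_vanish (hp : 3 < p) {f : MvPolynomial (Fin 4) F} (hinv : ∀ s : ZMod p, act p F !![1, s; 0, 1] f = f)
    {d : ℕ} (hf : f.IsHomogeneous d) (i k : ℕ) (hd : i + 2 * k = d) (h1 : i < 2 * k) (h2 : 2 * (i + k) + 3 ≤ p) :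
    (ev F f).coeff i = 0 := by
  set t := i + 4 * k with ht
  set e := 2 * (p - 1) - t with he
  have het : t + e = 2 * (p - 1) := by omega
  have hdeg : ∀ m ∈ f.support, m 0 + m 1 + m 2 + m 3 = d := by
    intro m hm
    have := hf (mem_support_iff.mp hm)
    rw [Finsupp.weight_apply, Finsupp.sum_fintype _ _ (by simp), Fin.sum_univ_four] at this
    simpa using this
  have hdv : ∀ m ∈ f.support, p - 1 ∣ m 1 + 2 * m 2 + e → m 1 + 2 * m 2 ≠ t → m 1 + 2 * m 2 + (p - 1) = t := by
    intro m hm ⟨c, hc⟩ hne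
    have h3 := hdeg m hm
    obtain h | h | h | h : c = 0 ∨ c = 1 ∨ c = 2 ∨ 3 ≤ c := by omega
    · rw [h] at hc; omega
    · rw [h] at hc; omega
    · rw [h] at hc; omega
    · have := Nat.mul_le_mul_left (p - 1) h
      omega
  set Q : Polynomial F := ∑ m ∈ f.support, (if p - 1 ∣ m 1 + 2 * m 2 + e then
      Polynomial.C (coeff m f) * (GG F m - if m 1 + 2 * m 2 = t then 0 else HH F m) else 0) with hQ
  have hQ2 : Q = ∑ m ∈ f.support, (if p - 1 ∣ m 1 + 2 * m 2 + e then
      Polynomial.C (coeff m f) * (if m 1 + 2 * m 2 = t then HH F m else 0) else 0) := by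
    rw [← sub_eq_zero]
    refine Eq.trans ?_ (GH2 hp hinv e)
    rw [hQ, ← Finset.sum_sub_distrib]
    apply Finset.sum_congr rfl
    intro m _
    split_ifs <;> ring
  have hdvd : (Polynomial.X - 1) ^ (2 * k) ∣ Q := by
    rw [hQ2]
    apply Finset.dvd_sum
    intro m hm
    split_ifs with h3 h4
    · apply Dvd.dvd.mul_left
      rw [HH]
      by_cases h5 : m 3 = 0
      · apply Dvd.dvd.mul_left
        apply Dvd.dvd.mul_left
        have := hdeg m hm
        have h6 : (Polynomial.X - 1 : Polynomial F) ∣ 1 - Polynomial.X := ⟨-1, by ring⟩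
        exact (pow_dvd_pow_of_dvd h6 _).trans (pow_dvd_pow _ (by omega))
      · simp [h5]
    · simp
    · simp
  have hterm : ∀ m ∈ f.support, ∀ x, ((x < 2 * k ∨ d < x) ∨ m 1 + 2 * m 2 ≠ t) → t + 1 - p ≤ x → 
     (if p - 1 ∣ m 1 + 2 * m 2 + e then
      Polynomial.C (coeff m f) * (GG F m - if m 1 + 2 * m 2 = t then 0 else HH F m) else 0).coeff x = 0 := by
    intro m hm x hx1 hx2
    have h3 := hdeg m hm
    split_ifs with h4 h5
    · rw [sub_zero, Polynomial.coeff_C_mul]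
      have : (GG F m).coeff x = 0 := by
        by_cases h6 : m 3 = 0
        · rcases hx1 with (hx1 | hx1) | hx1
          · rw [GG, Polynomial.coeff_C_mul, Polynomial.coeff_mul_X_pow', if_neg (by omega), mul_zero]
          · exact GG_coeff_gt _ _ (by omega)
          · exact absurd h5 hx1
        · rw [GG]; simp [h6]
      rw [this, mul_zero]
    · rw [Polynomial.coeff_C_mul, GH_coeff, mul_zero]
      have := hdv m hm h4 h5
      omega
    · simp
  have hQ0 : Q = 0 := by
    obtain ⟨E, hE1, hE2⟩ : ∃ E : Finset ℕ, (Finset.Icc (2 * k) d ∪ Finset.range (t + 1 - p)).card ≤ E.card ∧ True :=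
      ⟨_, le_rfl, trivial⟩
    set E := Finset.Icc (2 * k) d ∪ Finset.range (t + 1 - p)
    have hc : E.card ≤ 2 * k := by
      refine (Finset.card_union_le _ _).trans ?_
      rw [Nat.card_Icc, Finset.card_range]
      omega
    apply vander (p := p) E.card E Q rfl
    · intro x hx
      rw [Finset.mem_union, Finset.mem_Icc, Finset.mem_range] at hx
      omega
    · intro x hx
      rw [Finset.mem_union, Finset.mem_Icc, Finset.mem_range] at hx
      rw [hQ, Polynomial.finset_sum_coeff]
      apply Finset.sum_eq_zero
      intro m hm
      apply hterm m hm <;> omega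
    · exact (pow_dvd_pow _ hc).trans hdvd
  have hco : Q.coeff (2 * k) = (3⁻¹ : F) ^ d * (ev F f).coeff i := by
    rw [ev_coeff_sum, hQ, Polynomial.finset_sum_coeff, Finset.mul_sum]
    apply Finset.sum_congr rfl
    intro m hm
    have h3 := hdeg m hm
    by_cases h4 : m 1 + 2 * m 2 = t
    · rw [if_pos h4, if_pos ⟨2, by omega⟩, sub_zero, Polynomial.coeff_C_mul, GG, Polynomial.coeff_C_mul,
        Polynomial.coeff_mul_X_pow']
      by_cases h5 : m 3 = 0
      · by_cases h6 : m 2 = 2 * k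
        · have h7 : m 0 = 0 ∧ m 3 = 0 ∧ m 1 = i := by omega
          rw [if_pos h7, h6, if_pos le_rfl, Nat.sub_self, h5, h7.2.2, hd]
          rw [Polynomial.coeff_zero_eq_eval_zero]
          simp
          ring
        · rw [if_neg (by omega), if_neg (by omega)]; simp
      · simp [h5]
    · rw [hterm m hm _ (Or.inr h4) (by omega), if_neg (by omega)]; simp
  rw [hQ0, Polynomial.coeff_zero] at hco
  exact (mul_eq_zero.mp hco.symm).resolve_left (pow_ne_zero _ (inv_ne_zero (three_ne hp)))

end S8

section S9
variable {p : ℕ} [Fact p.Prime] {F : Type} [Field F] [CharP F p]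

lemma powsum (k : ℕ) : ∑ s : ZMod p, (cF p F s) ^ k = if k ≠ 0 ∧ p - 1 ∣ k then -1 else 0 := by
  rw [sum_split, sum_units_pow, map_zero]
  by_cases hk : k = 0
  · simp [hk]
  · simp [hk]

lemma psum {S : Type*} [CommRing S] [Algebra F S] (P : Polynomial S) (hP : P.natDegree < 2 * (p - 1) + (p - 1)) :
    ∑ s : ZMod p, P.eval (algebraMap F S (cF p F s)) = - (P.coeff (p - 1) + P.coeff (2 * (p - 1))) := by
  have hp2 := (Fact.out : p.Prime).two_le
  simp_rw [Polynomial.eval_eq_sum_range' hP]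
  rw [Finset.sum_comm]
  have h1 : ∀ k ∈ Finset.range (2 * (p - 1) + (p - 1)), ∑ s : ZMod p, P.coeff k * algebraMap F S (cF p F s) ^ k =
      (if k = p - 1 then - P.coeff (p - 1) else 0) + (if k = 2 * (p - 1) then - P.coeff (2 * (p - 1)) else 0) := by
    intro k hk
    rw [Finset.mem_range] at hk
    rw [← Finset.mul_sum]
    simp_rw [← map_pow]
    rw [← map_sum]
    simp only [map_pow]
    rw [powsum]
    by_cases h1 : k = p - 1
    · rw [if_pos ⟨by omega, by rw [h1]⟩, if_pos h1, if_neg (by omega), h1]; simp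
    · by_cases h2 : k = 2 * (p - 1)
      · rw [if_pos ⟨by omega, by rw [h2]; exact dvd_mul_left _ _⟩, if_neg h1, if_pos h2, h2]; simp
      · rw [if_neg, if_neg h1, if_neg h2]
        · simp
        · rintro ⟨h3, c, hc⟩
          obtain h | h | h | h : c = 0 ∨ c = 1 ∨ c = 2 ∨ 3 ≤ c := by omega
          · rw [h] at hc; omega
          · rw [h] at hc; omega
          · rw [h] at hc; omega
          · have := Nat.mul_le_mul_left (p - 1) h
            omega
  rw [Finset.sum_congr rfl h1, Finset.sum_add_distrib, Finset.sum_ite_eq', Finset.sum_ite_eq',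
    if_pos (by rw [Finset.mem_range]; omega), if_pos (by rw [Finset.mem_range]; omega)]
  ring

lemma three_pow (hp : 3 < p) : (3 : F) ^ (p - 1) = 1 := by
  have h3 : (3 : ZMod p) ≠ 0 := by
    intro h
    apply three_ne (F := F) hp
    have := congrArg (cF p F) h
    rwa [map_ofNat, map_zero] at this
  have := congrArg (cF p F) (ZMod.pow_card_sub_one_eq_one h3)
  rwa [map_pow, map_ofNat, map_one] at this

lemma act_rho_X1 (w : ZMod p) (hw : w ≠ 0) : act p F !![w, 0; 0, w⁻¹] (X 1) = C (cF p F w⁻¹) * X 1 := by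
  rw [act_def, ptAct_rho _ _ hw, aeval_X]; rfl

lemma act_rho_X2 (w : ZMod p) (hw : w ≠ 0) : act p F !![w, 0; 0, w⁻¹] (X 2) = C (cF p F w) * X 2 := by
  rw [act_def, ptAct_rho _ _ hw, aeval_X]; rfl

lemma cF_pow_sub (w : ZMod p) (hw : w ≠ 0) : cF p F w ^ (p - 1) = 1 := by
  rw [← map_pow, ZMod.pow_card_sub_one_eq_one hw, map_one]

lemma trP_X1 : trP p F (X 1 ^ (p - 1)) = - X 0 ^ (p - 1) := by
  have hp2 := (Fact.out : p.Prime).two_le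
  set P : Polynomial (MvPolynomial (Fin 4) F) := (Polynomial.C (X 0) * Polynomial.X + Polynomial.C (X 1)) ^ (p - 1)
  have h := psum (p := p) (F := F) P (by
    refine lt_of_le_of_lt (Polynomial.natDegree_pow_le.trans (Nat.mul_le_mul_left _ Polynomial.natDegree_linear_le)) ?_
    omega)
  have h1 : trP p F (X 1 ^ (p - 1)) = ∑ s : ZMod p, P.eval (algebraMap F _ (cF p F s)) := by
    unfold trP
    apply Finset.sum_congr rfl
    intro s _
    rw [map_pow, act_def, ptAct_u, aeval_X]
    simp [P, -algHom_C]
    ring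
  have h2 : P.coeff (p - 1) = X 0 ^ (p - 1) := by
    have := Polynomial.coeff_pow_of_natDegree_le (m := p - 1) (Polynomial.natDegree_linear_le (a := (X 0 : MvPolynomial (Fin 4) F)) (b := X 1))
    rw [mul_one] at this
    rw [this]; simp
  have h3 : P.coeff (2 * (p - 1)) = 0 := by
    apply Polynomial.coeff_eq_zero_of_natDegree_lt
    refine lt_of_le_of_lt (Polynomial.natDegree_pow_le.trans (Nat.mul_le_mul_left _ Polynomial.natDegree_linear_le)) ?_
    omega
  rw [h1, h, h2, h3, add_zero]

lemma K_eq : Kpoly p F = trBG p F (- X 0 ^ (p - 1)) := by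
  unfold Kpoly
  rw [trG_eq_of_rho, trP_X1, neg_neg]
  intro w hw
  rw [map_pow, act_rho_X1 w hw, mul_pow, ← map_pow, cF_pow_sub _ (inv_ne_zero hw), map_one, one_mul]

lemma ev_K (hp : 3 < p) : ev F (Kpoly p F) = Polynomial.X ^ (p - 1) + 1 := by
  rw [K_eq, trBG]
  simp only [map_add, map_sum, map_neg, map_pow]
  have h1 : ∀ s : ZMod p, ev F (act p F !![1, 0; s, 1] (X 0)) = 
      Polynomial.C (cF p F s) * (3 * (Polynomial.X + Polynomial.C (cF p F s))) := by
    intro s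
    rw [ev, aeval_act, ptAct_low, aeval_X]
    simp
    ring
  have h2 : ev F (act p F !![0, 1; -1, 0] (X 0)) = 0 := by
    rw [ev, aeval_act, ptAct_eta, aeval_X]
    simp
  simp_rw [h1]
  rw [h2, zero_pow (by omega), neg_zero, add_zero, Finset.sum_neg_distrib]
  set P : Polynomial (Polynomial F) := (Polynomial.X + Polynomial.C Polynomial.X) ^ (p - 1) * Polynomial.X ^ (p - 1)
  have hd : P.natDegree ≤ (p - 1) + (p - 1) := by
    refine Polynomial.natDegree_mul_le.trans (add_le_add ?_ (Polynomial.natDegree_X_pow_le _))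
    refine Polynomial.natDegree_pow_le.trans ?_
    rw [Polynomial.natDegree_X_add_C, mul_one]
  have h := psum (p := p) (F := F) P (by omega)
  have h3 : ∀ s : ZMod p, (Polynomial.C (cF p F s) * (3 * (Polynomial.X + Polynomial.C (cF p F s)))) ^ (p - 1) =
     P.eval (algebraMap F _ (cF p F s)) := by
    intro s
    have h4 : (3 : Polynomial F) ^ (p - 1) = 1 := by
      rw [← map_ofNat Polynomial.C 3, ← map_pow, three_pow hp, map_one]
    rw [mul_pow, mul_pow, h4]
    simp [P]
    ring
  simp_rw [h3]
  rw [h, neg_neg]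
  congr 1
  · have := Polynomial.coeff_mul_X_pow ((Polynomial.X + Polynomial.C Polynomial.X : Polynomial (Polynomial F)) ^ (p - 1)) (p - 1) 0
    rw [zero_add] at this
    rw [this, Polynomial.coeff_zero_eq_eval_zero]; simp
  · rw [two_mul, Polynomial.coeff_mul_X_pow]
    have h := (Polynomial.monic_X_add_C (Polynomial.X : Polynomial F)).pow (p - 1)
    have h2 : ((Polynomial.X + Polynomial.C (Polynomial.X : Polynomial F)) ^ (p - 1)).natDegree = (p - 1) := by
      rw [(Polynomial.monic_X_add_C _).natDegree_pow, Polynomial.natDegree_X_add_C, mul_one]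
    have h3 := h.coeff_natDegree
    rwa [h2] at h3

lemma deg_lt_of_hom {f : MvPolynomial (Fin 4) F} {d : ℕ} (hf : f.IsHomogeneous d) (hd : d < p) : degreeOf 3 f < p :=
  lt_of_le_of_lt ((degreeOf_le_totalDegree _ _).trans hf.totalDegree_le) hd

lemma K_hom : (Kpoly p F).IsHomogeneous (p - 1) := by
  have := (trG_hom (p := p) ((isHomogeneous_X F (1 : Fin 4)).pow (p - 1))).neg
  rwa [one_mul] at this

lemma K_mem : Kpoly p F ∈ invariants p F := Subalgebra.neg_mem _ (trG_mem _)

lemma inv_u {f : MvPolynomial (Fin 4) F} (hf : f ∈ invariants p F) (s : ZMod p) : act p F !![1, s; 0, 1] f = f :=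
  hf ⟨!![1, s; 0, 1], by simp [Matrix.det_fin_two]⟩

lemma inv_rho {f : MvPolynomial (Fin 4) F} (hf : f ∈ invariants p F) (w : ZMod p) (hw : w ≠ 0) :
    act p F !![w, 0; 0, w⁻¹] f = f :=
  hf ⟨!![w, 0; 0, w⁻¹], by simp [Matrix.det_fin_two, hw]⟩

lemma inv_eta {f : MvPolynomial (Fin 4) F} (hf : f ∈ invariants p F) : act p F !![0, 1; -1, 0] f = f :=
  hf ⟨!![0, 1; -1, 0], by simp [Matrix.det_fin_two]⟩

/-- equality mod `X 0` from equality of `ev` -/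
lemma TF.eq_of_ev (hp : 3 < p) {d : ℕ} {r g : MvPolynomial (Fin 4) F} (hr : TF p F d r) (hg : TF p F d g)
    (h : ev F r = ev F g) : X 0 ∣ r - g := by
  apply inj_TF hp (d := d)
  · exact ⟨hr.hom.sub hg.hom, lt_of_le_of_lt (degreeOf_sub_le _ _ _) (max_lt hr.deg hg.deg),
      mem_PI.mp (Subalgebra.sub_mem _ (mem_PI.mpr hr.inv) (mem_PI.mpr hg.inv))⟩
  · rw [map_sub, h, sub_self]

lemma X1xi_PI (c : F) (i k : ℕ) : C c * (X 1 ^ i * xipoly F ^ k) ∈ PI p F :=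
  Subalgebra.mul_mem _ (Subalgebra.algebraMap_mem _ c)
    (Subalgebra.mul_mem _ (Subalgebra.pow_mem _ X1_PI _) (Subalgebra.pow_mem _ xi_PI _))

lemma X1xi_hom (c : F) (i k : ℕ) : (C c * (X 1 ^ i * xipoly F ^ k)).IsHomogeneous (i + 2 * k) := by
  have := (((isHomogeneous_X F (1 : Fin 4)).pow i).mul (xi_hom.pow k)).C_mul c
  rwa [one_mul] at this

lemma ev_C (c : F) : ev F (C c) = Polynomial.C c := (ev F).commutes c

lemma ev_X1xi (c : F) (i k : ℕ) : ev F (C c * (X 1 ^ i * xipoly F ^ k)) = Polynomial.C (c * 3 ^ k) * Polynomial.X ^ i := by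
  rw [map_mul, map_mul, map_pow, map_pow, ev_X1, ev_xi, ev_C, map_mul, map_pow]; ring

lemma K_mod (hp : 3 < p) (m : ℕ) (hm : 2 * m = p - 1) :
    X 0 ∣ Kpoly p F - (X 1 ^ (p - 1) + C ((3 ^ m)⁻¹) * xipoly F ^ m) := by
  have h1 : TF p F (p - 1) (Kpoly p F) := ⟨K_hom, deg_lt_of_hom K_hom (by omega), fun s => by
    rw [inv_u K_mem, sub_self]; exact dvd_zero _⟩
  have hh : (X 1 ^ (p - 1) + C ((3 ^ m)⁻¹) * xipoly F ^ m : MvPolynomial (Fin 4) F) =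
      C 1 * (X 1 ^ (p - 1) * xipoly F ^ 0) + C ((3 ^ m)⁻¹) * (X 1 ^ 0 * xipoly F ^ m) := by simp
  rw [hh]
  have hhom : (C 1 * (X 1 ^ (p - 1) * xipoly F ^ 0) + C ((3 ^ m)⁻¹) * (X 1 ^ 0 * xipoly F ^ m)).IsHomogeneous (p - 1) := by
    have h2 := X1xi_hom (F := F) 1 (p - 1) 0
    have h3 := X1xi_hom (F := F) ((3 ^ m)⁻¹) 0 m
    rw [mul_zero, add_zero] at h2
    rw [zero_add, hm] at h3
    exact h2.add h3
  refine h1.eq_of_ev hp ⟨hhom, deg_lt_of_hom hhom (by omega),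
    mem_PI.mp (Subalgebra.add_mem _ (X1xi_PI _ _ _) (X1xi_PI _ _ _))⟩ ?_
  rw [ev_K hp, map_add, ev_X1xi, ev_X1xi, inv_mul_cancel₀ (pow_ne_zero _ (three_ne hp))]
  simp

end S9

section S10
variable {p : ℕ} [Fact p.Prime] {F : Type} [Field F] [CharP F p]

/-- the properties of the algebra of generators that are used -/
structure GA (p : ℕ) [Fact p.Prime] (F : Type) [Field F] [CharP F p]
    (A : Subalgebra F (MvPolynomial (Fin 4) F)) : Prop where
  D : Dpoly F ∈ A
  K : Kpoly p F ∈ A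
  L : Lpoly p F ∈ A
  NX : Npoly p F * X 0 ∈ A
  de : trBG p F (Npoly p F ^ ((p - 1) / 3)) ∈ A
  ee : trBG p F (Npoly p F * epoly F) ∈ A
  f1 : ∀ j, 1 ≤ j → j ≤ (p - 4) / 3 → trG p F (Npoly p F ^ j * (X 2 ^ (p - 1 - 3 * j) * X 3 ^ (p - 1))) ∈ A
  f2 : ∀ j, 1 ≤ j → j ≤ (p - 4) / 3 → trG p F (Npoly p F ^ j * X 3 ^ (p - 1 - j)) ∈ A
  f3 : ∀ j, 2 ≤ j → j ≤ (p - 4) / 3 → trG p F (Npoly p F ^ j * (X 3 ^ (p - 2) * X 2 ^ (p + 2 - 3 * j))) ∈ A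
  le : A ≤ invariants p F

/-- elements congruent modulo `X 0` to elements of `A` -/
def Bb (A : Subalgebra F (MvPolynomial (Fin 4) F)) : Subalgebra F (MvPolynomial (Fin 4) F) :=
  (A.map (kill0 F)).comap (kill0 F)

lemma mem_Bb {A : Subalgebra F (MvPolynomial (Fin 4) F)} {f : MvPolynomial (Fin 4) F} :
    f ∈ Bb A ↔ ∃ a ∈ A, X 0 ∣ f - a := by
  unfold Bb
  rw [Subalgebra.mem_comap, Subalgebra.mem_map]
  constructor
  · rintro ⟨a, ha, h⟩
    refine ⟨a, ha, ?_⟩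
    rw [X0_dvd_iff, map_sub, h, sub_self]
  · rintro ⟨a, ha, h⟩
    refine ⟨a, ha, ?_⟩
    rw [X0_dvd_iff, map_sub, sub_eq_zero] at h
    exact h.symm

lemma Bb_of_dvd {A : Subalgebra F (MvPolynomial (Fin 4) F)} {f : MvPolynomial (Fin 4) F} (h : X 0 ∣ f) :
    f ∈ Bb A := mem_Bb.mpr ⟨0, zero_mem _, by rwa [sub_zero]⟩

lemma Bb_of_mem {A : Subalgebra F (MvPolynomial (Fin 4) F)} {f : MvPolynomial (Fin 4) F} (h : f ∈ A) :
    f ∈ Bb A := mem_Bb.mpr ⟨f, h, by rw [sub_self]; exact dvd_zero _⟩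

lemma Bb_congr {A : Subalgebra F (MvPolynomial (Fin 4) F)} {f g : MvPolynomial (Fin 4) F} (h : X 0 ∣ f - g)
    (hg : g ∈ Bb A) : f ∈ Bb A := by
  have := add_mem (Bb_of_dvd (A := A) h) hg
  rwa [sub_add_cancel] at this

lemma Bb_C_mul {A : Subalgebra F (MvPolynomial (Fin 4) F)} {f : MvPolynomial (Fin 4) F} {c : F} (hc : c ≠ 0)
    (h : C c * f ∈ Bb A) : f ∈ Bb A := by
  have := mul_mem (Subalgebra.algebraMap_mem (Bb A) c⁻¹) h
  rwa [algebraMap_eq, ← mul_assoc, ← map_mul, inv_mul_cancel₀ hc, map_one, one_mul] at this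

/-- projection onto torus invariants -/
def eproj (p : ℕ) [Fact p.Prime] (F : Type) [Field F] [CharP F p] :
    MvPolynomial (Fin 4) F →ₗ[F] MvPolynomial (Fin 4) F :=
  - ∑ w : (ZMod p)ˣ, (act p F !![(w : ZMod p), 0; 0, (w : ZMod p)⁻¹]).toLinearMap

lemma eproj_apply (f : MvPolynomial (Fin 4) F) :
    eproj p F f = - ∑ w : (ZMod p)ˣ, act p F !![(w : ZMod p), 0; 0, (w : ZMod p)⁻¹] f := by
  unfold eproj
  rw [LinearMap.neg_apply, LinearMap.sum_apply]
  rfl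

lemma eproj_eig (E : ℕ) (f : MvPolynomial (Fin 4) F)
    (h : ∀ w : ZMod p, w ≠ 0 → act p F !![w, 0; 0, w⁻¹] f = C (cF p F w ^ E) * f) :
    eproj p F f = if p - 1 ∣ E then f else 0 := by
  rw [eproj_apply]
  have : ∀ w : (ZMod p)ˣ, act p F !![(w : ZMod p), 0; 0, (w : ZMod p)⁻¹] f = C (cF p F w ^ E) * f :=
    fun w => h w w.ne_zero
  simp_rw [this]
  rw [← Finset.sum_mul, ← map_sum, sum_units_pow]
  split_ifs <;> simp

lemma eproj_of_fixed (f : MvPolynomial (Fin 4) F) (h : ∀ w : ZMod p, w ≠ 0 → act p F !![w, 0; 0, w⁻¹] f = f) :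
    eproj p F f = f := by
  rw [eproj_eig 0 f (fun w hw => by rw [h w hw]; simp), if_pos (dvd_zero _)]

lemma eproj_dvd (f : MvPolynomial (Fin 4) F) (h : X 0 ∣ f) : X 0 ∣ eproj p F f := by
  rw [eproj_apply, dvd_neg]
  apply Finset.dvd_sum
  intro w _
  obtain ⟨g, rfl⟩ := h
  rw [map_mul]
  apply Dvd.dvd.mul_right
  rw [act_X0]
  have h1 : (!![(w : ZMod p), 0; 0, (w : ZMod p)⁻¹] : Matrix (Fin 2) (Fin 2) (ZMod p)) 1 0 = 0 := rfl
  rw [h1, map_zero, map_zero]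
  exact ⟨C (cF p F ((!![(w : ZMod p), 0; 0, (w : ZMod p)⁻¹] : Matrix (Fin 2) (Fin 2) (ZMod p)) 1 1)) ^ 3, by ring⟩

/-- those elements whose torus projection lies in `Bb A` -/
def WW (p : ℕ) [Fact p.Prime] {F : Type} [Field F] [CharP F p] (A : Subalgebra F (MvPolynomial (Fin 4) F)) :
    Submodule F (MvPolynomial (Fin 4) F) :=
  (Subalgebra.toSubmodule (Bb A)).comap (eproj p F)

lemma mem_WW {A : Subalgebra F (MvPolynomial (Fin 4) F)} {f : MvPolynomial (Fin 4) F} :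
    f ∈ WW p A ↔ eproj p F f ∈ Bb A := Iff.rfl

lemma WW_dvd {A : Subalgebra F (MvPolynomial (Fin 4) F)} (f : MvPolynomial (Fin 4) F) (h : X 0 ∣ f) : f ∈ WW p A :=
  mem_WW.mpr (Bb_of_dvd (eproj_dvd f h))

lemma WW_congr {A : Subalgebra F (MvPolynomial (Fin 4) F)} {f g : MvPolynomial (Fin 4) F} (h : X 0 ∣ f - g)
    (hg : g ∈ WW p A) : f ∈ WW p A := by
  have := add_mem (WW_dvd (p := p) (A := A) _ h) hg
  rwa [sub_add_cancel] at this

lemma GA.WW {A : Subalgebra F (MvPolynomial (Fin 4) F)} (hA : GA p F A) {f : MvPolynomial (Fin 4) F} (h : f ∈ A) :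
    f ∈ WW p A := by
  rw [mem_WW, eproj_of_fixed _ (inv_rho (hA.le h))]
  exact Bb_of_mem h

/-- the standard monomials -/
def mo (p : ℕ) [Fact p.Prime] (F : Type) [Field F] [CharP F p] (j i k b : ℕ) : MvPolynomial (Fin 4) F :=
  Npoly p F ^ j * (X 1 ^ i * (xipoly F ^ k * Mpoly p F ^ b))

lemma act_rho_xi (w : ZMod p) (hw : w ≠ 0) : act p F !![w, 0; 0, w⁻¹] (xipoly F) = C (cF p F w ^ 2) * xipoly F := by
  have h : C (σ := Fin 4) (cF p F w) * C (cF p F w⁻¹) = 1 := by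
    rw [← map_mul, cF_cancel w hw, map_one]
  unfold xipoly
  simp only [map_sub, map_mul, map_pow, map_ofNat]
  rw [act_rho_X1 w hw, act_rho_X2 w hw, act_rho_X3 w]
  linear_combination (-4 * C (cF p F w) ^ 2 * X 3 * X 1) * h

lemma act_rho_M (w : ZMod p) (hw : w ≠ 0) : act p F !![w, 0; 0, w⁻¹] (Mpoly p F) = C (cF p F w) * Mpoly p F := by
  unfold Mpoly
  simp only [map_sub, map_mul, map_pow]
  rw [act_rho_X1 w hw, act_rho_X2 w hw, mul_pow, mul_pow, ← map_pow C, ← map_pow C, cF_pow,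
    cF_pow_sub _ (inv_ne_zero hw), map_one]
  ring

lemma cF_inv_eq (w : ZMod p) (hw : w ≠ 0) : cF p F w⁻¹ = cF p F w ^ (p - 2) := by
  have hp2 := (Fact.out : p.Prime).two_le
  have h1 := cF_cancel (F := F) w hw
  have h2 := cF_pow_sub (F := F) w hw
  have h3 : cF p F w * cF p F w ^ (p - 2) = 1 := by
    rw [← pow_succ', ← h2]; congr 1; omega
  calc cF p F w⁻¹ = cF p F w⁻¹ * (cF p F w * cF p F w ^ (p - 2)) := by rw [h3, mul_one]
    _ = _ := by rw [← mul_assoc, mul_comm (cF p F w⁻¹), h1, one_mul]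

lemma act_rho_mo (j i k b : ℕ) (w : ZMod p) (hw : w ≠ 0) : act p F !![w, 0; 0, w⁻¹] (mo p F j i k b) =
    C (cF p F w ^ (3 * j + 2 * k + b + (p - 2) * i)) * mo p F j i k b := by
  unfold mo
  simp only [map_mul, map_pow]
  rw [act_rho_N w hw, act_rho_X1 w hw, act_rho_xi w hw, act_rho_M w hw, cF_inv_eq w hw]
  simp only [map_pow]
  rw [pow_add, pow_add, pow_add, pow_mul, pow_mul, pow_mul]
  ring

lemma okw_iff (q j i k b : ℕ) (hpq : p = 6 * q + 1) :
    okw q j i k b ↔ p - 1 ∣ 3 * j + 2 * k + b + (p - 2) * i := by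
  have hp2 := (Fact.out : p.Prime).two_le
  rw [← Int.natCast_dvd_natCast]
  have e1 : ((p - 1 : ℕ) : ℤ) = 6 * q := by omega
  have e2 : ((p - 2 : ℕ) : ℤ) = 6 * q - 1 := by omega
  push_cast
  rw [e1, e2]
  constructor
  · rintro ⟨c, hc⟩
    exact ⟨c + i, by linear_combination hc⟩
  · rintro ⟨c, hc⟩
    exact ⟨c - i, by linear_combination hc⟩

lemma mo_WW {A : Subalgebra F (MvPolynomial (Fin 4) F)} {q j i k b : ℕ} (hpq : p = 6 * q + 1)
    (h : okw q j i k b → mo p F j i k b ∈ Bb A) : mo p F j i k b ∈ WW p A := by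
  rw [mem_WW, eproj_eig _ _ (act_rho_mo j i k b)]
  rw [okw_iff q j i k b hpq] at h
  split_ifs with h1
  · exact h h1
  · exact zero_mem _

lemma mo_Bb {A : Subalgebra F (MvPolynomial (Fin 4) F)} {q j i k b : ℕ} (hpq : p = 6 * q + 1)
    (h1 : okw q j i k b) (h : mo p F j i k b ∈ WW p A) : mo p F j i k b ∈ Bb A := by
  rw [mem_WW, eproj_eig _ _ (act_rho_mo j i k b), if_pos ((okw_iff q j i k b hpq).mp h1)] at h
  exact h

lemma trP_N_mul (j : ℕ) (f : MvPolynomial (Fin 4) F) : trP p F (Npoly p F ^ j * f) = Npoly p F ^ j * trP p F f := by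
  unfold trP
  simp only [map_mul, map_pow, act_u_N]
  rw [Finset.mul_sum]

lemma trBG_Npow_mul (j : ℕ) (hj : 1 ≤ j) (f : MvPolynomial (Fin 4) F) :
    X 0 ∣ trBG p F (Npoly p F ^ j * f) - Npoly p F ^ j * f := by
  obtain ⟨j, rfl⟩ : ∃ j', j = j' + 1 := ⟨j - 1, by omega⟩
  rw [pow_succ', mul_assoc]
  exact trBG_N_mul _

lemma fam_WW {A : Subalgebra F (MvPolynomial (Fin 4) F)} (hA : GA p F A) (j : ℕ) (hj : 1 ≤ j)
    (h : MvPolynomial (Fin 4) F) (hm : trG p F (Npoly p F ^ j * h) ∈ A)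
    (hr : ∀ w : ZMod p, w ≠ 0 → act p F !![w, 0; 0, w⁻¹] (Npoly p F ^ j * h) = Npoly p F ^ j * h) :
    Npoly p F ^ j * trP p F h ∈ WW p A := by
  rw [trG_eq_of_rho hr, trP_N_mul] at hm
  have h1 := neg_mem hm
  rw [neg_neg] at h1
  have h2 := trBG_Npow_mul (p := p) j hj (trP p F h)
  rw [← neg_sub, dvd_neg] at h2
  exact WW_congr h2 (hA.WW h1)

end S10

section S11
variable {p : ℕ} [Fact p.Prime] {F : Type} [Field F] [CharP F p]

lemma degN_sub : degreeOf 3 (Npoly p F - X 3 ^ p) < p := by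
  obtain ⟨hm, hd⟩ := Psi_N_monic (p := p) (F := F)
  have hpos := (Fact.out : p.Prime).pos
  have h3 : Psi F (X 3) = Polynomial.X := by
    have : Psi F (X 3) = finSuccEquiv F 3 (rename (Equiv.swap (0 : Fin 4) 3) (X 3)) := rfl
    rw [this, rename_X, Equiv.swap_apply_right, finSuccEquiv_X_zero]
  rw [← natDegree_Psi, map_sub, map_pow, h3]
  by_cases h0 : Psi F (Npoly p F) - Polynomial.X ^ p = 0
  · rw [h0, Polynomial.natDegree_zero]; exact hpos
  · have h1 := Polynomial.degree_sub_lt_left (p := Psi F (Npoly p F)) (q := Polynomial.X ^ p) (by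
      rw [Polynomial.degree_eq_natDegree hm.ne_zero, hd, Polynomial.degree_X_pow]) hm.ne_zero (by
      rw [hm.leadingCoeff, Polynomial.leadingCoeff_X_pow])
    have h2 := Polynomial.natDegree_lt_natDegree h0 h1
    rwa [hd] at h2

lemma ev_N : ev F (Npoly p F) = 0 := by
  unfold Npoly
  rw [map_prod]
  apply Finset.prod_eq_zero (Finset.mem_univ 0)
  rw [one_eq, act_one]
  simp [ev]

lemma PI_of_inv {f : MvPolynomial (Fin 4) F} (h : ∀ s : ZMod p, act p F !![1, s; 0, 1] f = f) : f ∈ PI p F :=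
  mem_PI.mpr (fun s => by rw [h, sub_self]; exact dvd_zero _)


/-- the basic relation -/
lemma relation (hp : 3 < p) (m : ℕ) (hm : 2 * m + 1 = p) :
    X 0 ∣ 3 * Mpoly p F ^ 2 - (4 * (X 1 ^ p * Npoly p F) + xipoly F ^ p
      - C (2 * (3 ^ m)⁻¹) * (X 1 ^ (p - 1) * xipoly F ^ (m + 1)) + X 1 ^ (2 * (p - 1)) * xipoly F) := by
  have h3 := three_pow (F := F) hp
  have h3p : (3 : MvPolynomial (Fin 4) F) ^ p = 3 := by
    have : (3 : F) ^ p = 3 := by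
      conv_lhs => rw [show p = (p - 1) + 1 by omega, pow_succ, h3, one_mul]
    rw [← C_three, ← map_pow, this]
  have h4p : (4 : MvPolynomial (Fin 4) F) ^ p = 4 := by
    have : ((4 : ZMod p)) ^ p = 4 := ZMod.pow_card _
    have := congrArg (cF p F) this
    rw [map_pow, map_ofNat] at this
    rw [← C_four, ← map_pow, this]
  have hxi : xipoly F ^ p = 3 * (X 2 ^ 2) ^ p - 4 * X 3 ^ p * X 1 ^ p := by
    unfold xipoly
    rw [sub_pow_char, mul_pow, mul_pow, mul_pow, h3p, h4p]
  apply inj_TF hp (d := 2 * p)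
  · refine ⟨?_, ?_, ?_⟩
    · have a1 := (Mpoly_hom (p := p) (F := F)).pow 2 |>.C_mul 3
      have a2 := (((isHomogeneous_X F (1 : Fin 4)).pow p).mul (N_hom (p := p) (F := F))).C_mul 4
      have a3 := (xi_hom (F := F)).pow p
      have a4 := X1xi_hom (F := F) (2 * (3 ^ m)⁻¹) (p - 1) (m + 1)
      have a5 := ((isHomogeneous_X F (1 : Fin 4)).pow (2 * (p - 1))).mul (xi_hom (F := F))
      rw [C_three, show p * 2 = 2 * p by ring] at a1
      rw [C_four, show 1 * p + p = 2 * p by ring] at a2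
      rw [show p - 1 + 2 * (m + 1) = 2 * p by omega] at a4
      rw [show 1 * (2 * (p - 1)) + 2 = 2 * p by omega] at a5
      exact a1.sub (((a2.add a3).sub a4).add a5)
    · have e : 3 * Mpoly p F ^ 2 - (4 * (X 1 ^ p * Npoly p F) + xipoly F ^ p
          - C (2 * (3 ^ m)⁻¹) * (X 1 ^ (p - 1) * xipoly F ^ (m + 1)) + X 1 ^ (2 * (p - 1)) * xipoly F) =
        C 3 * Mpoly p F ^ 2 - C 4 * (X 1 ^ p * (Npoly p F - X 3 ^ p)) - C 3 * X 2 ^ (2 * p) +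
         C (2 * (3 ^ m)⁻¹) * (X 1 ^ (p - 1) * xipoly F ^ (m + 1)) - X 1 ^ (2 * (p - 1)) * xipoly F := by
        rw [hxi, C_three, C_four, pow_mul]; ring
      rw [e]
      have dpow : ∀ (i : Fin 4) (n : ℕ), i ≠ 3 → degreeOf 3 (X i ^ n : MvPolynomial (Fin 4) F) = 0 := fun i n hi => by
        have := degreeOf_pow_le (3 : Fin 4) (X i : MvPolynomial (Fin 4) F) n
        rw [degX i hi, mul_zero] at this
        omega
      have b1 : degreeOf 3 (C 3 * Mpoly p F ^ 2 : MvPolynomial (Fin 4) F) < p := by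
        refine lt_of_le_of_lt ((degreeOf_C_mul_le _ _ _).trans (degreeOf_pow_le _ _ _)) ?_
        rw [degM]; omega
      have b2 : degreeOf 3 (C 4 * (X 1 ^ p * (Npoly p F - X 3 ^ p)) : MvPolynomial (Fin 4) F) < p := by
        refine lt_of_le_of_lt ((degreeOf_C_mul_le _ _ _).trans (degreeOf_mul_le _ _ _)) ?_
        rw [dpow 1 _ (by decide), zero_add]; exact degN_sub
      have b3 : degreeOf 3 (C 3 * X 2 ^ (2 * p) : MvPolynomial (Fin 4) F) < p := by
        refine lt_of_le_of_lt (degreeOf_C_mul_le _ _ _) ?_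
        rw [dpow 2 _ (by decide)]; omega
      have b4 : degreeOf 3 (C (2 * (3 ^ m)⁻¹) * (X 1 ^ (p - 1) * xipoly F ^ (m + 1)) : MvPolynomial (Fin 4) F) < p := by
        refine lt_of_le_of_lt ((degreeOf_C_mul_le _ _ _).trans (degreeOf_mul_le _ _ _)) ?_
        rw [dpow 1 _ (by decide), zero_add]
        have := degreeOf_pow_le (3 : Fin 4) (xipoly F) (m + 1)
        have := Nat.mul_le_mul_left (m + 1) (degxi (F := F))
        omega
      have b5 : degreeOf 3 (X 1 ^ (2 * (p - 1)) * xipoly F : MvPolynomial (Fin 4) F) < p := by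
        refine lt_of_le_of_lt (degreeOf_mul_le _ _ _) ?_
        rw [dpow 1 _ (by decide), zero_add]
        have := (degxi (F := F))
        omega
      have S : ∀ a b : MvPolynomial (Fin 4) F, degreeOf 3 a < p → degreeOf 3 b < p → degreeOf 3 (a - b) < p :=
        fun a b ha hb => lt_of_le_of_lt (degreeOf_sub_le _ _ _) (max_lt ha hb)
      have S' : ∀ a b : MvPolynomial (Fin 4) F, degreeOf 3 a < p → degreeOf 3 b < p → degreeOf 3 (a + b) < p :=
        fun a b ha hb => lt_of_le_of_lt (degreeOf_add_le _ _ _) (max_lt ha hb)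
      exact S _ _ (S' _ _ (S _ _ (S _ _ b1 b2) b3) b4) b5
    · rw [← mem_PI]
      have c3 : (3 : MvPolynomial (Fin 4) F) ∈ PI p F := by rw [← C_three]; exact Subalgebra.algebraMap_mem _ _
      have c4 : (4 : MvPolynomial (Fin 4) F) ∈ PI p F := by rw [← C_four]; exact Subalgebra.algebraMap_mem _ _
      refine sub_mem (mul_mem c3 (pow_mem M_PI _)) (add_mem (sub_mem (add_mem (mul_mem c4 (mul_mem (pow_mem X1_PI _)
        (PI_of_inv act_u_N))) (pow_mem xi_PI _)) (X1xi_PI _ _ _)) (mul_mem (pow_mem X1_PI _) xi_PI))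
  · have hne : (3 : F) ^ m ≠ 0 := pow_ne_zero _ (three_ne hp)
    have e3 : (3 : F) ^ p = 3 := by
      conv_lhs => rw [show p = (p - 1) + 1 by omega, pow_succ, h3, one_mul]
    have e4 : 2 * (3 ^ m)⁻¹ * 3 ^ (m + 1) = (6 : F) := by
      rw [pow_succ]; field_simp; norm_num
    have e6 : (Polynomial.C 6 : Polynomial F) = 6 := map_ofNat _ 6
    have e7 : (Polynomial.C 3 : Polynomial F) = 3 := map_ofNat _ 3
    simp only [map_sub, map_add, ev_X1xi, e4]
    simp only [map_mul, map_pow, ev_M, ev_N, ev_xi, ev_X1, map_ofNat, ← map_pow Polynomial.C, e3, e6, e7]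
    have e8 : (3 : Polynomial F) ^ p = 3 := by rw [← e7, ← map_pow, e3]
    rw [e8]
    ring

end S11

section S12
variable {p : ℕ} [Fact p.Prime] {F : Type} [Field F] [CharP F p]
variable {A : Subalgebra F (MvPolynomial (Fin 4) F)}

lemma GA.D' (hA : GA p F A) : X 1 ^ 2 * xipoly F ∈ Bb A := by
  refine Bb_congr ?_ (Bb_of_mem hA.D)
  refine ⟨4 * X 2 ^ 3 - 6 * X 3 * X 2 * X 1 + X 3 ^ 2 * X 0, ?_⟩
  unfold xipoly Dpoly
  ring

lemma GA.L' (hp : 3 < p) (hA : GA p F A) : X 1 * Mpoly p F ∈ Bb A := by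
  apply Bb_C_mul (three_ne hp)
  refine Bb_congr ?_ (Bb_of_mem hA.L)
  rw [C_three]
  unfold Mpoly Lpoly
  obtain ⟨n, rfl⟩ : ∃ n, p = n + 1 := ⟨p - 1, by omega⟩
  rw [Nat.add_sub_cancel]
  exact ⟨X 3 ^ (n + 1) - X 3 * X 0 ^ n, by ring⟩

lemma GA.K' (hp : 3 < p) (hA : GA p F A) (m : ℕ) (hm : 2 * m = p - 1) :
    X 1 ^ (p - 1) + C ((3 ^ m)⁻¹) * xipoly F ^ m ∈ Bb A := by
  refine Bb_congr ?_ (Bb_of_mem hA.K)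
  have := K_mod (F := F) hp m hm
  rwa [← neg_sub, dvd_neg] at this

lemma GA.de' (hp : 3 < p) (hA : GA p F A) : Npoly p F ^ ((p - 1) / 3) ∈ Bb A := by
  refine Bb_congr ?_ (Bb_of_mem hA.de)
  have := trBG_Npow_mul (p := p) (F := F) ((p - 1) / 3) (by omega) 1
  rw [mul_one] at this
  rwa [← neg_sub, dvd_neg] at this

lemma GA.ee' (hp : 3 < p) (hA : GA p F A) : Npoly p F * X 1 ^ 3 ∈ Bb A := by
  apply Bb_C_mul (two_ne hp)
  have h1 : Npoly p F * epoly F ∈ Bb A := by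
    refine Bb_congr ?_ (Bb_of_mem hA.ee)
    have := trBG_N_mul (p := p) (epoly F)
    rwa [← neg_sub, dvd_neg] at this
  refine Bb_congr ?_ h1
  rw [C_two]
  unfold epoly
  exact ⟨- (Npoly p F * (X 3 * X 0 - 3 * X 2 * X 1)), by ring⟩

lemma mo_hD (hA : GA p F A) (j i k b : ℕ) (h : mo p F j i k b ∈ Bb A) : mo p F j (i + 2) (k + 1) b ∈ Bb A := by
  have := mul_mem hA.D' h
  convert this using 1
  unfold mo; ring

lemma mo_hL (hp : 3 < p) (hA : GA p F A) (j i k b : ℕ) (h : mo p F j i k b ∈ Bb A) :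
    mo p F j (i + 1) k (b + 1) ∈ Bb A := by
  have := mul_mem (hA.L' hp) h
  convert this using 1
  unfold mo; ring

lemma mo_hdel (hp : 3 < p) (hA : GA p F A) (q : ℕ) (hpq : p = 6 * q + 1) (j i k b : ℕ) (h : mo p F j i k b ∈ Bb A) :
    mo p F (j + 2 * q) i k b ∈ Bb A := by
  have := mul_mem (hA.de' hp) h
  rw [show (p - 1) / 3 = 2 * q by omega] at this
  convert this using 1
  unfold mo; ring

lemma mo_K (hp : 3 < p) (hA : GA p F A) (q : ℕ) (hpq : p = 6 * q + 1) (j i k b : ℕ) (h : mo p F j i k b ∈ Bb A) :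
    mo p F j (i + 6 * q) k b + C ((3 ^ (3 * q))⁻¹) * mo p F j i (k + 3 * q) b ∈ Bb A := by
  have := mul_mem (hA.K' hp (3 * q) (by omega)) h
  rw [show p - 1 = 6 * q by omega] at this
  convert this using 1
  unfold mo; ring

lemma mo_hK1 (hp : 3 < p) (hA : GA p F A) (q : ℕ) (hpq : p = 6 * q + 1) (j i k b : ℕ) (h : mo p F j i k b ∈ Bb A)
    (h2 : mo p F j (i + 6 * q) k b ∈ Bb A) : mo p F j i (k + 3 * q) b ∈ Bb A := by
  have := sub_mem (mo_K hp hA q hpq j i k b h) h2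
  rw [add_sub_cancel_left] at this
  exact Bb_C_mul (inv_ne_zero (pow_ne_zero _ (three_ne hp))) this

lemma mo_hK2 (hp : 3 < p) (hA : GA p F A) (q : ℕ) (hpq : p = 6 * q + 1) (j i k b : ℕ) (h : mo p F j i k b ∈ Bb A)
    (h2 : mo p F j i (k + 3 * q) b ∈ Bb A) : mo p F j (i + 6 * q) k b ∈ Bb A := by
  have := sub_mem (mo_K hp hA q hpq j i k b h) (mul_mem (Subalgebra.algebraMap_mem (Bb A) ((3 ^ (3 * q))⁻¹)) h2)
  rwa [algebraMap_eq, add_sub_cancel_right] at this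

lemma mo_base0 (hp : 3 < p) (hA : GA p F A) (q : ℕ) (hpq : p = 6 * q + 1) : mo p F (2 * q) 0 0 0 ∈ Bb A := by
  have := hA.de' hp
  rw [show (p - 1) / 3 = 2 * q by omega] at this
  simpa [mo] using this

lemma mo_base1 (hp : 3 < p) (hA : GA p F A) (j : ℕ) : mo p F j (3 * j) 0 0 ∈ Bb A := by
  have := pow_mem (hA.ee' hp) j
  convert this using 1
  unfold mo
  rw [mul_pow, ← pow_mul]; simp

lemma mo_rel (hp : 3 < p) (q : ℕ) (hpq : p = 6 * q + 1) (j k b : ℕ)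
    (h1 : mo p F j 0 (k + p) b ∈ Bb A) (h2 : mo p F j (p - 1) (k + 1 + 3 * q) b ∈ Bb A)
    (h3 : mo p F j (2 * (p - 1)) (k + 1) b ∈ Bb A) (h4 : mo p F (j + 1) p k b ∈ Bb A) :
    mo p F j 0 k (b + 2) ∈ Bb A := by
  apply Bb_C_mul (three_ne hp)
  have hc : ∀ c : F, C c ∈ Bb A := fun c => Subalgebra.algebraMap_mem (Bb A) c
  have hR := relation (F := F) hp (3 * q) (by omega)
  refine Bb_congr ?_ (add_mem (sub_mem (add_mem (mul_mem (hc 4) h4) h1) (mul_mem (hc (2 * (3 ^ (3 * q))⁻¹)) h2)) h3)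
  refine (hR.mul_right (mo p F j 0 k b)).trans (dvd_of_eq ?_)
  unfold mo
  rw [C_three, C_four]
  ring

end S12

section S13
variable {p : ℕ} [Fact p.Prime] {F : Type} [Field F] [CharP F p]
variable {A : Subalgebra F (MvPolynomial (Fin 4) F)}

lemma act_u_trP (t : ZMod p) (f : MvPolynomial (Fin 4) F) : act p F !![1, t; 0, 1] (trP p F f) = trP p F f := by
  unfold trP
  rw [map_sum]
  simp_rw [act_act, u_mul_u]
  exact Equiv.sum_comp (Equiv.addLeft t) (fun s => act p F !![1, s; 0, 1] f)

lemma TF_trP {d : ℕ} {f : MvPolynomial (Fin 4) F} (hf : f.IsHomogeneous d) (h : degreeOf 3 f < p) :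
    TF p F d (trP p F f) := by
  refine ⟨trP_hom hf, ?_, fun s => by rw [act_u_trP, sub_self]; exact dvd_zero _⟩
  unfold trP
  refine lt_of_le_of_lt (degreeOf_sum_le _ _ _) ?_
  rw [Finset.sup_lt_iff (by exact (Fact.out : p.Prime).pos)]
  intro s _
  exact lt_of_le_of_lt (deg_act_u s f) h

lemma act_rho_gen (j a b : ℕ) (w : ZMod p) (hw : w ≠ 0) :
    act p F !![w, 0; 0, w⁻¹] (Npoly p F ^ j * (X 2 ^ a * X 3 ^ b)) =
      C (cF p F w ^ (3 * j + a + 3 * b)) * (Npoly p F ^ j * (X 2 ^ a * X 3 ^ b)) := by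
  simp only [map_mul, map_pow]
  rw [act_rho_N w hw, act_rho_X2 w hw, act_rho_X3 w]
  simp only [map_pow]
  rw [pow_add, pow_add, pow_mul, pow_mul]
  ring

lemma act_rho_fix (j a b c : ℕ) (h : 3 * j + a + 3 * b = (p - 1) * c) (w : ZMod p) (hw : w ≠ 0) :
    act p F !![w, 0; 0, w⁻¹] (Npoly p F ^ j * (X 2 ^ a * X 3 ^ b)) = (Npoly p F ^ j * (X 2 ^ a * X 3 ^ b)) := by
  rw [act_rho_gen j a b w hw, h, pow_mul, cF_pow_sub w hw, one_pow, map_one, one_mul]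

lemma ev_trP (a b : ℕ) : ev F (trP p F (X 2 ^ a * X 3 ^ b)) =
    ∑ s : ZMod p, (1 + 2 * Polynomial.C (cF p F s) * Polynomial.X) ^ a *
      (3 * Polynomial.C (cF p F s) * (1 + Polynomial.C (cF p F s) * Polynomial.X)) ^ b := by
  unfold trP
  rw [map_sum]
  apply Finset.sum_congr rfl
  intro s _
  rw [ev, aeval_act, ptAct_u]
  simp only [map_mul, map_pow, aeval_X]
  simp only [Polynomial.algebraMap_eq]
  simp
  left
  congr 1
  ring

lemma choose_ne (e j : ℕ) (he : e < p) (hj : j ≤ e) : (e.choose j : F) ≠ 0 := by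
  intro h
  rw [CharP.cast_eq_zero_iff F p] at h
  have h1 : p ∣ e.factorial := by
    rw [← Nat.choose_mul_factorial_mul_factorial hj, mul_assoc]
    exact h.mul_right _
  rw [(Fact.out : p.Prime).dvd_factorial] at h1
  omega

lemma ev_fam2 (j e : ℕ) (he : e + j = p - 1) (hj : 1 ≤ j) : ev F (trP p F (X 3 ^ e)) =
    Polynomial.C (- (3 ^ e * (e.choose j : F))) * Polynomial.X ^ j := by
  have h0 := ev_trP (p := p) (F := F) 0 e
  rw [pow_zero, one_mul] at h0
  rw [h0]
  set P : Polynomial (Polynomial F) := 3 ^ e * ((1 + Polynomial.C Polynomial.X * Polynomial.X) ^ e * Polynomial.X ^ e) with hP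
  have hl : (1 + Polynomial.C Polynomial.X * Polynomial.X : Polynomial (Polynomial F)).natDegree ≤ 1 := by
    rw [add_comm]
    exact Polynomial.natDegree_linear_le (a := (Polynomial.X : Polynomial F)) (b := 1)
  have hd : P.natDegree ≤ e + e := by
    have : (3 : Polynomial (Polynomial F)) = Polynomial.C 3 := (map_ofNat _ 3).symm
    rw [hP, this, ← map_pow]
    refine (Polynomial.natDegree_C_mul_le _ _).trans ?_
    refine Polynomial.natDegree_mul_le.trans (add_le_add ?_ (Polynomial.natDegree_X_pow_le _))
    refine Polynomial.natDegree_pow_le.trans ?_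
    have := Nat.mul_le_mul_left e hl
    omega
  have h := psum (p := p) (F := F) P (by omega)
  have h3 : ∀ s : ZMod p, (1 + 2 * Polynomial.C (cF p F s) * Polynomial.X) ^ 0 *
      (3 * Polynomial.C (cF p F s) * (1 + Polynomial.C (cF p F s) * Polynomial.X)) ^ e =
      P.eval (algebraMap F _ (cF p F s)) := by
    intro s
    rw [hP]
    simp
    rw [mul_pow, mul_pow]
    ring
  simp_rw [h3]
  rw [h, Polynomial.coeff_eq_zero_of_natDegree_lt (show P.natDegree < 2 * (p - 1) by omega), add_zero]
  have h4 : P.coeff (p - 1) = Polynomial.C (3 ^ e * (e.choose j : F)) * Polynomial.X ^ j := by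
    have : (3 : Polynomial (Polynomial F)) = Polynomial.C 3 := (map_ofNat _ 3).symm
    rw [hP, this, ← map_pow, Polynomial.coeff_C_mul, ← he, add_comm e j, Polynomial.coeff_mul_X_pow]
    have h5 : ((1 + Polynomial.C Polynomial.X * Polynomial.X : Polynomial (Polynomial F)) ^ e) =
        ((1 + Polynomial.X) ^ e : Polynomial (Polynomial F)).comp (Polynomial.C Polynomial.X * Polynomial.X) := by
      simp
    rw [h5, Polynomial.comp_C_mul_X_coeff, Polynomial.coeff_one_add_X_pow]
    simp
    have : (Polynomial.C (3 : F)) = 3 := map_ofNat _ 3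
    rw [this]
    ring
  rw [h4, map_neg, neg_mul]

lemma mo_fam2 (hp : 3 < p) (hA : GA p F A) (q : ℕ) (hpq : p = 6 * q + 1) (j : ℕ) (hj : 1 ≤ j) (hj2 : j < 2 * q) :
    mo p F j j (3 * q - j) 0 ∈ Bb A := by
  have hm := fam_WW hA j hj (X 3 ^ (p - 1 - j)) (hA.f2 j hj (by omega)) (by
    have := act_rho_fix (p := p) (F := F) j 0 (p - 1 - j) 3 (by omega)
    simpa only [pow_zero, one_mul] using this)
  have hom : (X 3 ^ (p - 1 - j) : MvPolynomial (Fin 4) F).IsHomogeneous (p - 1 - j) := by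
    have := (isHomogeneous_X F (3 : Fin 4)).pow (p - 1 - j)
    rwa [one_mul] at this
  have hT := TF_trP hom (deg_lt_of_hom hom (by omega : p - 1 - j < p))
  have h3 : (3 : F) ^ (3 * q - j) ≠ 0 := pow_ne_zero _ (three_ne hp)
  obtain ⟨c, hc0, hc⟩ : ∃ c : F, c ≠ 0 ∧ c * 3 ^ (3 * q - j) = - (3 ^ (p - 1 - j) * ((p - 1 - j).choose j : F)) := by
    refine ⟨- (3 ^ (p - 1 - j) * ((p - 1 - j).choose j : F)) * (3 ^ (3 * q - j))⁻¹, ?_, ?_⟩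
    · exact mul_ne_zero (neg_ne_zero.mpr (mul_ne_zero (pow_ne_zero _ (three_ne hp)) (choose_ne _ _ (by omega) (by omega))))
        (inv_ne_zero h3)
    · rw [mul_assoc, inv_mul_cancel₀ h3, mul_one]
  have hom2 := X1xi_hom (F := F) c j (3 * q - j)
  rw [show j + 2 * (3 * q - j) = p - 1 - j by omega] at hom2
  have hdv := hT.eq_of_ev hp ⟨hom2, deg_lt_of_hom hom2 (by omega), mem_PI.mp (X1xi_PI _ _ _)⟩ (by
    rw [ev_fam2 j (p - 1 - j) (by omega) hj, ev_X1xi, hc])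
  have h4 : C c * mo p F j j (3 * q - j) 0 ∈ WW p A := by
    refine WW_congr ?_ hm
    rw [← neg_sub, dvd_neg] at hdv
    refine (hdv.mul_left (Npoly p F ^ j)).trans (dvd_of_eq ?_)
    unfold mo
    ring
  rw [C_mul', Submodule.smul_mem_iff _ hc0] at h4
  exact mo_Bb hpq ⟨1, by omega⟩ h4

lemma mo_fam1 (hp : 3 < p) (hA : GA p F A) (q : ℕ) (hpq : p = 6 * q + 1) (j k b : ℕ) (hj : 1 ≤ j) (hj2 : j < 2 * q)
    (hkb : 2 * k + p * b + 3 * j = 2 * (p - 1))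
    (H : ∀ i' k' b', 1 ≤ i' → i' + 2 * k' + p * b' + 3 * j = 2 * (p - 1) → okw q j i' k' b' → mo p F j i' k' b' ∈ Bb A) :
    mo p F j 0 k b ∈ Bb A := by
  have hm := fam_WW hA j hj _ (hA.f1 j hj (by omega)) (act_rho_fix (p := p) (F := F) j (p - 1 - 3 * j) (p - 1) 4 (by omega))
  obtain ⟨d, hd⟩ : ∃ d, d + 1 + 3 * j = 2 * (p - 1) := ⟨2 * (p - 1) - 3 * j - 1, by omega⟩
  have hom : (X 2 ^ (p - 1 - 3 * j) * X 3 ^ (p - 1) : MvPolynomial (Fin 4) F).IsHomogeneous (d + 1) := by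
    have := ((isHomogeneous_X F (2 : Fin 4)).pow (p - 1 - 3 * j)).mul ((isHomogeneous_X F (3 : Fin 4)).pow (p - 1))
    rwa [show 1 * (p - 1 - 3 * j) + 1 * (p - 1) = d + 1 by omega] at this
  have hdeg : degreeOf 3 (X 2 ^ (p - 1 - 3 * j) * X 3 ^ (p - 1) : MvPolynomial (Fin 4) F) < p := by
    have h1 := degreeOf_mul_le (3 : Fin 4) (X 2 ^ (p - 1 - 3 * j) : MvPolynomial (Fin 4) F) (X 3 ^ (p - 1))
    have h2 := degreeOf_pow_le (3 : Fin 4) (X 2 : MvPolynomial (Fin 4) F) (p - 1 - 3 * j)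
    have h3 := degreeOf_pow_le (3 : Fin 4) (X 3 : MvPolynomial (Fin 4) F) (p - 1)
    rw [degX 2 (by decide), mul_zero] at h2
    rw [degreeOf_X, if_pos rfl, mul_one] at h3
    omega
  have hT := TF_trP hom hdeg
  have hc0 : (ev F (trP p F (X 2 ^ (p - 1 - 3 * j) * X 3 ^ (p - 1)))).coeff 0 = -1 := by
    rw [ev_trP, Polynomial.coeff_zero_eq_eval_zero, Polynomial.eval_finset_sum]
    have := powsum (p := p) (F := F) (p - 1)
    rw [if_pos ⟨by omega, dvd_refl _⟩] at this
    rw [← this]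
    apply Finset.sum_congr rfl
    intro s _
    simp [mul_pow, three_pow hp]
  obtain ⟨r', c, k', b', hT', hkb', hc, hdv⟩ := hT.six hp
  rw [hc0] at hc
  have hcne : c ≠ 0 := by
    rintro rfl
    rw [zero_mul] at hc
    exact neg_ne_zero.mpr one_ne_zero hc.symm
  have hkb' := hkb' hcne
  obtain ⟨rfl, rfl⟩ : b' = b ∧ k' = k := by
    have hb : b < 2 := by
      by_contra h
      have := Nat.mul_le_mul_left p (show 2 ≤ b by omega)
      omega
    have hb' : b' < 2 := by
      by_contra h
      have := Nat.mul_le_mul_left p (show 2 ≤ b' by omega)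
      omega
    interval_cases b <;> interval_cases b' <;> omega
  have h2 : Npoly p F ^ j * (X 1 ^ 1 * r') ∈ WW p A := by
    refine TF.span hp (WW p A) WW_dvd _ d r' hT' 1 ?_
    intro i k'' b'' hi _
    exact mo_WW hpq (H _ _ _ (by omega) (by omega))
  have h4 : C c * mo p F j 0 k' b' ∈ WW p A := by
    refine WW_congr ?_ (sub_mem hm h2)
    rw [← neg_sub, dvd_neg] at hdv
    refine (hdv.mul_left (Npoly p F ^ j)).trans (dvd_of_eq ?_)
    unfold mo
    ring
  rw [C_mul', Submodule.smul_mem_iff _ hcne] at h4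
  refine mo_Bb hpq ⟨2 - b', ?_⟩ h4
  subst hpq
  have h5 : (2 * k' + (6 * q + 1) * b' + 3 * j : ℤ) = 2 * (6 * q) := by
    have : 2 * k' + (6 * q + 1) * b' + 3 * j = 2 * (6 * q) := by omega
    exact_mod_cast this
  push_cast
  linear_combination h5

end S13

section S14
variable {p : ℕ} [Fact p.Prime] {F : Type} [Field F] [CharP F p]
variable {A : Subalgebra F (MvPolynomial (Fin 4) F)}

lemma coeff1_fam3 (a b : ℕ) (s : F) :
    ((1 + 2 * Polynomial.C s * Polynomial.X) ^ a *
      (3 * Polynomial.C s * (1 + Polynomial.C s * Polynomial.X)) ^ b : Polynomial F).coeff 1 =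
      3 ^ b * (2 * a + b) * s ^ (b + 1) := by
  have h := Polynomial.coeff_derivative ((1 + 2 * Polynomial.C s * Polynomial.X) ^ a *
      (3 * Polynomial.C s * (1 + Polynomial.C s * Polynomial.X)) ^ b : Polynomial F) 0
  rw [Nat.cast_zero, zero_add, zero_add, mul_one] at h
  rw [← h, Polynomial.coeff_zero_eq_eval_zero, mul_pow]
  have e3 : (3 : Polynomial F) = Polynomial.C 3 := (map_ofNat _ 3).symm
  have e2 : (2 : Polynomial F) = Polynomial.C 2 := (map_ofNat _ 2).symm
  rw [e3, e2]
  simp [Polynomial.derivative_mul, Polynomial.derivative_pow]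
  ring

lemma mo_fam3 (hp : 3 < p) (hA : GA p F A) (q : ℕ) (hpq : p = 6 * q + 1) (j k b : ℕ) (hj : 2 ≤ j) (hj2 : j < 2 * q)
    (hkb : 1 + 2 * k + p * b + 3 * j = 2 * p)
    (H : ∀ i' k' b', 2 ≤ i' → i' + 2 * k' + p * b' + 3 * j = 2 * p → okw q j i' k' b' → mo p F j i' k' b' ∈ Bb A) :
    mo p F j 1 k b ∈ Bb A := by
  have hf3 := hA.f3 j hj (by omega)
  rw [mul_comm (X 3 ^ (p - 2)) (X 2 ^ (p + 2 - 3 * j))] at hf3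
  have hm := fam_WW hA j (by omega) _ hf3 (act_rho_fix (p := p) (F := F) j (p + 2 - 3 * j) (p - 2) 4 (by omega))
  obtain ⟨d, hd⟩ : ∃ d, d + 1 + 1 + 3 * j = 2 * p := ⟨2 * p - 3 * j - 1 - 1, by omega⟩
  have hom : (X 2 ^ (p + 2 - 3 * j) * X 3 ^ (p - 2) : MvPolynomial (Fin 4) F).IsHomogeneous (d + 1 + 1) := by
    have := ((isHomogeneous_X F (2 : Fin 4)).pow (p + 2 - 3 * j)).mul ((isHomogeneous_X F (3 : Fin 4)).pow (p - 2))
    rwa [show 1 * (p + 2 - 3 * j) + 1 * (p - 2) = d + 1 + 1 by omega] at this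
  have hdeg : degreeOf 3 (X 2 ^ (p + 2 - 3 * j) * X 3 ^ (p - 2) : MvPolynomial (Fin 4) F) < p := by
    have h1 := degreeOf_mul_le (3 : Fin 4) (X 2 ^ (p + 2 - 3 * j) : MvPolynomial (Fin 4) F) (X 3 ^ (p - 2))
    have h2 := degreeOf_pow_le (3 : Fin 4) (X 2 : MvPolynomial (Fin 4) F) (p + 2 - 3 * j)
    have h3 := degreeOf_pow_le (3 : Fin 4) (X 3 : MvPolynomial (Fin 4) F) (p - 2)
    rw [degX 2 (by decide), mul_zero] at h2
    rw [degreeOf_X, if_pos rfl, mul_one] at h3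
    omega
  have hT := TF_trP hom hdeg
  have hc0 : (ev F (trP p F (X 2 ^ (p + 2 - 3 * j) * X 3 ^ (p - 2)))).coeff 0 = 0 := by
    rw [ev_trP, Polynomial.coeff_zero_eq_eval_zero, Polynomial.eval_finset_sum]
    have := powsum (p := p) (F := F) (p - 2)
    rw [if_neg (by rintro ⟨h1, h2⟩; have := Nat.le_of_dvd (by omega) h2; omega)] at this
    have h2 := congrArg (fun x => 3 ^ (p - 2) * x) this
    simp only [mul_zero] at h2
    refine Eq.trans ?_ h2
    rw [Finset.mul_sum]
    apply Finset.sum_congr rfl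
    intro s _
    simp [mul_pow]
  have hc1 : (ev F (trP p F (X 2 ^ (p + 2 - 3 * j) * X 3 ^ (p - 2)))).coeff 1 ≠ 0 := by
    rw [ev_trP, Polynomial.finset_sum_coeff]
    simp_rw [coeff1_fam3]
    rw [← Finset.mul_sum, show p - 2 + 1 = p - 1 by omega, powsum, if_pos ⟨by omega, dvd_refl _⟩]
    refine mul_ne_zero (mul_ne_zero (pow_ne_zero _ (three_ne hp)) ?_) (neg_ne_zero.mpr one_ne_zero)
    have e1 : (2 * ((p + 2 - 3 * j : ℕ) : F) + ((p - 2 : ℕ) : F)) = ((3 * p + 2 - 6 * j : ℕ) : F) := by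
      rw [show 3 * p + 2 - 6 * j = 2 * (p + 2 - 3 * j) + (p - 2) by omega]
      push_cast
      rfl
    rw [e1, Ne, CharP.cast_eq_zero_iff F p]
    intro h
    have h2 : p ∣ 3 * p + 2 - 6 * j + (2 * (3 * j - 1)) := by
      rw [show 3 * p + 2 - 6 * j + (2 * (3 * j - 1)) = p * 3 by omega]
      exact dvd_mul_right _ _
    have h3 := (Nat.dvd_add_right h).mp h2
    rcases ((Fact.out : p.Prime).dvd_mul).mp h3 with h4 | h4
    · have := Nat.le_of_dvd (by norm_num) h4; omega
    · have := Nat.le_of_dvd (by omega) h4; omega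
  obtain ⟨r1, c, k1, b1, hT1, _, hc, hdv1⟩ := hT.six hp
  rw [hc0] at hc
  have hc' : c = 0 := (mul_eq_zero.mp hc).resolve_right (pow_ne_zero _ (three_ne hp))
  rw [hc', map_zero, zero_mul, zero_add] at hdv1
  have hev := ev_eq_of_dvd hdv1
  rw [hev, map_mul, ev_X1, mul_comm] at hc1
  have hc1' := Polynomial.coeff_mul_X (ev F r1) 0
  rw [zero_add] at hc1'
  rw [hc1'] at hc1
  obtain ⟨r2, c, k', b', hT', hkb', hc, hdv⟩ := hT1.six hp
  have hcne : c ≠ 0 := by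
    rintro rfl
    rw [zero_mul] at hc
    exact hc1 hc.symm
  have hkb' := hkb' hcne
  obtain ⟨rfl, rfl⟩ : b' = b ∧ k' = k := by
    have hb : b < 2 := by
      by_contra h
      have := Nat.mul_le_mul_left p (show 2 ≤ b by omega)
      omega
    have hb' : b' < 2 := by
      by_contra h
      have := Nat.mul_le_mul_left p (show 2 ≤ b' by omega)
      omega
    interval_cases b <;> interval_cases b' <;> omega
  have h2 : Npoly p F ^ j * (X 1 ^ 2 * r2) ∈ WW p A := by
    refine TF.span hp (WW p A) WW_dvd _ d r2 hT' 2 ?_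
    intro i k'' b'' hi _
    exact mo_WW hpq (H _ _ _ (by omega) (by omega))
  have h4 : C c * mo p F j 1 k' b' ∈ WW p A := by
    refine WW_congr ?_ (sub_mem hm h2)
    rw [← neg_sub, dvd_neg] at hdv hdv1
    refine (dvd_add (hdv1.mul_left (Npoly p F ^ j)) (hdv.mul_left (Npoly p F ^ j * X 1))).trans (dvd_of_eq ?_)
    unfold mo
    ring
  rw [C_mul', Submodule.smul_mem_iff _ hcne] at h4
  refine mo_Bb hpq ⟨2 - b', ?_⟩ h4
  subst hpq
  have h5 : (1 + 2 * k' + (6 * q + 1) * b' + 3 * j : ℤ) = 2 * (6 * q + 1) := by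
    exact_mod_cast hkb
  push_cast
  linear_combination h5

lemma mo_all (hp : 3 < p) (hA : GA p F A) (q : ℕ) (hpq : p = 6 * q + 1) (j i k b : ℕ) (hj : 1 ≤ j)
    (hok : okw q j i k b) (hbad : ¬ badE p i k b) : mo p F j i k b ∈ Bb A :=
  claimC q p (by omega) hpq (fun j i k b => mo p F j i k b ∈ Bb A) (mo_hD hA) (mo_hL hp hA) (mo_hdel hp hA q hpq)
    (mo_hK1 hp hA q hpq) (mo_hK2 hp hA q hpq) (mo_base0 hp hA q hpq) (fun j _ => mo_base1 hp hA j)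
    (mo_fam2 hp hA q hpq) (mo_fam1 hp hA q hpq) (mo_fam3 hp hA q hpq) (mo_rel hp q hpq) j i k b hj hok hbad

/-- Lemma Q -/
lemma lemmaQ (hp : 3 < p) (hA : GA p F A) (q : ℕ) (hpq : p = 6 * q + 1) : ∀ (e j : ℕ) (f : MvPolynomial (Fin 4) F),
    1 ≤ j → f.IsHomogeneous e → (∀ s : ZMod p, act p F !![1, s; 0, 1] f = f) →
    (∀ w : ZMod p, w ≠ 0 → C (cF p F w ^ (3 * j)) * act p F !![w, 0; 0, w⁻¹] f = f) →
    Npoly p F ^ j * f ∈ Bb A := by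
  intro e
  induction e using Nat.strong_induction_on with
  | _ e ih =>
    intro j f hj hf hu hr
    obtain ⟨f', r, hfr, hdeg, hrh, hqh, hlt⟩ := N_div_hom (p := p) hf
    have hu2 : ∀ s : ZMod p, act p F !![1, s; 0, 1] f' = f' ∧ act p F !![1, s; 0, 1] r = r := by
      intro s
      have := N_div_sym hfr hdeg !![1, s; 0, 1] (deg_act_u s _) 1 1 (by rw [act_u_N]; simp) (by rw [hu s]; simp)
      simpa using this
    have hr2 : ∀ w : ZMod p, w ≠ 0 → C (cF p F w ^ (3 * j) * cF p F w ^ 3) * act p F !![w, 0; 0, w⁻¹] f' = f' ∧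
        C (cF p F w ^ (3 * j)) * act p F !![w, 0; 0, w⁻¹] r = r := by
      intro w hw
      exact N_div_sym hfr hdeg _ (deg_act_rho w hw _) _ _ (act_rho_N w hw) (hr w hw)
    have h1 : Npoly p F ^ j * (Npoly p F * f') ∈ Bb A := by
      by_cases hd : e < p
      · rw [hlt hd]; simp
      · obtain ⟨e', rfl⟩ : ∃ e', e = p + e' := ⟨e - p, by omega⟩
        have := ih e' (by omega) (j + 1) f' (by omega) (hqh e' rfl) (fun s => (hu2 s).1) (fun w hw => by
          rw [mul_add, mul_one, pow_add]; exact (hr2 w hw).1)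
        rwa [pow_succ, mul_assoc] at this
    have h2 : Npoly p F ^ j * r ∈ WW p A := by
      have hT : TF p F e r := ⟨hrh, hdeg, fun s => by rw [(hu2 s).2, sub_self]; exact dvd_zero _⟩
      have := TF.span hp (WW p A) WW_dvd (Npoly p F ^ j) e r hT 0 (by
        intro i k b hd hne
        rw [zero_add]
        refine mo_WW hpq (fun hok => mo_all hp hA q hpq j i k b hj hok ?_)
        rintro ⟨rfl, hi, hik⟩
        rw [mul_zero, add_zero] at hd
        exact hne (by omega) (bad_vanish hp (fun s => (hu2 s).2) hrh i k hd hi hik))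
      rwa [pow_zero, one_mul] at this
    rw [mem_WW, eproj_of_fixed] at h2
    · rw [hfr, mul_add]
      exact add_mem h1 h2
    · intro w hw
      rw [map_mul, map_pow, act_rho_N w hw]
      conv_rhs => rw [← (hr2 w hw).2]
      rw [mul_pow, ← map_pow, ← pow_mul]
      ring

end S14

section S15
variable {p : ℕ} [Fact p.Prime] {F : Type} [Field F] [CharP F p]
variable {A : Subalgebra F (MvPolynomial (Fin 4) F)}

/-- restrictions to the plane of homogeneous elements of `A` -/
def VV (A : Subalgebra F (MvPolynomial (Fin 4) F)) (d : ℕ) : Submodule F (Polynomial F) :=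
  Submodule.map (ev F).toLinearMap (Subalgebra.toSubmodule A ⊓ homogeneousSubmodule (Fin 4) F d)

lemma mem_VV {d : ℕ} {v : Polynomial F} : v ∈ VV A d ↔ ∃ g ∈ A, g.IsHomogeneous d ∧ ev F g = v := by
  unfold VV
  rw [Submodule.mem_map]
  constructor
  · rintro ⟨g, ⟨h1, h2⟩, h3⟩
    exact ⟨g, h1, h2, h3⟩
  · rintro ⟨g, h1, h2, h3⟩
    exact ⟨g, ⟨h1, h2⟩, h3⟩

lemma VV_mul {d e : ℕ} {v w : Polynomial F} (hv : v ∈ VV A d) (hw : w ∈ VV A e) : v * w ∈ VV A (d + e) := by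
  rw [mem_VV] at *
  obtain ⟨g, h1, h2, h3⟩ := hv
  obtain ⟨g', h1', h2', h3'⟩ := hw
  exact ⟨g * g', mul_mem h1 h1', h2.mul h2', by rw [map_mul, h3, h3']⟩

lemma VV_C {d : ℕ} {v : Polynomial F} {c : F} (hc : c ≠ 0) (hv : Polynomial.C c * v ∈ VV A d) : v ∈ VV A d := by
  rwa [← Polynomial.smul_eq_C_mul, Submodule.smul_mem_iff _ hc] at hv

lemma D_hom : (Dpoly F).IsHomogeneous 4 := by
  have x := fun i : Fin 4 => isHomogeneous_X F i
  have h1 := (((x 2).pow 2).mul ((x 1).pow 2)).C_mul 3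
  have h2 := ((x 3).mul ((x 1).pow 3)).C_mul 4
  have h3 := (((x 2).pow 3).mul (x 0)).C_mul 4
  have h4 := ((((x 3).mul (x 2)).mul (x 1)).mul (x 0)).C_mul 6
  have h5 := (((x 3).pow 2).mul ((x 0).pow 2))
  have e : Dpoly F = C 3 * (X 2 ^ 2 * X 1 ^ 2) - C 4 * (X 3 * X 1 ^ 3) - C 4 * (X 2 ^ 3 * X 0)
    + C 6 * (X 3 * X 2 * X 1 * X 0) - X 3 ^ 2 * X 0 ^ 2 := by
    have h6 : (C 6 : MvPolynomial (Fin 4) F) = 6 := map_ofNat C 6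
    rw [C_three, C_four, h6]
    unfold Dpoly
    ring
  rw [e]
  exact (((h1.sub h2).sub h3).add h4).sub h5

lemma L_hom : (Lpoly p F).IsHomogeneous (p + 1) := by
  have x := fun i : Fin 4 => isHomogeneous_X F i
  have h1 := (((x 2).pow p).mul (x 1))
  have h2 := ((x 2).mul ((x 1).pow p))
  have h3 := (((x 3).pow p).mul (x 0))
  have h4 := ((x 3).mul ((x 0).pow p))
  rw [one_mul] at h1 h2 h3 h4
  rw [add_comm] at h2 h4
  have h5 := (h1.sub h2).C_mul 3
  rw [C_three] at h5
  exact h5.sub (h3.sub h4)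

lemma VV_X2 (hp : 3 < p) (hA : GA p F A) : (Polynomial.X ^ 2 : Polynomial F) ∈ VV A 4 := by
  apply VV_C (three_ne (F := F) hp)
  refine mem_VV.mpr ⟨_, hA.D, D_hom, ?_⟩
  have e7 : (Polynomial.C 3 : Polynomial F) = 3 := map_ofNat _ 3
  simp [ev, Dpoly, e7]

lemma VV_X2n (hp : 3 < p) (hA : GA p F A) (n : ℕ) : (Polynomial.X ^ (2 * n) : Polynomial F) ∈ VV A (4 * n) := by
  induction n with
  | zero => exact mem_VV.mpr ⟨1, one_mem _, isHomogeneous_one _ _, by simp⟩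
  | succ n ih =>
    have := VV_mul ih (VV_X2 hp hA)
    rw [← pow_add] at this
    exact this

lemma VV_K (hp : 3 < p) (hA : GA p F A) : (1 + Polynomial.X ^ (p - 1) : Polynomial F) ∈ VV A (p - 1) :=
  mem_VV.mpr ⟨_, hA.K, K_hom, by rw [ev_K hp, add_comm]⟩

lemma VV_L (hp : 3 < p) (hA : GA p F A) : (Polynomial.X - Polynomial.X ^ p : Polynomial F) ∈ VV A (p + 1) := by
  apply VV_C (three_ne (F := F) hp)
  refine mem_VV.mpr ⟨_, hA.L, L_hom, ?_⟩
  have e7 : (Polynomial.C 3 : Polynomial F) = 3 := map_ofNat _ 3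
  have h0 : (0 : Polynomial F) ^ p = 0 := zero_pow (by omega)
  simp [ev, Lpoly, e7, h0]

lemma VV_even (hp : 3 < p) (hA : GA p F A) (q : ℕ) (hpq : p = 6 * q + 1) (c : ℕ) :
    (1 + Polynomial.X ^ (c * (p - 1)) : Polynomial F) ∈ VV A (c * (p - 1)) ∧
    (1 + Polynomial.X ^ ((c + 1) * (p - 1)) : Polynomial F) ∈ VV A ((c + 1) * (p - 1)) := by
  induction c with
  | zero =>
    constructor
    · refine mem_VV.mpr ⟨2, by rw [← C_two]; exact Subalgebra.algebraMap_mem _ _, ?_, ?_⟩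
      · rw [← C_two, zero_mul]; exact isHomogeneous_C _ _
      · rw [map_ofNat, zero_mul, pow_zero]; norm_num
    · rw [zero_add, one_mul]; exact VV_K hp hA
  | succ c ih =>
    refine ⟨ih.2, ?_⟩
    have h1 := VV_mul (VV_K hp hA) ih.2
    have h2 := VV_mul (VV_X2n hp hA (3 * q)) ih.1
    rw [show 2 * (3 * q) = p - 1 by omega, show 4 * (3 * q) = (p - 1) + (p - 1) by omega] at h2
    rw [show p - 1 + (c + 1) * (p - 1) = (c + 1 + 1) * (p - 1) by ring] at h1
    rw [show p - 1 + (p - 1) + c * (p - 1) = (c + 1 + 1) * (p - 1) by ring] at h2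
    convert sub_mem h1 h2 using 1
    rw [add_mul, add_mul, one_mul, pow_add, pow_add]
    ring

lemma VV_odd (hp : 3 < p) (hA : GA p F A) (q : ℕ) (hpq : p = 6 * q + 1) (c : ℕ) :
    (Polynomial.X - Polynomial.X ^ (1 + c * (p - 1)) : Polynomial F) ∈ VV A (2 + c * (p - 1)) ∧
    (Polynomial.X - Polynomial.X ^ (1 + (c + 1) * (p - 1)) : Polynomial F) ∈ VV A (2 + (c + 1) * (p - 1)) := by
  induction c with
  | zero =>
    constructor
    · simp
    · rw [zero_add, one_mul, show 1 + (p - 1) = p by omega, show 2 + (p - 1) = p + 1 by omega]; exact VV_L hp hA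
  | succ c ih =>
    refine ⟨ih.2, ?_⟩
    have h1 := VV_mul (VV_K hp hA) ih.2
    have h2 := VV_mul (VV_X2n hp hA (3 * q)) ih.1
    rw [show 2 * (3 * q) = p - 1 by omega, show 4 * (3 * q) = (p - 1) + (p - 1) by omega] at h2
    rw [show p - 1 + (2 + (c + 1) * (p - 1)) = 2 + (c + 1 + 1) * (p - 1) by ring] at h1
    rw [show p - 1 + (p - 1) + (2 + c * (p - 1)) = 2 + (c + 1 + 1) * (p - 1) by ring] at h2
    convert sub_mem h1 h2 using 1
    simp only [add_mul, one_mul, pow_add]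
    ring

lemma VV_T (hp : 3 < p) (hA : GA p F A) (q : ℕ) (hpq : p = 6 * q + 1) (x c : ℕ) :
    (Polynomial.X ^ x + (-1) ^ x * Polynomial.X ^ (x + c * (p - 1)) : Polynomial F) ∈ VV A (2 * x + c * (p - 1)) := by
  rcases Nat.even_or_odd x with hx | hx
  · obtain ⟨y, rfl⟩ := even_iff_exists_two_mul.mp hx
    have := VV_mul (VV_X2n hp hA y) (VV_even hp hA q hpq c).1
    rw [hx.neg_one_pow, show 2 * (2 * y) = 4 * y by ring]
    convert this using 1
    rw [pow_add]; ring
  · obtain ⟨y, rfl⟩ := hx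
    have := VV_mul (VV_X2n hp hA y) (VV_odd hp hA q hpq c).1
    rw [show (-1 : Polynomial F) ^ (2 * y + 1) = -1 from Odd.neg_one_pow ⟨y, rfl⟩,
      show 2 * (2 * y + 1) + c * (p - 1) = 4 * y + (2 + c * (p - 1)) by ring]
    convert this using 1
    simp only [pow_add]
    ring

lemma torus_coeff {f : MvPolynomial (Fin 4) F} (hf : f ∈ invariants p F) {d : ℕ} (hd : f.IsHomogeneous d) (i : ℕ)
    (hi : i ≤ d) (h : (ev F f).coeff i ≠ 0) : p - 1 ∣ (d - i) + (p - 2) * i := by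
  have h1 : ∀ w : (ZMod p)ˣ, cF p F w ^ ((d - i) + (p - 2) * i) = 1 := by
    intro w
    have e1 := aeval_act (F := F) (![0, Polynomial.X, 1, 0] : Fin 4 → Polynomial F) !![(w : ZMod p), 0; 0, (w : ZMod p)⁻¹] f
    rw [inv_rho hf _ w.ne_zero, ptAct_rho _ _ w.ne_zero] at e1
    have e2 := plane (Polynomial.C (cF p F (w : ZMod p)⁻¹) * Polynomial.X : Polynomial F) (Polynomial.C (cF p F w)) hd
    have e3 : ev F f = ∑ i ∈ Finset.range (d + 1), Polynomial.C ((ev F f).coeff i) *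
        (Polynomial.C (cF p F (w : ZMod p)⁻¹) * Polynomial.X) ^ i * Polynomial.C (cF p F w) ^ (d - i) := by
      refine Eq.trans ?_ e2
      refine Eq.trans e1 ?_
      congr 2
      funext i
      fin_cases i <;> simp [-ZMod.inv_coe_unit, -Units.val_inv_eq_inv_val, -map_units_inv, -map_inv₀]
    have e4 := congrArg (fun P => Polynomial.coeff P i) e3
    simp only [Polynomial.finset_sum_coeff] at e4
    rw [Finset.sum_eq_single i] at e4
    · rw [mul_pow, ← mul_assoc, mul_assoc, mul_comm (Polynomial.X ^ i), ← mul_assoc, ← map_pow Polynomial.C, ← map_pow Polynomial.C, ← map_mul, ← map_mul,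
        Polynomial.coeff_C_mul_X_pow, if_pos rfl, mul_assoc] at e4
      have e5 := mul_left_cancel₀ h ((mul_one _).trans e4)
      rw [cF_inv_eq _ w.ne_zero, ← pow_mul, ← pow_add, add_comm] at e5
      exact e5.symm
    · intro b _ hb
      rw [mul_pow, ← mul_assoc, mul_assoc, mul_comm (Polynomial.X ^ b), ← mul_assoc, ← map_pow Polynomial.C, ← map_pow Polynomial.C, ← map_mul, ← map_mul,
        Polynomial.coeff_C_mul_X_pow, if_neg hb.symm]
    · intro h; simp at h; omega
  have h2 := sum_units_pow (p := p) (F := F) ((d - i) + (p - 2) * i)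
  rw [Finset.sum_congr rfl (fun w _ => h1 w)] at h2
  by_contra h3
  rw [if_neg h3] at h2
  have h4 := sum_units_pow (p := p) (F := F) 0
  rw [if_pos (dvd_zero _)] at h4
  simp only [pow_zero] at h4
  rw [h4] at h2
  exact neg_ne_zero.mpr one_ne_zero h2

lemma eta_coeff {f : MvPolynomial (Fin 4) F} (hf : f ∈ invariants p F) {d : ℕ} (hd : f.IsHomogeneous d) :
    ev F f = ∑ i ∈ Finset.range (d + 1), Polynomial.C ((ev F f).coeff i) * ((-1) ^ (d - i) * Polynomial.X ^ (d - i)) := by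
  have e1 := aeval_act (F := F) (![0, Polynomial.X, 1, 0] : Fin 4 → Polynomial F) !![(0 : ZMod p), 1; -1, 0] f
  rw [inv_eta hf, ptAct_eta] at e1
  have e2 := plane (1 : Polynomial F) (- Polynomial.X) hd
  refine Eq.trans (Eq.trans e1 ?_) (e2.trans ?_)
  · congr 2
    funext i
    fin_cases i <;> simp
  · apply Finset.sum_congr rfl
    intro i _
    rw [one_pow, mul_one, neg_pow]
    rfl

lemma plane_VV (hp : 3 < p) (hA : GA p F A) (q : ℕ) (hpq : p = 6 * q + 1) {f : MvPolynomial (Fin 4) F}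
    (hf : f ∈ invariants p F) {d : ℕ} (hd : f.IsHomogeneous d) : ev F f ∈ VV A d := by
  apply VV_C (two_ne (F := F) hp)
  have h1 := ev_eq_sum hd
  have h2 := eta_coeff hf hd
  have h3 : Polynomial.C 2 * ev F f = ∑ i ∈ Finset.range (d + 1), Polynomial.C ((ev F f).coeff i) *
      (Polynomial.X ^ i + (-1) ^ (d - i) * Polynomial.X ^ (d - i)) := by
    simp only [mul_add]
    rw [Finset.sum_add_distrib, ← h1, ← h2]
    have e2 : (2 : Polynomial F) = Polynomial.C 2 := (map_ofNat _ 2).symm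
    rw [← e2]; ring
  rw [h3]
  refine Submodule.sum_mem _ ?_
  intro i hi
  rw [Finset.mem_range] at hi
  by_cases h0 : (ev F f).coeff i = 0
  · rw [h0, map_zero, zero_mul]; exact zero_mem _
  rw [← Polynomial.smul_eq_C_mul]
  apply Submodule.smul_mem
  obtain ⟨c, hc⟩ := torus_coeff hf hd i (by omega) h0
  have hc2 : ((d : ℤ) - i) + (6 * q - 1) * i = 6 * q * c := by
    have e1 : ((d - i : ℕ) : ℤ) = d - i := by omega
    have e2 : ((p - 1 : ℕ) : ℤ) = 6 * q := by omega
    have e3 : ((p - 2 : ℕ) : ℤ) = 6 * q - 1 := by omega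
    have := congrArg (Nat.cast : ℕ → ℤ) hc
    push_cast at this
    rw [e1, e2, e3] at this
    exact this
  rcases Nat.le_total i (d - i) with hle | hle
  · obtain ⟨n, hn⟩ : ∃ n : ℕ, d = 2 * i + n * (p - 1) := by
      have hdv : p - 1 ∣ d - 2 * i := by
        rw [← Int.natCast_dvd_natCast]
        refine ⟨c - i, ?_⟩
        rw [show ((p - 1 : ℕ) : ℤ) = 6 * q by omega, show ((d - 2 * i : ℕ) : ℤ) = d - 2 * i by omega]
        linear_combination hc2
      obtain ⟨n, hn⟩ := hdv
      exact ⟨n, by rw [mul_comm n]; omega⟩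
    have := VV_T hp hA q hpq i n
    rw [hn, show 2 * i + n * (p - 1) - i = i + n * (p - 1) by omega]
    rw [show (-1 : Polynomial F) ^ (i + n * (p - 1)) = (-1) ^ i by
      rw [pow_add, show n * (p - 1) = 2 * (n * (3 * q)) by rw [show p - 1 = 2 * (3 * q) by omega]; ring, pow_mul]; simp]
    exact this
  · obtain ⟨x, hx⟩ : ∃ x, x + i = d := ⟨d - i, by omega⟩
    obtain ⟨n, hn⟩ : ∃ n : ℕ, i = x + n * (p - 1) := by
      have hdv : p - 1 ∣ i - x := by
        rw [← Int.natCast_dvd_natCast]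
        refine ⟨i - c, ?_⟩
        rw [show ((p - 1 : ℕ) : ℤ) = 6 * q by omega, show ((i - x : ℕ) : ℤ) = 2 * i - d by omega]
        linear_combination - hc2
      obtain ⟨n, hn⟩ := hdv
      exact ⟨n, by rw [mul_comm n]; omega⟩
    have := VV_T hp hA q hpq x n
    rw [← hn, show 2 * x + n * (p - 1) = d by omega] at this
    rw [show d - i = x by omega]
    have h4 : (-1 : Polynomial F) ^ x * (-1) ^ x = 1 := by rw [← mul_pow]; simp
    rcases Nat.even_or_odd x with hxe | hxe
    · rw [hxe.neg_one_pow, one_mul] at this ⊢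
      rwa [add_comm]
    · rw [hxe.neg_one_pow] at this ⊢
      have := neg_mem this
      convert this using 1
      ring

lemma inv_Bb (hp : 3 < p) (hA : GA p F A) (q : ℕ) (hpq : p = 6 * q + 1) {f : MvPolynomial (Fin 4) F}
    (hf : f ∈ invariants p F) {d : ℕ} (hd : f.IsHomogeneous d) : f ∈ Bb A := by
  obtain ⟨g, hg, hgd, hge⟩ := mem_VV.mp (plane_VV hp hA q hpq hf hd)
  have hfg : f - g ∈ invariants p F := sub_mem hf (hA.le hg)
  have hhom := hd.sub hgd
  have hev : ev F (f - g) = 0 := by rw [map_sub, hge, sub_self]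
  suffices f - g ∈ Bb A by
    have := add_mem this (Bb_of_mem hg)
    rwa [sub_add_cancel] at this
  obtain ⟨f', r, hfr, hdeg, hrh, hqh, hlt⟩ := N_div_hom (p := p) hhom
  have hu2 : ∀ s : ZMod p, act p F !![1, s; 0, 1] f' = f' ∧ act p F !![1, s; 0, 1] r = r := by
    intro s
    have := N_div_sym hfr hdeg !![1, s; 0, 1] (deg_act_u s _) 1 1 (by rw [act_u_N]; simp) (by rw [inv_u hfg s]; simp)
    simpa using this
  have hr2 : ∀ w : ZMod p, w ≠ 0 → C (1 * cF p F w ^ 3) * act p F !![w, 0; 0, w⁻¹] f' = f' := by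
    intro w hw
    exact (N_div_sym hfr hdeg _ (deg_act_rho w hw _) 1 _ (act_rho_N w hw) (by rw [inv_rho hfg w hw]; simp)).1
  have h1 : Npoly p F * f' ∈ Bb A := by
    by_cases hd : d < p
    · rw [hlt hd]; simp
    · obtain ⟨e', rfl⟩ : ∃ e', d = p + e' := ⟨d - p, by omega⟩
      have := lemmaQ hp hA q hpq e' 1 f' le_rfl (hqh e' rfl) (fun s => (hu2 s).1) (fun w hw => by
          have := hr2 w hw; rwa [one_mul] at this)
      rwa [pow_one] at this
  have h2 : X 0 ∣ r := by
    apply inj_TF hp (d := d) ⟨hrh, hdeg, fun s => by rw [(hu2 s).2, sub_self]; exact dvd_zero _⟩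
    rw [hfr, map_add, map_mul, ev_N, zero_mul, zero_add] at hev
    exact hev
  rw [hfr]
  exact add_mem h1 (Bb_of_dvd h2)

end S15

section S16
variable {p : ℕ} [Fact p.Prime] {F : Type} [Field F] [CharP F p]
variable {A : Subalgebra F (MvPolynomial (Fin 4) F)}

lemma e_hom : (epoly F).IsHomogeneous 3 := by
  have x := fun i : Fin 4 => isHomogeneous_X F i
  have h1 := ((x 1).pow 3).C_mul 2
  have h2 := ((x 0).mul (x 3)).mul (x 0)
  have h3 := (((x 0).mul (x 2)).mul (x 1)).C_mul 3
  have e : epoly F = C 2 * X 1 ^ 3 + (X 0 * X 3 * X 0 - C 3 * (X 0 * X 2 * X 1)) := by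
    rw [C_two, C_three]
    unfold epoly
    ring
  rw [e]
  exact h1.add (h2.sub h3)

/-- the subalgebra generated by homogeneous elements is graded -/
lemma hcomp_adjoin {S : Set (MvPolynomial (Fin 4) F)} (hS : ∀ s ∈ S, ∃ n, s.IsHomogeneous n)
    {f : MvPolynomial (Fin 4) F} (hf : f ∈ Algebra.adjoin F S) :
    ∀ d, homogeneousComponent d f ∈ Algebra.adjoin F S := by
  induction hf using Algebra.adjoin_induction with
  | mem x hx =>
    intro d
    obtain ⟨n, hn⟩ := hS x hx
    rw [homogeneousComponent_of_mem hn]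
    split_ifs
    · exact Algebra.subset_adjoin hx
    · exact zero_mem _
  | algebraMap r =>
    intro d
    rw [algebraMap_eq, homogeneousComponent_of_mem (isHomogeneous_C (Fin 4) r)]
    split_ifs
    · exact Subalgebra.algebraMap_mem _ r
    · exact zero_mem _
  | add x y _ _ hx hy =>
    intro d
    rw [map_add]
    exact add_mem (hx d) (hy d)
  | mul x y _ _ hx hy =>
    intro d
    rw [← sum_homogeneousComponent x, Finset.sum_mul, map_sum]
    refine sum_mem fun i _ => ?_
    by_cases h : d < i
    · rw [hcomp_mul_lt (homogeneousComponent_isHomogeneous i x) d h]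
      exact zero_mem _
    · obtain ⟨k, rfl⟩ := Nat.exists_eq_add_of_le (not_lt.mp h)
      rw [hcomp_mul (homogeneousComponent_isHomogeneous i x) k]
      exact mul_mem (hx i) (hy k)

lemma act_u_neg (s : ZMod p) (f : MvPolynomial (Fin 4) F) :
    act p F !![1, s; 0, 1] (act p F !![1, -s; 0, 1] f) = f := by
  rw [act_act, u_mul_u, add_neg_cancel, one_eq, act_one]

/-- unipotent elements as automorphisms -/
def uEquiv (p : ℕ) [Fact p.Prime] (F : Type) [Field F] [CharP F p] (s : ZMod p) :
    MvPolynomial (Fin 4) F ≃ₐ[F] MvPolynomial (Fin 4) F :=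
  AlgEquiv.ofAlgHom (act p F !![1, s; 0, 1]) (act p F !![1, -s; 0, 1])
    (AlgHom.ext fun f => act_u_neg s f)
    (AlgHom.ext fun f => by
      have := act_u_neg (-s) f
      rw [neg_neg] at this
      exact this)

lemma l_prime (s : ZMod p) : Prime (act p F !![1, s; 0, 1] (X 3)) := by
  have h : Prime (X 3 : MvPolynomial (Fin 4) F) := X_prime
  exact (MulEquiv.prime_iff (uEquiv p F s)).mpr h

lemma l_not_dvd {s t : ZMod p} (h : s ≠ t) :
    ¬ act p F !![1, s; 0, 1] (X 3) ∣ act p F !![1, t; 0, 1] (X 3) := by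
  intro hd
  have h1 := map_dvd (act p F !![1, -s; 0, 1]) hd
  rw [act_act, act_act, u_mul_u, u_mul_u, neg_add_cancel, one_eq, act_one] at h1
  have h2 := map_dvd (aeval (![1, 0, 0, 0] : Fin 4 → F)) h1
  rw [act_X3] at h2
  simp at h2
  apply h
  have h3 : cF p F (-s + t) = 0 := by
    rw [map_add, map_neg]
    exact h2
  have h4 := (map_eq_zero (cF p F)).mp h3
  exact (neg_add_eq_zero.mp h4)

lemma X0_rel (s : ZMod p) : IsRelPrime (act p F !![1, s; 0, 1] (X 3)) (X 0) := by
  have h : Prime (X 0 : MvPolynomial (Fin 4) F) := X_prime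
  refine IsRelPrime.symm ((Irreducible.isRelPrime_iff_not_dvd h.irreducible).mpr ?_)
  intro hd
  have h2 := map_dvd (aeval (![0, 0, 0, 1] : Fin 4 → F)) hd
  rw [act_X3] at h2
  simp at h2

lemma NX0_dvd {f : MvPolynomial (Fin 4) F} (hf : f ∈ invariants p F) (h : X 0 ∣ f) :
    Npoly p F * X 0 ∣ f := by
  have h3 : X 3 ∣ f := by
    have h1 := map_dvd (act p F !![0, 1; -1, 0]) h
    rw [inv_eta hf, act_X0] at h1
    simpa using h1
  have hl : ∀ s : ZMod p, act p F !![1, s; 0, 1] (X 3) ∣ f := by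
    intro s
    have h1 := map_dvd (act p F !![1, s; 0, 1]) h3
    rwa [inv_u hf] at h1
  have hN : Npoly p F ∣ f := by
    unfold Npoly
    apply Finset.prod_dvd_of_isRelPrime
    · intro s _ t _ hst
      exact (Irreducible.isRelPrime_iff_not_dvd (l_prime s).irreducible).mpr (l_not_dvd hst)
    · intro s _
      exact hl s
  refine IsRelPrime.mul_dvd ?_ hN h
  unfold Npoly
  exact IsRelPrime.prod_left fun s _ => X0_rel s

lemma hcomp_inv {f : MvPolynomial (Fin 4) F} (hf : f ∈ invariants p F) (d : ℕ) :
    homogeneousComponent d f ∈ invariants p F := by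
  intro g
  rw [← hcomp_act, hf g]

lemma hcomp_self {f : MvPolynomial (Fin 4) F} {d : ℕ} (hf : f.IsHomogeneous d) :
    homogeneousComponent d f = f := by
  rw [homogeneousComponent_of_mem hf, if_pos rfl]

lemma inv_mem_hom (hp : 3 < p) (hA : GA p F A) (q : ℕ) (hpq : p = 6 * q + 1)
    (hgr : ∀ a ∈ A, ∀ d, homogeneousComponent d a ∈ A) :
    ∀ (d : ℕ) (f : MvPolynomial (Fin 4) F), f ∈ invariants p F → f.IsHomogeneous d → f ∈ A := by
  intro d
  induction d using Nat.strong_induction_on with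
  | _ d ih =>
    intro f hf hd
    obtain ⟨a, ha, hdv⟩ := mem_Bb.mp (inv_Bb hp hA q hpq hf hd)
    obtain ⟨h, hh⟩ := NX0_dvd (sub_mem hf (hA.le ha)) hdv
    have hNX : (Npoly p F * X 0).IsHomogeneous (p + 1) := N_hom.mul (isHomogeneous_X F 0)
    have hne : Npoly p F * X 0 ≠ 0 := mul_ne_zero N_ne (X_ne_zero 0)
    have hinv : h ∈ invariants p F := by
      intro g
      have h1 : Npoly p F * X 0 * h ∈ invariants p F := by
        rw [← hh]; exact sub_mem hf (hA.le ha)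
      have h2 := h1 g
      rw [map_mul, NX0_mem hp g] at h2
      exact mul_left_cancel₀ hne h2
    have hc := congrArg (homogeneousComponent d) hh
    rw [map_sub, hcomp_self hd] at hc
    have e1 : f = homogeneousComponent d a + homogeneousComponent d (Npoly p F * X 0 * h) := by
      rw [← hc]; ring
    rw [e1]
    refine add_mem (hgr a ha d) ?_
    by_cases hlt : d < p + 1
    · rw [hcomp_mul_lt hNX d hlt]
      exact zero_mem _
    · obtain ⟨k, rfl⟩ := Nat.exists_eq_add_of_le (not_lt.mp hlt)
      rw [hcomp_mul hNX k]
      exact mul_mem hA.NX (ih k (by omega) _ (hcomp_inv hinv k) (homogeneousComponent_isHomogeneous k h))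

lemma inv_mem_all (hp : 3 < p) (hA : GA p F A) (q : ℕ) (hpq : p = 6 * q + 1)
    (hgr : ∀ a ∈ A, ∀ d, homogeneousComponent d a ∈ A) : invariants p F ≤ A := by
  intro f hf
  rw [← sum_homogeneousComponent f]
  exact sum_mem fun i _ => inv_mem_hom hp hA q hpq hgr i _ (hcomp_inv hf i)
    (homogeneousComponent_isHomogeneous i f)

end S16

/-- for `p ≡ 1 (mod 3)`, `F[V]^{SL₂(F_p)}` is generated as an `F`-algebra by
`D, K, L, N·a₀, δ = tr_B^G(N^{(p-1)/3}), ẽ = tr_B^G(N·e)` together with the transfers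
`tr^G(N^j a₂^{(m-1)(p-1)-3j} a₃^{p-1})` for `1 ≤ j ≤ (p-4)/3`,
`tr^G(N^j a₃^{p-1-j})` for `1 ≤ j ≤ (p-4)/3`, and
`tr^G(N^j a₃^{p-2} a₂^{(m-1)(p-1)+3-3j})` for `2 ≤ j ≤ (p-4)/3`,
where `m = 2 + ⌊3j/(p-1)⌋`. -/
theorem generators_one_mod_three (p : ℕ) [Fact p.Prime] (hp : 3 < p) (hp3 : p % 3 = 1)
    (F : Type) [Field F] [CharP F p] :
    invariants p F = Algebra.adjoin F (
      ({Dpoly F, Kpoly p F, Lpoly p F, Npoly p F * X 0,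
        trBG p F (Npoly p F ^ ((p - 1) / 3)), trBG p F (Npoly p F * epoly F)} :
          Set (MvPolynomial (Fin 4) F)) ∪
      (fun j : ℕ => trG p F (Npoly p F ^ j *
          (X 2 ^ ((2 + 3 * j / (p - 1) - 1) * (p - 1) - 3 * j) * X 3 ^ (p - 1)))) ''
        (Set.Icc 1 ((p - 4) / 3)) ∪
      (fun j : ℕ => trG p F (Npoly p F ^ j * X 3 ^ (p - 1 - j))) ''
        (Set.Icc 1 ((p - 4) / 3)) ∪
      (fun j : ℕ => trG p F (Npoly p F ^ j *
          (X 3 ^ (p - 2) * X 2 ^ ((2 + 3 * j / (p - 1) - 1) * (p - 1) + 3 - 3 * j)))) ''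
        (Set.Icc 2 ((p - 4) / 3))) := by
  have hj : ∀ j, j ≤ (p - 4) / 3 → 3 * j / (p - 1) = 0 := by
    intro j hj
    apply Nat.div_eq_of_lt
    omega
  obtain ⟨q, hpq⟩ : ∃ q, p = 6 * q + 1 := by
    have h2 : p % 2 = 1 := by
      rcases (Fact.out : p.Prime).eq_two_or_odd with h | h
      · omega
      · exact h
    exact ⟨p / 6, by omega⟩
  have x := fun i : Fin 4 => isHomogeneous_X F i
  apply le_antisymm
  · refine inv_mem_all hp (q := q) ?_ hpq (fun a ha => hcomp_adjoin ?_ ha)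
    · refine ⟨?_, ?_, ?_, ?_, ?_, ?_, ?_, ?_, ?_, ?_⟩
      · exact Algebra.subset_adjoin (by simp)
      · exact Algebra.subset_adjoin (by simp)
      · exact Algebra.subset_adjoin (by simp)
      · exact Algebra.subset_adjoin (by simp)
      · exact Algebra.subset_adjoin (by simp)
      · exact Algebra.subset_adjoin (by simp)
      · intro j h1 h2
        refine Algebra.subset_adjoin (Or.inl (Or.inl (Or.inr ⟨j, ⟨h1, h2⟩, ?_⟩)))
        simp only [hj j h2, add_zero, Nat.add_one_sub_one, Nat.reduceSub, one_mul]
      · intro j h1 h2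
        exact Algebra.subset_adjoin (Or.inl (Or.inr ⟨j, ⟨h1, h2⟩, rfl⟩))
      · intro j h1 h2
        refine Algebra.subset_adjoin (Or.inr ⟨j, ⟨h1, h2⟩, ?_⟩)
        have e : (2 + 3 * j / (p - 1) - 1) * (p - 1) + 3 - 3 * j = p + 2 - 3 * j := by
          rw [hj j h2]; omega
        simp only [e]
      · rw [Algebra.adjoin_le_iff]
        rintro s (((hs | ⟨j, _, rfl⟩) | ⟨j, _, rfl⟩) | ⟨j, _, rfl⟩)
        · rcases hs with rfl | rfl | rfl | rfl | rfl | rfl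
          · exact D_mem
          · exact K_mem
          · exact L_mem
          · exact NX0_mem hp
          · exact delta_mem hp3
          · exact Ne_mem
        · exact trG_mem _
        · exact trG_mem _
        · exact trG_mem _
    · rintro s (((hs | ⟨j, _, rfl⟩) | ⟨j, _, rfl⟩) | ⟨j, _, rfl⟩)
      · rcases hs with rfl | rfl | rfl | rfl | rfl | rfl
        · exact ⟨_, D_hom⟩
        · exact ⟨_, K_hom⟩
        · exact ⟨_, L_hom⟩
        · exact ⟨_, N_hom.mul (x 0)⟩
        · exact ⟨_, trBG_hom (N_hom.pow _)⟩
        · exact ⟨_, trBG_hom (N_hom.mul e_hom)⟩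
      · exact ⟨_, trG_hom ((N_hom.pow _).mul (((x 2).pow _).mul ((x 3).pow _)))⟩
      · exact ⟨_, trG_hom ((N_hom.pow _).mul ((x 3).pow _))⟩
      · exact ⟨_, trG_hom ((N_hom.pow _).mul (((x 3).pow _).mul ((x 2).pow _)))⟩
  · rw [Algebra.adjoin_le_iff]
    rintro s (((hs | ⟨j, _, rfl⟩) | ⟨j, _, rfl⟩) | ⟨j, _, rfl⟩)
    · rcases hs with rfl | rfl | rfl | rfl | rfl | rfl
      · exact D_mem
      · exact K_mem
      · exact L_mem
      · exact NX0_mem hp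
      · exact delta_mem hp3
      · exact Ne_mem
    · exact trG_mem _
    · exact trG_mem _
    · exact trG_mem _

end
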